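/- Let (R, m) be an analytically unramified Cohen-Macaulay local ring of dimension d ≥ 3, type t(R), infinite residue field. Let I be an ideal with closure(I) = m, J a minimal reduction of I, and suppose ē₃(I) = 0. Then e₀(I) − 1 + λ(closure(I²)/(J·closure(I))) ≤ ē₁(I) ≤ e₀(I) − 1 + t(R). -/

import Mathlib

set_option synthInstance.maxHeartbeats 1000000
set_option maxHeartbeats 2000000

open IsLocalRing Polynomial Finset

variable {R : Type*}

/-- `x` is integral over the ideal `I`: it satisfies an equation
`x^n + a₁ x^{n-1} + ⋯ + aₙ = 0` with `aᵢ ∈ Iⁱ`. -/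
def IsIntegralOverIdeal [CommRing R] (I : Ideal R) (x : R) : Prop :=
  ∃ n : ℕ, 0 < n ∧ ∃ a : ℕ → R, (∀ i ∈ Finset.Icc 1 n, a i ∈ I ^ i) ∧
    x ^ n + ∑ i ∈ Finset.Icc 1 n, a i * x ^ (n - i) = 0

/-- The integral closure of an ideal (the set of integral elements is an ideal,
so the span equals it). -/
def intCl [CommRing R] (I : Ideal R) : Ideal R :=
  Ideal.span {x | IsIntegralOverIdeal I x}

/-- Length of a module, as the Krull dimension of its lattice of submodules. -/
noncomputable def mlen (R M : Type*) [CommRing R] [AddCommGroup M] [Module R M] :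
    WithBot ℕ∞ :=
  Order.krullDim (Submodule R M)

/-- The quotient module `N/(K ∩ N)` for ideals `N K`. -/
abbrev idealQuot [CommRing R] (N K : Ideal R) :=
  N ⧸ (Submodule.comap N.subtype K)

/-- Depth of `M` with respect to the ideal `J`: sup of lengths of `M`-regular
sequences contained in `J`. -/
noncomputable def rdepth (A : Type*) [CommRing A] (J : Ideal A)
    (M : Type*) [AddCommGroup M] [Module A M] : ℕ∞ :=
  sSup {n : ℕ∞ | ∃ rs : List A, (rs.length : ℕ∞) = n ∧ (∀ x ∈ rs, x ∈ J) ∧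
    RingTheory.Sequence.IsRegular M rs}

/-- A local ring is Cohen-Macaulay if its depth equals its Krull dimension. -/
def IsCMLocal (R : Type*) [CommRing R] [IsLocalRing R] : Prop :=
  (rdepth R (maximalIdeal R) R : WithBot ℕ∞) = ringKrullDim R

/-- A local ring is analytically unramified if its `m`-adic completion is reduced. -/
def AnalyticallyUnramified (R : Type*) [CommRing R] [IsLocalRing R] : Prop :=
  IsReduced (AdicCompletion (maximalIdeal R) R)

/-- An ideal is `m`-primary. -/
def IsMPrimary [CommRing R] [IsLocalRing R] (I : Ideal R) : Prop :=
  I.radical = maximalIdeal R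

/-- `J ⊆ I` is a minimal reduction: generated by `d = dim R` elements and
`I^{n+1} = J I^n` for `n ≫ 0`. -/
def IsMinimalReduction [CommRing R] (d : ℕ) (J I : Ideal R) : Prop :=
  J ≤ I ∧ (∃ s : Fin d → R, J = Ideal.span (Set.range s)) ∧
    ∃ N : ℕ, ∀ n ≥ N, I ^ (n + 1) = J * I ^ n

/-- Normal Hilbert data: `L n = λ(R/ intCl(I^{n+1}))` and for `n ≫ 0` this agrees
with the polynomial whose normalized coefficients are the `e i`. -/
def NormalHilbertData [CommRing R] (d : ℕ) (I : Ideal R) (L : ℕ → ℕ) (e : ℕ → ℤ) : Prop :=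
  (∀ n, mlen R (R ⧸ intCl (I ^ (n + 1))) = (L n : WithBot ℕ∞)) ∧
    ∃ N : ℕ, ∀ n ≥ N, (L n : ℤ) =
      ∑ i ∈ Finset.range (d + 1), (-1 : ℤ) ^ i * e i * ((n + d - i).choose (d - i))

/-- `t` is the Cohen-Macaulay type of the local ring `R` of dimension `d`:
`t = λ((Q : m)/Q)` for every ideal `Q` generated by a maximal regular sequence in `m`. -/
def CMTypeData (R : Type*) [CommRing R] [IsLocalRing R] (d t : ℕ) : Prop :=
  ∀ s : List R, s.length = d → (∀ x ∈ s, x ∈ maximalIdeal R) →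
    RingTheory.Sequence.IsRegular R s →
      mlen R (idealQuot ((Ideal.span {x | x ∈ s}).colon (maximalIdeal R))
        (Ideal.span {x | x ∈ s})) = (t : WithBot ℕ∞)

/-- The quotient module `N/(K ∩ N)` for submodules `N K` of a module. -/
abbrev submoduleQuot {A M : Type*} [CommRing A] [AddCommGroup M] [Module A M]
    (N K : Submodule A M) :=
  N ⧸ (Submodule.comap N.subtype K)

section
set_option synthInstance.maxHeartbeats 1000000
set_option maxHeartbeats 2000000

open IsLocalRing Polynomial Finset

namespace NH

/-- asymptotic criterion for integrality over an ideal -/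
def AC {R : Type*} [CommRing R] (I : Ideal R) (x : R) : Prop :=
  ∃ r : ℕ, ∀ N : ℕ, x ^ (N + r) ∈ I ^ N

section
variable {R : Type*} [CommRing R]

theorem AC.of_integral {I : Ideal R} {x : R} (h : IsIntegralOverIdeal I x) : AC I x := by
  obtain ⟨n, hn, a, ha, he⟩ := h
  refine ⟨n - 1, fun N => ?_⟩
  induction N using Nat.strong_induction_on with
  | _ N ih =>
    rcases Nat.eq_zero_or_pos N with rfl | hN
    · simp
    have h1 : x ^ (N + (n - 1)) = - ∑ i ∈ Finset.Icc 1 n, a i * x ^ (n - i) * x ^ (N - 1) := by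
      have : N + (n - 1) = n + (N - 1) := by omega
      rw [this, pow_add, ← Finset.sum_mul]
      linear_combination x ^ (N - 1) * he
    rw [h1]
    refine neg_mem (Ideal.sum_mem _ fun i hi => ?_)
    have hi' := Finset.mem_Icc.1 hi
    by_cases hiN : i ≤ N
    · have h2 := ih (N - i) (by omega)
      have : a i * x ^ (n - i) * x ^ (N - 1) = a i * x ^ (N - i + (n - 1)) := by
        rw [mul_assoc, ← pow_add]; congr 2; omega
      rw [this]
      have h3 := Ideal.mul_mem_mul (ha i hi) h2
      rwa [← pow_add, Nat.add_sub_cancel' hiN] at h3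
    · rw [mul_assoc]
      exact Ideal.mul_mem_right _ _ (Ideal.pow_le_pow_right (by omega) (ha i hi))

theorem AC.to_integral [IsNoetherianRing R] {I : Ideal R} {x : R} (h : AC I x) :
    IsIntegralOverIdeal I x := by
  obtain ⟨r, hr⟩ := h
  let v : ℕ → reesAlgebra I := fun N =>
    ⟨monomial N (x ^ (N + r)), reesAlgebra.monomial_mem.2 (hr N)⟩
  let f : ℕ →o Ideal (reesAlgebra I) :=
    ⟨fun n => Ideal.span (v '' {j | j < n}), fun a b hab =>
      Ideal.span_mono (Set.image_mono fun j hj => lt_of_lt_of_le hj hab)⟩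
  have : IsNoetherianRing (reesAlgebra I) := inferInstance
  obtain ⟨n, hn⟩ := monotone_stabilizes_iff_noetherian.2 this f
  have hmem : v n ∈ Ideal.span (v '' {j | j < n}) := by
    have : v n ∈ f (n + 1) := Ideal.subset_span ⟨n, Nat.lt_succ_self n, rfl⟩
    rw [← hn (n + 1) (Nat.le_succ n)] at this
    exact this
  have key : ∃ b : ℕ → reesAlgebra I, v n = ∑ j ∈ Finset.range n, b j * v j := by
    have e : v '' {j | j < n} = v '' ((Finset.range n : Finset ℕ) : Set ℕ) := by
      congr 1; ext; simp
    rw [e] at hmem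
    obtain ⟨b, hb⟩ := (Submodule.mem_span_image_finset_iff_exists_fun (reesAlgebra I)).1 hmem
    refine ⟨fun j => if h : j ∈ Finset.range n then b ⟨j, h⟩ else 0, ?_⟩
    rw [← hb, ← Finset.sum_attach (Finset.range n)]
    exact Finset.sum_congr rfl fun j _ => by dsimp only; rw [dif_pos j.2]; rfl
  obtain ⟨b, hb⟩ := key
  have hc : x ^ (n + r) = ∑ j ∈ Finset.range n, ((b j : R[X]).coeff (n - j)) * x ^ (j + r) := by
    have := congrArg (fun z : reesAlgebra I => (z : R[X]).coeff n) hb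
    simp only [v, coeff_monomial, if_true] at this
    rw [this]
    push_cast
    rw [finsetSum_coeff]
    refine Finset.sum_congr rfl fun j hj => ?_
    have hj' := Finset.mem_range.1 hj
    have : n = (n - j) + j := by omega
    conv_lhs => rw [this]
    rw [coeff_mul_monomial]
  rcases Nat.eq_zero_or_pos n with rfl | hn0
  · simp only [Finset.range_zero, Finset.sum_empty] at hc
    refine ⟨r + 1, by omega, 0, by simp, ?_⟩
    simp [pow_succ] at hc ⊢
    rw [hc]; simp
  refine ⟨n + r, by omega, fun i => if i ≤ n then - ((b (n - i) : R[X]).coeff i) else 0, ?_, ?_⟩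
  · intro i hi
    dsimp only
    split_ifs with h
    · exact neg_mem ((mem_reesAlgebra_iff _ _).1 (b (n - i)).2 i)
    · exact zero_mem _
  · have e2 : ∑ i ∈ Finset.Icc 1 (n + r), (if i ≤ n then - ((b (n - i) : R[X]).coeff i) else 0) *
        x ^ (n + r - i) = ∑ i ∈ Finset.Icc 1 n, (- ((b (n - i) : R[X]).coeff i)) *
        x ^ (n + r - i) := by
      symm
      apply Finset.sum_subset_zero_on_sdiff
      · intro i hi; simp at hi ⊢; omega
      · intro i hi
        simp only [Finset.mem_sdiff, Finset.mem_Icc] at hi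
        rw [if_neg (by omega), zero_mul]
      · intro i hi
        rw [if_pos (Finset.mem_Icc.1 hi).2]
    rw [e2, hc]
    have e3 : ∑ j ∈ Finset.range n, ((b j : R[X]).coeff (n - j)) * x ^ (j + r) =
       ∑ i ∈ Finset.Icc 1 n, ((b (n - i) : R[X]).coeff i) * x ^ (n + r - i) := by
      refine Finset.sum_bij' (fun j _ => n - j) (fun i _ => n - i) ?_ ?_ ?_ ?_ ?_
      · intro j hj; simp at hj ⊢; omega
      · intro j hj; simp at hj ⊢; omega
      · intro j hj; simp at hj ⊢; omega
      · intro j hj; simp at hj ⊢; omega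
      · intro j hj
        have := Finset.mem_range.1 hj
        have a1 : n - (n - j) = j := by omega
        have a2 : n + r - (n - j) = j + r := by omega
        rw [a1, a2]
    rw [e3, ← Finset.sum_add_distrib]
    simp

theorem AC.zero (I : Ideal R) : AC I 0 := ⟨1, fun N => by simp⟩

theorem AC.add {I : Ideal R} {x y : R} (hx : AC I x) (hy : AC I y) : AC I (x + y) := by
  obtain ⟨r, hr⟩ := hx
  obtain ⟨s, hs⟩ := hy
  refine ⟨r + s, fun N => ?_⟩
  rw [add_pow]
  refine Ideal.sum_mem _ fun i hi => Ideal.mul_mem_right _ _ ?_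
  have hi' := Finset.mem_range.1 hi
  by_cases h1 : i < r
  · have := hs (N + (r - i))
    rw [show N + (r - i) + s = N + (r + s) - i by omega] at this
    exact Ideal.mul_mem_left _ _ (Ideal.pow_le_pow_right (by omega) this)
  by_cases h2 : N + (r + s) - i < s
  · have := hr (i - r)
    rw [show i - r + r = i by omega] at this
    exact Ideal.mul_mem_right _ _ (Ideal.pow_le_pow_right (by omega) this)
  have a := hr (i - r)
  have b := hs (N + r - i)
  rw [show i - r + r = i by omega] at a
  rw [show N + r - i + s = N + (r + s) - i by omega] at b
  have := Ideal.mul_mem_mul a b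
  rw [← pow_add] at this
  exact Ideal.pow_le_pow_right (by omega) this

theorem AC.mul {I K : Ideal R} {x y : R} (hx : AC I x) (hy : AC K y) : AC (I * K) (x * y) := by
  obtain ⟨r, hr⟩ := hx
  obtain ⟨s, hs⟩ := hy
  refine ⟨r + s, fun N => ?_⟩
  rw [mul_pow, mul_pow]
  refine Ideal.mul_mem_mul ?_ ?_
  · exact Ideal.pow_le_pow_right (show N ≤ N + s by omega) (by have := hr (N + s); rwa [show N + s + r = N + (r + s) by omega] at this)
  · exact Ideal.pow_le_pow_right (show N ≤ N + r by omega) (by have := hs (N + r); rwa [show N + r + s = N + (r + s) by omega] at this)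

theorem AC.of_mem {I : Ideal R} {x : R} (hx : x ∈ I) : AC I x :=
  ⟨0, fun N => Ideal.pow_mem_pow hx N⟩

theorem AC.smul {I : Ideal R} {x : R} (a : R) (hx : AC I x) : AC I (a * x) := by
  obtain ⟨r, hr⟩ := hx
  exact ⟨r, fun N => by rw [mul_pow]; exact Ideal.mul_mem_left _ _ (hr N)⟩

theorem AC.mono {I K : Ideal R} (h : I ≤ K) {x : R} (hx : AC I x) : AC K x := by
  obtain ⟨r, hr⟩ := hx
  exact ⟨r, fun N => Ideal.pow_right_mono h N (hr N)⟩

theorem AC.map {S : Type*} [CommRing S] (f : R →+* S) {I : Ideal R} {x : R} (hx : AC I x) :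
    AC (I.map f) (f x) := by
  obtain ⟨r, hr⟩ := hx
  exact ⟨r, fun N => by rw [← map_pow, ← Ideal.map_pow]; exact Ideal.mem_map_of_mem _ (hr N)⟩

theorem mem_intCl [IsNoetherianRing R] {I : Ideal R} {x : R} : x ∈ intCl I ↔ AC I x := by
  constructor
  · intro h
    refine Submodule.span_induction (p := fun x _ => AC I x) ?_ (AC.zero I) ?_ ?_ h
    · intro x hx; exact AC.of_integral hx
    · intro x y _ _ hx hy; exact hx.add hy
    · intro a x _ hx; exact hx.smul a
  · intro h
    exact Ideal.subset_span h.to_integral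

theorem AC.sum {ι : Type*} (s : Finset ι) {I : Ideal R} {f : ι → R} (h : ∀ i ∈ s, AC I (f i)) :
    AC I (∑ i ∈ s, f i) := by
  classical
  induction s using Finset.induction_on with
  | empty => simpa using AC.zero I
  | insert a s ha ih =>
    rw [Finset.sum_insert ha]
    exact (h a (Finset.mem_insert_self _ _)).add (ih fun i hi => h i (Finset.mem_insert_of_mem hi))

/-- `x` with a power AC over `I^j` is AC over `I`. -/
theorem AC.of_pow {I : Ideal R} {x : R} {j : ℕ} (hj : 0 < j) (h : AC (I ^ j) (x ^ j)) : AC I x := by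
  obtain ⟨r, hr⟩ := h
  refine ⟨j * (r + 1), fun N => ?_⟩
  have h1 := hr (N / j + 1)
  rw [← pow_mul, ← pow_mul] at h1
  have h2 : N < j * (N / j + 1) := Nat.lt_mul_div_succ N hj
  have h3 : j * (N / j) ≤ N := Nat.mul_div_le N j
  have h4 : j * (N / j + 1 + r) ≤ N + j * (r + 1) := by nlinarith
  rw [← Nat.sub_add_cancel h4, pow_add]
  exact Ideal.mul_mem_left _ _ (Ideal.pow_le_pow_right h2.le h1)

theorem AC.pow {I : Ideal R} {x : R} (j : ℕ) (h : AC I x) : AC (I ^ j) (x ^ j) := by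
  obtain ⟨r, hr⟩ := h
  refine ⟨r, fun N => ?_⟩
  rw [← pow_mul, ← pow_mul, show j * (N + r) = j * N + r * j by ring]
  rcases Nat.eq_zero_or_pos j with rfl | hj
  · simp
  have h1 := hr (j * N)
  have : j * N + r ≤ j * N + r * j := by nlinarith
  rw [← Nat.sub_add_cancel this, pow_add]
  exact Ideal.mul_mem_left _ _ h1

/-- AC is transitive -/
theorem AC.trans [IsNoetherianRing R] {I K : Ideal R} (hK : ∀ y ∈ K, AC I y) {x : R} (hx : AC K x) :
    AC I x := by
  -- K is f.g., so K^{N+r} ≤ I^N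
  have hKI : ∃ r, ∀ N, K ^ (N + r) ≤ I ^ N := by
    obtain ⟨s, hs⟩ := (IsNoetherian.noetherian K : K.FG)
    have : ∀ s : Finset R, (∀ y ∈ s, AC I y) → ∃ r, ∀ N, (Ideal.span (s : Set R)) ^ (N + r) ≤ I ^ N := by
      classical
      intro s
      induction s using Finset.induction_on with
      | empty => intro _; exact ⟨1, fun N => by simp [pow_succ]⟩
      | insert a s ha ih =>
        intro h
        obtain ⟨r, hr⟩ := ih fun y hy => h y (Finset.mem_insert_of_mem hy)
        obtain ⟨r', hr'⟩ := h a (Finset.mem_insert_self _ _)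
        refine ⟨r + r', fun N => ?_⟩
        rw [Finset.coe_insert, Ideal.span_insert, ← Submodule.add_eq_sup, add_pow]
        rw [Ideal.sum_eq_sup, Finset.sup_le_iff]
        intro i hi
        have hi' := Finset.mem_range.1 hi
        refine le_trans Ideal.mul_le_left ?_
        rw [Ideal.span_singleton_pow]
        have H1 : ∀ j, j ≤ i - r' → Ideal.span {a ^ i} ≤ I ^ j := fun j hj => by
          rw [Ideal.span_le, Set.singleton_subset_iff]
          by_cases h : i < r'
          · have : j = 0 := by omega
            subst this; simp
          have := hr' (i - r')
          rw [show i - r' + r' = i by omega] at this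
          exact Ideal.pow_le_pow_right hj this
        have H2 : ∀ j l, j ≤ l - r → Ideal.span (s : Set R) ^ l ≤ I ^ j := fun j l hj => by
          by_cases h : l < r
          · have : j = 0 := by omega
            subst this; simp
          have := hr (l - r)
          rw [show l - r + r = l by omega] at this
          exact this.trans (Ideal.pow_le_pow_right hj)
        refine (mul_le_mul' (H1 (i - r') le_rfl) (H2 (N + (r + r') - i - r) _ le_rfl)).trans ?_
        rw [← pow_add]
        exact Ideal.pow_le_pow_right (by omega)
    obtain ⟨r, hr⟩ := this s (fun y hy => hK y (hs ▸ Ideal.subset_span hy))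
    refine ⟨r, fun N => ?_⟩
    have := hr N
    rwa [show Ideal.span (s : Set R) = K from hs] at this
  obtain ⟨r, hr⟩ := hKI
  obtain ⟨r', hr'⟩ := hx
  exact ⟨r + r', fun N => by
    have := hr N (hr' (N + r)); rwa [add_assoc] at this⟩

end
end NH

end

section
set_option synthInstance.maxHeartbeats 1000000
set_option maxHeartbeats 2000000

open IsLocalRing Polynomial Finset

namespace NH

section
variable {R M M' : Type*} [CommRing R] [AddCommGroup M] [Module R M] [AddCommGroup M'] [Module R M']

/-- relative length of `K / (N ∩ K)` -/
noncomputable def rl (N K : Submodule R M) : ℕ∞ := Module.length R (K ⧸ N.comap K.subtype)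

theorem rl_add {N K L : Submodule R M} (h1 : N ≤ K) (h2 : K ≤ L) : rl N L = rl N K + rl K L := by
  unfold rl
  let f : (K ⧸ N.comap K.subtype) →ₗ[R] (L ⧸ N.comap L.subtype) :=
    Submodule.mapQ _ _ (Submodule.inclusion h2) (by intro x hx; simpa using hx)
  let g : (L ⧸ N.comap L.subtype) →ₗ[R] (L ⧸ K.comap L.subtype) :=
    Submodule.mapQ _ _ LinearMap.id (by intro x hx; simp only [Submodule.mem_comap] at hx ⊢; exact h1 hx)
  refine Module.length_eq_add_of_exact f g ?_ ?_ ?_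
  · rw [← LinearMap.ker_eq_bot, LinearMap.ker_eq_bot']
    intro x
    induction x using Submodule.Quotient.induction_on with
    | _ x =>
      intro h
      simp only [f, Submodule.mapQ_apply, Submodule.Quotient.mk_eq_zero] at h ⊢
      simpa using h
  · intro x
    induction x using Submodule.Quotient.induction_on with
    | _ x => exact ⟨Submodule.Quotient.mk x, by simp [g]⟩
  · intro x
    induction x using Submodule.Quotient.induction_on with
    | _ x =>
      constructor
      · intro h
        simp only [g, Submodule.mapQ_apply, Submodule.Quotient.mk_eq_zero] at h
        exact ⟨Submodule.Quotient.mk ⟨x.1, h⟩, by simp only [f, Submodule.mapQ_apply]; rfl⟩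
      · rintro ⟨y, hy⟩
        induction y using Submodule.Quotient.induction_on with
        | _ y =>
          simp only [f, Submodule.mapQ_apply] at hy
          rw [← hy]
          simp only [g, Submodule.mapQ_apply, Submodule.Quotient.mk_eq_zero]
          exact y.2

theorem rl_le_of_surj {N K : Submodule R M} {N' K' : Submodule R M'} (φ : M →ₗ[R] M')
    (hN : ∀ x ∈ K, x ∈ N → φ x ∈ N') (hK : ∀ x ∈ K, φ x ∈ K')
    (hs : ∀ y ∈ K', ∃ x ∈ K, y - φ x ∈ N') : rl N' K' ≤ rl N K := by
  unfold rl
  let f : (K ⧸ N.comap K.subtype) →ₗ[R] (K' ⧸ N'.comap K'.subtype) :=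
    Submodule.mapQ _ _ (φ.restrict hK) (by
      intro x hx
      simp only [Submodule.mem_comap] at hx ⊢
      exact hN _ x.2 hx)
  refine Module.length_le_of_surjective f ?_
  intro y
  induction y using Submodule.Quotient.induction_on with
  | _ y =>
    obtain ⟨x, hx, hxy⟩ := hs y y.2
    refine ⟨Submodule.Quotient.mk ⟨x, hx⟩, ?_⟩
    simp only [f, Submodule.mapQ_apply]
    symm
    rw [Submodule.Quotient.eq]
    exact hxy

theorem rl_anti {N N' : Submodule R M} (K : Submodule R M) (h : N ≤ N') : rl N' K ≤ rl N K :=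
  rl_le_of_surj LinearMap.id (fun _ _ hx => h hx) (fun _ h => h) (fun y hy => ⟨y, hy, by simp⟩)

theorem rl_le_of_inj {N K : Submodule R M} {N' K' : Submodule R M'} (φ : M →ₗ[R] M')
    (hK : ∀ x ∈ K, φ x ∈ K') (hi : ∀ x ∈ K, φ x ∈ N' → x ∈ N) : rl N K ≤ rl N' K' := by
  have h1 : rl N K ≤ rl (N'.comap φ) K := by
    refine rl_le_of_surj LinearMap.id ?_ (fun _ h => h) (fun y hy => ⟨y, hy, by simp⟩)
    intro x hx h; exact hi x hx h
  refine h1.trans ?_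
  unfold rl
  let f : (K ⧸ (N'.comap φ).comap K.subtype) →ₗ[R] (K' ⧸ N'.comap K'.subtype) :=
    Submodule.mapQ _ _ (φ.restrict hK) (by
      intro x hx
      exact hx)
  refine Module.length_le_of_injective f ?_
  rw [← LinearMap.ker_eq_bot, LinearMap.ker_eq_bot']
  intro x
  induction x using Submodule.Quotient.induction_on with
  | _ x =>
    intro h
    rw [Submodule.Quotient.mk_eq_zero]
    have h2 := (Submodule.Quotient.mk_eq_zero (N'.comap K'.subtype)).1 h
    exact h2

theorem rl_mono (N : Submodule R M) {K K' : Submodule R M} (h : K ≤ K') : rl N K ≤ rl N K' :=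
  rl_le_of_inj LinearMap.id (fun _ hx => h hx) (fun _ _ hx => hx)

theorem rl_eq_zero {N K : Submodule R M} : rl N K = 0 ↔ K ≤ N := by
  unfold rl
  rw [Module.length_eq_zero_iff, Submodule.Quotient.subsingleton_iff, Submodule.comap_subtype_eq_top]

theorem rl_top (N : Submodule R M) : rl N ⊤ = Module.length R (M ⧸ N) := by
  unfold rl
  refine LinearEquiv.length_eq (Submodule.Quotient.equiv _ _ Submodule.topEquiv ?_)
  ext x; simp

theorem rl_inf (N K : Submodule R M) : rl (N ⊓ K) K = rl N K := by
  apply le_antisymm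
  · exact rl_le_of_inj LinearMap.id (fun _ h => h) (fun x hx h => ⟨h, hx⟩)
  · exact rl_anti _ inf_le_left

theorem rl_sup (N K : Submodule R M) : rl N (N ⊔ K) = rl N K := by
  apply le_antisymm
  · refine rl_le_of_surj LinearMap.id (fun _ _ h => h) (fun x h => (le_sup_right : K ≤ N ⊔ K) h) ?_
    intro y hy
    obtain ⟨a, ha, b, hb, rfl⟩ := Submodule.mem_sup.1 hy
    exact ⟨b, hb, by simpa using ha⟩
  · exact rl_mono _ le_sup_right

theorem rl_tri (N K L : Submodule R M) : rl N L ≤ rl N K + rl K L := by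
  calc rl N L ≤ rl N (N ⊔ K ⊔ L) := rl_mono _ le_sup_right
    _ = rl N (N ⊔ K) + rl (N ⊔ K) (N ⊔ K ⊔ L) := rl_add le_sup_left le_sup_left
    _ = rl N K + rl (N ⊔ K) L := by rw [rl_sup, rl_sup]
    _ ≤ _ := by gcongr; exact rl_anti _ le_sup_right

theorem mlen_eq (M : Type*) [AddCommGroup M] [Module R M] : mlen R M = (Module.length R M : WithBot ℕ∞) := by
  rw [Module.coe_length]; rfl

theorem rl_eq_mlen (N K : Ideal R) : mlen R (idealQuot K N) = (rl N K : WithBot ℕ∞) := by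
  rw [mlen_eq]; rfl

/-- strict chains give lower bounds for lengths -/
theorem le_rl_of_chain (U : ℕ → Submodule R M) (n : ℕ) (h : ∀ i < n, U (i + 1) ≤ U i)
    (h' : ∀ i < n, ¬ U i ≤ U (i + 1)) : (n : ℕ∞) ≤ rl (U n) (U 0) := by
  induction n with
  | zero => simp
  | succ n ih =>
    have hU : ∀ i ≤ n, U n ≤ U i := by
      intro i hi
      have : ∀ k, i + k ≤ n → U (i + k) ≤ U i := by
        intro k
        induction k with
        | zero => intro _; exact le_rfl
        | succ k ihk => intro hk; exact (h (i + k) (by omega)).trans (ihk (by omega))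
      have := this (n - i) (by omega)
      rwa [show i + (n - i) = n by omega] at this
    rw [rl_add (h n (by omega)) (hU 0 (by omega)), add_comm (rl _ _)]
    push_cast
    refine add_le_add (ih (fun i hi => h i (by omega)) (fun i hi => h' i (by omega))) ?_
    rw [Order.one_le_iff_ne_zero]
    intro h0
    exact h' n (by omega) (rl_eq_zero.1 h0)

/-- chain upper bound -/
theorem rl_chain_le (U : ℕ → Submodule R M) (c : ℕ → ℕ∞) (n : ℕ)
    (h : ∀ i < n, rl (U (i + 1)) (U i) ≤ c i) : rl (U n) (U 0) ≤ ∑ i ∈ Finset.range n, c i := by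
  induction n with
  | zero => simp [rl_eq_zero.2 (le_refl (U 0))]
  | succ n ih =>
    rw [Finset.sum_range_succ, add_comm (∑ x ∈ range n, c x)]
    refine (rl_tri _ (U n) _).trans (add_le_add (h n (by omega)) (ih fun i hi => h i (by omega)))

end
end NH

end

section
set_option synthInstance.maxHeartbeats 1000000
set_option maxHeartbeats 2000000

open IsLocalRing Polynomial Finset

namespace NH

/-- finite length of quotients by ideals containing a power of the maximal ideal -/
theorem rl_ne_top_of_pow_le {R : Type*} [CommRing R] [IsLocalRing R] [IsNoetherianRing R]
    {I : Ideal R} {s : ℕ} (h : (maximalIdeal R) ^ s ≤ I) (K : Ideal R) : rl I K ≠ ⊤ := by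
  have h0 : rl I ⊤ ≠ ⊤ := by
    rw [rl_top]
    have : IsArtinianRing (R ⧸ I) := by
      have : Ring.KrullDimLE 0 (R ⧸ I) := by
        refine Ring.KrullDimLE.mk₀ fun P hP => ?_
        have hc : (P.comap (Ideal.Quotient.mk I)).IsPrime := Ideal.comap_isPrime _ _
        have h1 : (maximalIdeal R) ^ s ≤ P.comap (Ideal.Quotient.mk I) := fun x hx => by
          rw [Ideal.mem_comap, Ideal.Quotient.eq_zero_iff_mem.2 (h hx)]; exact zero_mem _
        have h2 : maximalIdeal R ≤ P.comap (Ideal.Quotient.mk I) := hc.le_of_pow_le h1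
        have h3 : (P.comap (Ideal.Quotient.mk I)).IsMaximal := by
          have := (maximalIdeal.isMaximal R).eq_of_le hc.ne_top h2
          rw [← this]; exact maximalIdeal.isMaximal R
        have h4 := Ideal.map_eq_top_or_isMaximal_of_surjective (Ideal.Quotient.mk I)
          Ideal.Quotient.mk_surjective h3
        rw [Ideal.map_comap_of_surjective _ Ideal.Quotient.mk_surjective] at h4
        exact h4.resolve_left hP.ne_top
      exact IsNoetherianRing.isArtinianRing_of_krullDimLE_zero
    rw [Module.length_eq_of_surjective (R := R ⧸ I) (S := R) (M := R ⧸ I) Ideal.Quotient.mk_surjective]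
    exact Module.length_ne_top
  exact ne_top_of_le_ne_top h0 (rl_mono _ le_top)

theorem Linf_domain {A : Type*} [CommRing A] [IsLocalRing A] [IsNoetherianRing A] [IsDomain A]
    (y : A) (hy : y ≠ 0) (hp : ∀ p : Ideal A, p.IsPrime → p ≠ ⊥ → y ∈ p)
    (h : ∀ N : ℕ, ∃ j, 0 < j ∧ y ^ j ∈ (maximalIdeal A) ^ (N * j)) : False := by
  set 𝔪 := maximalIdeal A
  have hym : y ∈ 𝔪 := by
    obtain ⟨j, hj, h1⟩ := h 1
    exact (maximalIdeal.isMaximal A).isPrime.mem_of_pow_mem j (Ideal.pow_le_self (by omega) h1)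
  -- the maximal ideal is minimal over y
  have hmin : 𝔪 ∈ (Ideal.span {y}).minimalPrimes := by
    by_contra hcon
    have hfin := (Ideal.span {y}).finite_minimalPrimes_of_isNoetherianRing A
    have : ¬ ((𝔪 : Set A) ⊆ ⋃ p ∈ ((hfin.toFinset : Finset (Ideal A)) : Set (Ideal A)), ((id p : Ideal A) : Set A)) := by
      rw [Ideal.subset_union_prime ⊥ ⊥]
      · rintro ⟨p, hp1, hp2⟩
        have hp3 := hfin.mem_toFinset.1 hp1
        have : 𝔪 = p := (maximalIdeal.isMaximal A).eq_of_le hp3.1.1.ne_top hp2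
        exact hcon (this ▸ hp3)
      · intro p hp1 _ _
        exact (hfin.mem_toFinset.1 hp1).1.1
    rw [Set.not_subset] at this
    obtain ⟨z, hz, hz2⟩ := this
    have hzne : z ≠ 0 := by
      rintro rfl
      obtain ⟨p, hp1⟩ := (Ideal.span {y}).nonempty_minimalPrimes (by
        rw [Ne, Ideal.span_singleton_eq_top]; exact hym)
      exact hz2 (Set.mem_biUnion (hfin.mem_toFinset.2 hp1) (zero_mem p))
    obtain ⟨p', hp'⟩ := (Ideal.span {z}).nonempty_minimalPrimes (by
        rw [Ne, Ideal.span_singleton_eq_top]; exact hz)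
    have hpp := hp'.1.1
    have hzp : z ∈ p' := hp'.1.2 (Ideal.mem_span_singleton_self z)
    have hyp : y ∈ p' := hp p' hpp (fun h => hzne (by rwa [h] at hzp))
    obtain ⟨q, hq, hqp⟩ := Ideal.exists_minimalPrimes_le
      (show Ideal.span {y} ≤ p' from (Ideal.span_singleton_le_iff_mem _).2 hyp)
    have hqpr := hq.1.1
    have hne : q ≠ p' := by
      rintro rfl
      exact hz2 (Set.mem_biUnion (hfin.mem_toFinset.2 hq) hzp)
    have h1 := Ideal.height_le_one_of_isPrincipal_of_mem_minimalPrimes _ p' hp'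
    have h2 : q.height < p'.height := Ideal.height_strict_mono_of_isPrime_of_isPrime (lt_of_le_of_ne hqp hne)
    have hq0 : (⊥ : Ideal A) < q := by
      rw [bot_lt_iff_ne_bot]
      rintro rfl
      exact hy (by simpa using hq.1.2 (Ideal.mem_span_singleton_self y))
    have h3 : (⊥ : Ideal A).height < q.height := Ideal.height_strict_mono_of_isPrime_of_isPrime hq0
    have h4 := lt_of_lt_of_le h2 h1
    rw [Order.lt_one_iff] at h4
    rw [h4] at h3
    exact not_lt_bot h3
  have hrad : (Ideal.span {y}).radical = 𝔪 := by
    apply le_antisymm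
    · exact (maximalIdeal.isMaximal A).isPrime.radical_le_iff.2 hmin.1.2
    · rw [Ideal.radical_eq_sInf]
      refine le_sInf ?_
      rintro p ⟨hp1, hp2⟩
      exact hmin.2 ⟨hp2, hp1⟩ (le_maximalIdeal hp2.ne_top)
  obtain ⟨s, hs⟩ := Ideal.exists_radical_pow_le_of_fg (Ideal.span {y}) (IsNoetherian.noetherian _)
  rw [hrad] at hs
  have hfin := rl_ne_top_of_pow_le hs ⊤
  obtain ⟨l, hl⟩ := ENat.ne_top_iff_exists.1 hfin
  have hup : ∀ j, rl (Ideal.span {y ^ j}) ⊤ ≤ (j * l : ℕ) := by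
    intro j
    have := rl_chain_le (fun i => Ideal.span {y ^ i}) (fun _ => (l : ℕ∞)) j (fun i _ => by
      rw [hl]
      refine rl_le_of_surj (LinearMap.mulLeft A (y ^ i)) ?_ ?_ ?_
      · intro x _ hx
        rw [Ideal.mem_span_singleton] at hx ⊢
        simpa [pow_succ] using mul_dvd_mul_left (y ^ i) hx
      · intro x _
        rw [Ideal.mem_span_singleton]
        exact ⟨x, rfl⟩
      · intro x hx
        rw [Ideal.mem_span_singleton] at hx
        obtain ⟨c, rfl⟩ := hx
        exact ⟨c, trivial, by simp⟩)
    simpa using this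
  have hlow : ∀ n : ℕ, (n : ℕ∞) ≤ rl (𝔪 ^ n) ⊤ := by
    intro n
    have := le_rl_of_chain (fun i => 𝔪 ^ i) n (fun i _ => Ideal.pow_le_pow_right (Nat.le_succ i)) (by
      intro i _ hle
      have h0 : 𝔪 ^ i = ⊥ := by
        refine Submodule.eq_bot_of_le_smul_of_le_jacobson_bot 𝔪 _ (IsNoetherian.noetherian _) ?_ ?_
        · rw [smul_eq_mul, ← pow_succ']; exact hle
        · exact IsLocalRing.maximalIdeal_le_jacobson _
      have : y ^ i = 0 := by simpa [h0] using Ideal.pow_mem_pow hym i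
      exact hy (by by_contra hne; exact pow_ne_zero i hne this))
    simpa using this
  obtain ⟨j, hj, hjm⟩ := h (l + 1)
  have h1 : rl (𝔪 ^ ((l + 1) * j)) ⊤ ≤ rl (Ideal.span {y ^ j}) ⊤ :=
    rl_anti _ ((Ideal.span_singleton_le_iff_mem _).2 hjm)
  have h2 := (hlow _).trans (h1.trans (hup j))
  have h3 : (l + 1) * j ≤ j * l := by exact_mod_cast h2
  nlinarith

/-- if `y` has infinite asymptotic order in a noetherian local ring then it is nilpotent -/
theorem Linf {A : Type*} [CommRing A] [IsLocalRing A] [IsNoetherianRing A]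
    (y : A) (h : ∀ N : ℕ, ∃ j, 0 < j ∧ y ^ j ∈ (maximalIdeal A) ^ (N * j)) : IsNilpotent y := by
  by_contra hn
  have hne : {p : Ideal A | p.IsPrime ∧ y ∉ p}.Nonempty := by
    by_contra hcon
    rw [Set.not_nonempty_iff_eq_empty] at hcon
    apply hn
    rw [nilpotent_iff_mem_prime]
    intro p hp
    by_contra hy
    have : p ∈ {p : Ideal A | p.IsPrime ∧ y ∉ p} := ⟨hp, hy⟩
    rw [hcon] at this
    exact this
  obtain ⟨Q, ⟨hQ, hyQ⟩, hmax⟩ := set_has_maximal_iff_noetherian.2 (inferInstance : IsNoetherian A A) _ hne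
  have : Nontrivial (A ⧸ Q) := Ideal.Quotient.nontrivial_iff.2 hQ.ne_top
  have : IsLocalRing (A ⧸ Q) := IsLocalRing.of_surjective' (Ideal.Quotient.mk Q) Ideal.Quotient.mk_surjective
  refine Linf_domain (A := A ⧸ Q) (Ideal.Quotient.mk Q y) ?_ ?_ ?_
  · rwa [Ne, Ideal.Quotient.eq_zero_iff_mem]
  · intro p hp hp0
    by_contra hcon
    have hc : (p.comap (Ideal.Quotient.mk Q)).IsPrime := Ideal.comap_isPrime _ _
    refine hmax (p.comap (Ideal.Quotient.mk Q)) ⟨hc, hcon⟩ (lt_of_le_of_ne ?_ ?_)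
    · intro x hx
      rw [Ideal.mem_comap, Ideal.Quotient.eq_zero_iff_mem.2 hx]; exact zero_mem _
    · intro heq
      apply hp0
      rw [eq_bot_iff]
      intro x hx
      obtain ⟨x, rfl⟩ := Ideal.Quotient.mk_surjective x
      have : x ∈ Q := by rw [heq]; exact hx
      simpa [Ideal.Quotient.eq_zero_iff_mem] using this
  · intro N
    obtain ⟨j, hj, hm⟩ := h N
    refine ⟨j, hj, ?_⟩
    have h1 := Ideal.mem_map_of_mem (Ideal.Quotient.mk Q) hm
    rw [Ideal.map_pow, map_pow] at h1
    refine Ideal.pow_right_mono ?_ _ h1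
    rw [Ideal.map_le_iff_le_comap]
    intro x hx
    rw [Ideal.mem_comap, mem_maximalIdeal, mem_nonunits_iff]
    intro hu
    have : IsLocalHom (Ideal.Quotient.mk Q) :=
      IsLocalHom.of_surjective _ Ideal.Quotient.mk_surjective
    exact hx (isUnit_of_map_unit _ _ hu)

end NH

end

section
set_option synthInstance.maxHeartbeats 1000000
set_option maxHeartbeats 400000

open IsLocalRing Polynomial Finset

namespace NH

theorem ofpm_aux1 {R : Type*} [CommRing R] {I B : Ideal R} {f : R}  (hfB : Ideal.span {f} ≤ B) (n : ℕ) (ih : B ^ (n + 1) ≤ I * B ^ n ⊔ Ideal.span {f ^ (n + 1)}) :B ^ (n + 1) * Ideal.span {f}  ≤ I * B ^ (n+1) ⊔ Ideal.span {f ^ (n + 1+1)} := by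
          refine (Ideal.mul_mono_left ih).trans ?_
          rw [Ideal.sup_mul]
          refine sup_le_sup ?_ ?_
          · rw [pow_succ, ← mul_assoc]
            exact Ideal.mul_mono_right hfB
          · rw [Ideal.span_singleton_mul_span_singleton, ← pow_succ]

theorem ofpm_aux2 {R : Type*} [CommRing R] {I B : Ideal R} {f : R} (hB : B = I ⊔ Ideal.span {f})
  (hfB : Ideal.span {f} ≤ B)  : ∀ n, B ^ (n + 1) ≤ I * B ^ n ⊔ Ideal.span {f ^ (n + 1)} := by
      intro n
      induction n with
      | zero => simp [hB]
      | succ n ih =>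
        have e : B ^ (n + 1 + 1) = B ^ (n + 1) * I ⊔ B ^ (n + 1) * Ideal.span {f} := by
          rw [← Ideal.mul_sup, ← hB, pow_succ]
        rw [e]
        refine sup_le ?_ ?_
        · rw [mul_comm]; exact le_sup_left
        · exact ofpm_aux1 hfB n ih

theorem ofpm_aux3 {R : Type*} [CommRing R] {I B : Ideal R} (M : ℕ) (h1 : B ^ (M + 1) ≤ I * B ^ M) : ∀ N, B ^ (N + M) ≤ I ^ N * B ^ M := by
    intro N
    induction N with
    | zero => simp
    | succ N ih =>
      rw [show N + 1 + M = (N + M) + 1 by ring, pow_succ]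
      refine (Ideal.mul_mono_left ih).trans ?_
      rw [mul_assoc, ← pow_succ, pow_succ I, mul_assoc]
      exact Ideal.mul_mono_right h1

theorem AC.of_pow_mem {R : Type*} [CommRing R] {I : Ideal R} {f : R} (M : ℕ)
    (h : f ^ (M + 1) ∈ I * (I ⊔ Ideal.span {f}) ^ M) : AC I f := by
  generalize hB : I ⊔ Ideal.span {f} = B at h
  have hfB : Ideal.span {f} ≤ B := hB ▸ le_sup_right
  have h0 := ofpm_aux2 hB.symm hfB M
  have h1 : B ^ (M + 1) ≤ I * B ^ M :=
    h0.trans (sup_le le_rfl ((Ideal.span_singleton_le_iff_mem _).2 h))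
  refine ⟨M, fun N => ?_⟩
  have h3 : f ^ (N + M) ∈ B ^ (N + M) :=
    Ideal.pow_mem_pow (hfB (Ideal.mem_span_singleton_self f)) _
  have h4 := ofpm_aux3 M h1 N h3
  have h5 : I ^ N * B ^ M ≤ I ^ N := Ideal.mul_le_left
  exact h5 h4

/-- an element whose asymptotic `I`-order is at least one is integral over `I` -/
theorem AC.of_asymptotic {R : Type*} [CommRing R] [IsNoetherianRing R] {I : Ideal R} {f : R}
    (h : ∀ N : ℕ, ∃ a b : ℕ, 0 < b ∧ f ^ b ∈ I ^ a ∧ N * b ≤ (N + 1) * a) : AC I f := by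
  by_contra hcon
  set B := I ⊔ Ideal.span {f} with hB
  have hfB : f ∈ B := (le_sup_right : _ ≤ B) (Ideal.mem_span_singleton_self f)
  have hIB : I ≤ B := le_sup_left
  let A := reesAlgebra B
  have hmon : ∀ {y : R} {n : ℕ}, y ∈ B ^ n → (monomial n y : R[X]) ∈ reesAlgebra B :=
    fun h => reesAlgebra.monomial_mem.2 h
  let F : A := ⟨monomial 1 f, hmon (by simpa using hfB)⟩
  let 𝔟 : Ideal A := Ideal.span {z | ∃ y ∈ I, (z : R[X]) = monomial 1 y}
  have hdeg : ∀ z ∈ 𝔟, (z : R[X]).coeff 0 = 0 ∧ ∀ M, (z : R[X]).coeff (M + 1) ∈ I * B ^ M := by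
    intro z hz
    refine Submodule.span_induction ?_ ?_ ?_ ?_ hz
    · rintro z ⟨y, hy, hz⟩
      rw [hz]
      refine ⟨by simp [coeff_monomial], fun M => ?_⟩
      rw [coeff_monomial]
      split_ifs with h
      · have : M = 0 := by omega
        subst this; simpa using hy
      · exact zero_mem _
    · simp
    · rintro x y _ _ ⟨h1, h2⟩ ⟨h3, h4⟩
      exact ⟨by simp [h1, h3], fun M => by simpa using add_mem (h2 M) (h4 M)⟩
    · rintro a x _ ⟨h1, h2⟩
      refine ⟨by simp [h1, mul_coeff_zero], fun M => ?_⟩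
      rw [smul_eq_mul, Subalgebra.coe_mul, coeff_mul]
      refine Ideal.sum_mem _ fun ij hij => ?_
      have hij' := Finset.HasAntidiagonal.mem_antidiagonal.1 hij
      rcases Nat.eq_zero_or_pos ij.2 with h0 | h0
      · rw [h0, h1, mul_zero]; exact zero_mem _
      · have h5 := h2 (ij.2 - 1)
        rw [Nat.sub_add_cancel h0] at h5
        have h6 := Ideal.mul_mem_mul ((mem_reesAlgebra_iff _ _).1 a.2 ij.1) h5
        have : B ^ ij.1 * (I * B ^ (ij.2 - 1)) = I * B ^ M := by
          rw [show M = ij.1 + (ij.2 - 1) by omega, pow_add]; ring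
        rwa [this] at h6
  have hFpow : ∀ n, ((F ^ n : A) : R[X]) = monomial n (f ^ n) := by
    intro n
    rw [Subalgebra.coe_pow]
    simp [F, monomial_pow]
  have hdisj : Disjoint (𝔟 : Set A) (Submonoid.powers F : Set A) := by
    rw [Set.disjoint_left]
    rintro z hz ⟨n, rfl⟩
    have h1 := hdeg _ hz
    apply hcon
    rcases n with _ | M
    · have h10 : (1 : R) = 0 := by
        have := h1.1
        simpa [hFpow] using this
      exact ⟨0, fun N => by rw [← mul_one (f ^ _), h10, mul_zero]; exact zero_mem _⟩
    · refine AC.of_pow_mem M ?_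
      have := h1.2 M
      rw [hFpow, coeff_monomial, if_pos rfl] at this
      exact this
  obtain ⟨P, hP, hbP, hPd⟩ := Ideal.exists_le_prime_disjoint 𝔟 _ hdisj
  have hFP : F ∉ P := fun h => Set.disjoint_left.1 hPd h ⟨1, by simp⟩
  have : IsNoetherianRing (reesAlgebra B) := inferInstance
  have : IsNoetherianRing A := this
  let AP := Localization.AtPrime P
  have : IsNoetherianRing AP := IsLocalization.isNoetherianRing P.primeCompl AP inferInstance
  let g : A →+* AP := algebraMap A AP
  let φ : A := algebraMap R A f
  have hunit : IsUnit (g F) := IsLocalization.map_units AP (⟨F, hFP⟩ : P.primeCompl)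
  have hIa : ∀ (a : ℕ) (u : R) (hu : u ∈ I ^ a),
      (⟨monomial a u, hmon (Ideal.pow_right_mono hIB a hu)⟩ : A) ∈ P ^ a := by
    intro a
    induction a with
    | zero => intro u hu; simp
    | succ a ih =>
      intro u hu
      have : ∀ v ∈ I ^ (a + 1), ∃ hv : (monomial (a + 1) v : R[X]) ∈ reesAlgebra B, (⟨_, hv⟩ : A) ∈ P ^ (a + 1) := by
        intro v hv
        rw [pow_succ] at hv
        refine Submodule.mul_induction_on hv ?_ ?_
        · intro m hm n hn
          refine ⟨hmon ?_, ?_⟩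
          · rw [pow_succ]; exact Ideal.mul_mem_mul (Ideal.pow_right_mono hIB a hm) (hIB hn)
          · have h1 := ih m hm
            have h2 : (⟨monomial 1 n, hmon (by simpa using hIB hn)⟩ : A) ∈ P :=
              hbP (Ideal.subset_span ⟨n, hn, rfl⟩)
            have h3 := Ideal.mul_mem_mul h1 h2
            rw [← pow_succ] at h3
            convert h3 using 1
            apply Subtype.ext
            simp [monomial_mul_monomial]
        · rintro x y ⟨hx, hx'⟩ ⟨hy, hy'⟩
          refine ⟨by rw [map_add]; exact add_mem hx hy, ?_⟩
          convert add_mem hx' hy' using 1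
          apply Subtype.ext
          simp
      exact (this u hu).2
  have hnil : IsNilpotent (g φ) := by
    refine Linf (g φ) fun N => ?_
    obtain ⟨a, b, hb, hm, hN⟩ := h N
    have hab : a < b := by
      by_contra hab
      push Not at hab
      exact hcon (AC.of_pow hb (AC.of_mem (Ideal.pow_le_pow_right hab hm)))
    refine ⟨b - a, by omega, ?_⟩
    have h1 := hIa a _ hm
    have h2 : (⟨monomial a (f ^ b), hmon (Ideal.pow_right_mono hIB a hm)⟩ : A) = F ^ a * φ ^ (b - a) := by
      apply Subtype.ext
      rw [Subalgebra.coe_mul, hFpow, Subalgebra.coe_pow]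
      change _ = _ * (C f) ^ (b - a)
      rw [← C_pow, monomial_mul_C, ← pow_add, Nat.add_sub_cancel' hab.le]
    rw [h2] at h1
    have h3 := Ideal.mem_map_of_mem g h1
    rw [Ideal.map_pow, map_mul, map_pow, map_pow, Ideal.unit_mul_mem_iff_mem _ (hunit.pow a)] at h3
    have h4 : P.map g = maximalIdeal AP := Localization.AtPrime.map_eq_maximalIdeal
    rw [h4] at h3
    refine Ideal.pow_le_pow_right ?_ h3
    have : N * b = N * (b - a) + N * a := by rw [← mul_add, Nat.sub_add_cancel hab.le]
    nlinarith
  obtain ⟨M, hM⟩ := hnil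
  rw [← map_pow] at hM
  obtain ⟨s, hs⟩ := (IsLocalization.map_eq_zero_iff P.primeCompl AP _).1 hM
  have : (s : A) * F ^ M = 0 := by
    apply Subtype.ext
    have h1 := congrArg (fun z : A => (z : R[X])) hs
    simp only [Subalgebra.coe_mul, ZeroMemClass.coe_zero] at h1
    have h2 : ((φ ^ M : A) : R[X]) = C (f ^ M) := by
      rw [Subalgebra.coe_pow, C_pow]; rfl
    rw [h2] at h1
    rw [Subalgebra.coe_mul, hFpow, ← C_mul_X_pow_eq_monomial, ← mul_assoc, h1, zero_mul]; rfl
  have h5 : (s : A) * F ^ M ∈ P := by rw [this]; exact zero_mem _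
  rcases hP.mem_or_mem h5 with h6 | h6
  · exact s.2 h6
  · exact hFP (hP.mem_of_pow_mem _ h6)

end NH

end

section
set_option synthInstance.maxHeartbeats 1000000
set_option maxHeartbeats 400000

open IsLocalRing Polynomial Finset

namespace NH

section CM
universe u

theorem coset_avoid {R : Type u} [CommRing R] (s : Finset (Ideal R)) (x : R) (𝔞 : Ideal R)
    (hp : ∀ P ∈ s, P.IsPrime) (h : ∀ P ∈ s, ¬ (x ∈ P ∧ 𝔞 ≤ P)) :
    ∃ a ∈ 𝔞, ∀ P ∈ s, x + a ∉ P := by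
  classical
  induction s using Finset.strongInduction with
  | H s ih =>
    rcases s.eq_empty_or_nonempty with rfl | hne
    · exact ⟨0, zero_mem _, by simp⟩
    obtain ⟨P, hPs, hPm⟩ := s.exists_minimal hne
    obtain ⟨a, ha, hA⟩ := ih (s.erase P) (Finset.erase_ssubset hPs)
      (fun Q hQ => hp Q (Finset.mem_of_mem_erase hQ)) (fun Q hQ => h Q (Finset.mem_of_mem_erase hQ))
    by_cases hxP : x + a ∈ P
    · have hPp := hp P hPs
      have h1 : ¬ 𝔞 ≤ P := fun h2 => h P hPs ⟨by simpa using sub_mem hxP (h2 ha), h2⟩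
      have h2 : ¬ 𝔞 * (∏ Q ∈ s.erase P, Q) ≤ P := by
        intro h3
        rcases hPp.mul_le.1 h3 with h4 | h4
        · exact h1 h4
        · obtain ⟨Q, hQ, hQP⟩ := (hPp.prod_le).1 h4
          have := hPm (Finset.mem_of_mem_erase hQ) hQP
          exact (Finset.ne_of_mem_erase hQ) (le_antisymm hQP this)
      obtain ⟨b, hb, hbP⟩ := SetLike.not_le_iff_exists.1 h2
      refine ⟨a + b, add_mem ha (Ideal.mul_le_left hb), fun Q hQ hQ' => ?_⟩
      by_cases hQP : Q = P
      · subst hQP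
        apply hbP
        have := sub_mem hQ' hxP
        rwa [show x + (a + b) - (x + a) = b by ring] at this
      · have hQe : Q ∈ s.erase P := Finset.mem_erase.2 ⟨hQP, hQ⟩
        have hbQ : b ∈ Q := (Ideal.prod_le_inf.trans (Finset.inf_le hQe)) (Ideal.mul_le_right hb)
        apply hA Q hQe
        have := sub_mem hQ' hbQ
        rwa [show x + (a + b) - b = x + a by ring] at this
    · refine ⟨a, ha, fun Q hQ => ?_⟩
      by_cases hQP : Q = P
      · rwa [hQP]
      · exact hA Q (Finset.mem_erase.2 ⟨hQP, hQ⟩)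

open CategoryTheory Abelian Limits RingTheory.Sequence Pointwise in
theorem exists_reg_gen {R : Type u} [CommRing R] [IsNoetherianRing R] (J : Ideal R) (n : ℕ)
    (M : ModuleCat.{u} R) [Module.Finite R M] (hlt : J • (⊤ : Submodule R M) < ⊤)
    (K : Ideal R) (hK : ∀ r ∈ K, ∀ z : M, r • z = 0) (x : Fin n → R)
    (hJ : J = K ⊔ Ideal.span (Set.range x))
    (hreg : ∃ rs : List R, rs.length = n ∧ (∀ r ∈ rs, r ∈ J) ∧ IsRegular M rs) :
    ∃ rs : List R, rs.length = n ∧ IsRegular M rs ∧ J = K ⊔ Ideal.ofList rs := by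
  induction n generalizing M K with
  | zero =>
    obtain ⟨rs, h1, -, h2⟩ := hreg
    obtain rfl : rs = [] := List.length_eq_zero_iff.1 h1
    refine ⟨[], rfl, h2, ?_⟩
    rw [hJ]
    simp
  | succ n ih =>
    have hnt : Nontrivial M := (Submodule.nontrivial_iff R).mp (nontrivial_of_lt _ _ hlt)
    -- avoid associated primes
    have hfin := associatedPrimes.finite R M
    obtain ⟨a, ha, hav⟩ := coset_avoid hfin.toFinset (x 0) (Ideal.span (Set.range (Fin.tail x)))
      (fun P hP => ((Set.Finite.mem_toFinset _).1 hP).1) (by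
        rintro P hP ⟨h1, h2⟩
        have hP' := (Set.Finite.mem_toFinset _).1 hP
        obtain ⟨rs, hl, hm, hr⟩ := hreg
        rcases rs with _ | ⟨r, rs⟩
        · simp at hl
        have hrP : r ∈ P := by
          have : J ≤ P := by
            rw [hJ]
            refine sup_le ?_ ?_
            · intro r hr
              obtain ⟨hPp, z, hz⟩ := isAssociatedPrime_iff.1 hP'
              rw [hz]
              exact Submodule.mem_colon_singleton.2 ((Submodule.mem_bot R).2 (hK r hr z))
            · rw [Ideal.span_le]
              rintro _ ⟨i, rfl⟩
              refine Fin.cases h1 (fun i => h2 (Ideal.subset_span ⟨i, rfl⟩)) i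
          exact this (hm r (by simp))
        have hsr := ((isRegular_cons_iff M r rs).1 hr).1
        obtain ⟨hPp, z, hz⟩ := isAssociatedPrime_iff.1 hP'
        rw [hz] at hrP
        have h0 : r • z = 0 := (Submodule.mem_bot R).1 (Submodule.mem_colon_singleton.1 hrP)
        have hz0 : z = 0 := isSMulRegular_iff_right_eq_zero_of_smul.1 hsr z h0
        apply hPp.ne_top
        rw [hz, hz0, Ideal.eq_top_iff_one]
        exact Submodule.mem_colon_singleton.2 (by rw [smul_zero]; exact zero_mem _))
    set y := x 0 + a with hy
    have hyreg : IsSMulRegular M y := by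
      rw [isSMulRegular_iff_right_eq_zero_of_smul]
      intro z hz
      by_contra hz0
      obtain ⟨P, hP, hyP⟩ : ∃ P ∈ associatedPrimes R M, y ∈ P := by
        have := biUnion_associatedPrimes_eq_zero_divisors R M
        have hy' : y ∈ {r : R | ∃ x : M, x ≠ 0 ∧ r • x = 0} := ⟨z, hz0, hz⟩
        rw [← this] at hy'
        simpa using hy'
      exact hav P ((Set.Finite.mem_toFinset _).2 hP) hyP
    have hx0 : x 0 ∈ J := hJ ▸ Ideal.mem_sup_right (Ideal.subset_span ⟨0, rfl⟩)
    have htail : Ideal.span (Set.range (Fin.tail x)) ≤ J := by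
      rw [Ideal.span_le]
      rintro _ ⟨i, rfl⟩
      exact hJ ▸ Ideal.mem_sup_right (Ideal.subset_span ⟨i.succ, rfl⟩)
    have hyJ : y ∈ J := add_mem hx0 (htail ha)
    have hlt' : J • (⊤ : Submodule R (QuotSMulTop y M)) < ⊤ := by
      refine lt_top_iff_ne_top.2 fun eq => ?_
      absurd congrArg (Submodule.comap (Submodule.mkQ _)) eq
      simpa [Submodule.comap_smul_top_of_surjective J _ (Submodule.mkQ_surjective _),
        Submodule.smul_mono_left ((Ideal.span_singleton_le_iff_mem J).mpr hyJ),
        ← Submodule.ideal_span_singleton_smul] using hlt.ne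
    have hext := ((ModuleCat.exists_isRegular_tfae J (n + 1) M hlt).out 3 1).1 hreg
    have hreg' : ∃ rs : List R, rs.length = n ∧ (∀ r ∈ rs, r ∈ J) ∧
        IsRegular (ModuleCat.of R (QuotSMulTop y M)) rs := by
      refine ((ModuleCat.exists_isRegular_tfae J n (ModuleCat.of R (QuotSMulTop y M)) hlt').out 3 1).2 ?_
      intro i hi
      have zero1 := AddCommGrpCat.isZero_of_iff_subsingleton.mpr (hext i (by omega))
      have zero2 := AddCommGrpCat.isZero_of_iff_subsingleton.mpr (hext (i + 1) (by omega))
      exact AddCommGrpCat.subsingleton_of_isZero <| ShortComplex.Exact.isZero_of_both_zeros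
        ((Ext.covariant_sequence_exact₃' _ hyreg.smulShortComplex_shortExact) i (i + 1) rfl)
        (zero1.eq_zero_of_src _) (zero2.eq_zero_of_tgt _)
    obtain ⟨rs, hl, hr, hJ'⟩ := ih (ModuleCat.of R (QuotSMulTop y M)) hlt' (K ⊔ Ideal.span {y}) (by
      intro r hr z
      induction z using Submodule.Quotient.induction_on with
      | _ z =>
      obtain ⟨k, hk, c, hc, rfl⟩ := Submodule.mem_sup.1 hr
      obtain ⟨c, rfl⟩ := Ideal.mem_span_singleton'.1 hc
      rw [← Submodule.Quotient.mk_smul, Submodule.Quotient.mk_eq_zero, add_smul, hK k hk, zero_add,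
        mul_comm, mul_smul]
      exact Submodule.smul_mem_pointwise_smul _ _ _ trivial) (Fin.tail x) (by
        apply le_antisymm
        · rw [hJ]
          refine sup_le (le_sup_left.trans le_sup_left) ?_
          rw [Ideal.span_le]
          rintro _ ⟨i, rfl⟩
          refine Fin.cases ?_ (fun i => ?_) i
          · have : x 0 = y - a := by simp [hy]
            rw [this]
            exact sub_mem (Ideal.mem_sup_left (Ideal.mem_sup_right (Ideal.mem_span_singleton_self y)))
              (Ideal.mem_sup_right ha)
          · exact Ideal.mem_sup_right (Ideal.subset_span ⟨i, rfl⟩)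
        · refine sup_le (sup_le (hJ ▸ le_sup_left) ?_) htail
          exact (Ideal.span_singleton_le_iff_mem _).2 hyJ) hreg'
    refine ⟨y :: rs, by simp [hl], (isRegular_cons_iff M y rs).2 ⟨hyreg, hr⟩, ?_⟩
    rw [Ideal.ofList_cons, ← sup_assoc]
    exact hJ'

end CM
end NH

end

section
set_option synthInstance.maxHeartbeats 1000000
set_option maxHeartbeats 400000

open IsLocalRing Polynomial Finset

namespace NH

abbrev sp {R ι : Type*} [CommRing R] (x : ι → R) : Ideal R := Ideal.span (Set.range x)

/-- quasi-regular sequence -/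
def QR {R ι : Type*} [CommRing R] (x : ι → R) : Prop :=
  ∀ (n : ℕ) (p : MvPolynomial ι R), p.IsHomogeneous n → MvPolynomial.eval x p ∈ sp x ^ (n + 1) →
    ∀ m, p.coeff m ∈ sp x

theorem mem_form {R ι : Type*} [CommRing R] {x : ι → R} {n : ℕ} {y : R} :
    y ∈ sp x ^ n ↔ ∃ p : MvPolynomial ι R, p.IsHomogeneous n ∧ MvPolynomial.eval x p = y :=
  Ideal.mem_span_pow_iff_exists_isHomogeneous x y

theorem prod_mem {R ι : Type*} [CommRing R] (x : ι → R) (m : ι →₀ ℕ) :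
    (m.prod fun i k => x i ^ k) ∈ sp x ^ m.degree := by
  rw [mem_form]
  refine ⟨MvPolynomial.monomial m 1, MvPolynomial.isHomogeneous_monomial _ rfl, ?_⟩
  rw [MvPolynomial.eval_monomial, one_mul]

theorem eval_mem_mul {R ι : Type*} [CommRing R] (x : ι → R) {n : ℕ} {p : MvPolynomial ι R}
    (hp : p.IsHomogeneous n) (K : Ideal R) (h : ∀ m, p.coeff m ∈ K) :
    MvPolynomial.eval x p ∈ K * sp x ^ n := by
  rw [MvPolynomial.eval_eq]
  refine Ideal.sum_mem _ fun m hm => Ideal.mul_mem_mul (h m) ?_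
  have := prod_mem x m
  have hd : m.degree = n := by
    by_contra hne
    exact MvPolynomial.mem_support_iff.1 hm (hp.coeff_eq_zero hne)
  rwa [hd] at this

theorem eval_mem_pow {R ι : Type*} [CommRing R] (x : ι → R) {n : ℕ} {p : MvPolynomial ι R}
    (hp : p.IsHomogeneous n) : MvPolynomial.eval x p ∈ sp x ^ n := mem_form.2 ⟨p, hp, rfl⟩

/-- mapping a form into a quotient -/
theorem qr_coeff_of_map {R S ι : Type*} [CommRing R] [CommRing S] (f : R →+* S)
    (hf : Function.Surjective f) {x : ι → R} (h : QR (f ∘ x)) {n : ℕ} {p : MvPolynomial ι R}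
    (hp : p.IsHomogeneous n)
    (he : MvPolynomial.eval x p ∈ RingHom.ker f ⊔ sp x ^ (n + 1)) (m : ι →₀ ℕ) :
    p.coeff m ∈ RingHom.ker f ⊔ sp x := by
  have hsp : sp (f ∘ x) = (sp x).map f := by
    rw [sp, sp, Ideal.map_span, Set.range_comp]
  have h1 : MvPolynomial.eval (f ∘ x) (MvPolynomial.map f p) ∈ sp (f ∘ x) ^ (n + 1) := by
    have h2 : MvPolynomial.eval (f ∘ x) (MvPolynomial.map f p) = f (MvPolynomial.eval x p) := by
      rw [MvPolynomial.eval_map, MvPolynomial.eval₂_comp]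
    rw [h2, hsp, ← Ideal.map_pow]
    obtain ⟨a, ha, b, hb, hab⟩ := Submodule.mem_sup.1 he
    rw [← hab, map_add, (RingHom.mem_ker).1 ha, zero_add]
    exact Ideal.mem_map_of_mem f hb
  have h3 := h n _ (hp.map f) h1 m
  rw [MvPolynomial.coeff_map, hsp] at h3
  have h4 : p.coeff m ∈ ((sp x).map f).comap f := h3
  rw [Ideal.comap_map_of_surjective f hf] at h4
  rw [sup_comm]; exact h4

theorem qr_inter {R S ι : Type*} [CommRing R] [IsNoetherianRing R] [CommRing S] (f : R →+* S)
    (hf : Function.Surjective f) {x : ι → R} (h : QR (f ∘ x)) (N : ℕ) :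
    sp x ^ N ⊓ RingHom.ker f ≤ sp x ^ N * RingHom.ker f := by
  set K := RingHom.ker f
  have step : ∀ N, sp x ^ N ⊓ K ≤ sp x ^ N * K ⊔ (sp x ^ (N + 1) ⊓ K) := by
    rintro N z ⟨hz, hzK⟩
    obtain ⟨p, hp, rfl⟩ := mem_form.1 hz
    have h1 := eval_mem_mul x hp (K ⊔ sp x)
      (qr_coeff_of_map f hf h hp (Ideal.mem_sup_left hzK))
    rw [Ideal.sup_mul] at h1
    obtain ⟨a, ha, b, hb, hab⟩ := Submodule.mem_sup.1 h1
    refine Submodule.mem_sup.2 ⟨a, by rwa [mul_comm], b, ⟨by rwa [pow_succ'], ?_⟩, hab⟩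
    have : b = MvPolynomial.eval x p - a := by rw [← hab]; ring
    rw [this]
    exact sub_mem hzK (Ideal.mul_le_left ha)
  have step2 : ∀ k, sp x ^ N ⊓ K ≤ sp x ^ N * K ⊔ (sp x ^ (N + k) ⊓ K) := by
    intro k
    induction k with
    | zero => exact le_sup_right
    | succ k ih =>
      refine ih.trans (sup_le le_sup_left ((step (N + k)).trans (sup_le ?_ le_sup_right)))
      exact (Ideal.mul_mono_left (Ideal.pow_le_pow_right (by omega))).trans le_sup_left
  obtain ⟨c, hc⟩ := Ideal.exists_pow_inf_eq_pow_smul (sp x) (K : Submodule R R)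
  refine (step2 c).trans (sup_le le_rfl ?_)
  have := hc (N + c) (by omega)
  simp only [smul_eq_mul, Ideal.mul_top] at this
  rw [this, Nat.add_sub_cancel]
  exact Ideal.mul_mono_right inf_le_right

theorem pow_sup_le {R : Type*} [CommRing R] (K L : Ideal R) (n : ℕ) :
    (K ⊔ L) ^ (n + 1) ≤ K * (K ⊔ L) ^ n ⊔ L ^ (n + 1) := by
  induction n with
  | zero => simp
  | succ n ih =>
    rw [pow_succ]
    refine (Ideal.mul_mono_left ih).trans ?_
    rw [Ideal.sup_mul, Ideal.mul_sup (L ^ (n+1)), mul_assoc, ← pow_succ, ← pow_succ]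
    refine sup_le le_sup_left (sup_le ?_ le_sup_right)
    rw [mul_comm]
    exact (Ideal.mul_mono_right (Ideal.pow_right_mono le_sup_right _)).trans le_sup_left

theorem sp_cons {R : Type*} [CommRing R] {n : ℕ} (y : R) (x : Fin n → R) :
    sp (Fin.cons y x : Fin (n + 1) → R) = Ideal.span {y} ⊔ sp x := by
  rw [sp, Fin.range_cons, ← Set.singleton_union, Ideal.span_union]

theorem qr_cons {R S : Type*} [CommRing R] [IsNoetherianRing R] [CommRing S] (f : R →+* S)
    (hf : Function.Surjective f) {k : ℕ} {x : Fin k → R} (h : QR (f ∘ x)) (y : R)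
    (hy : ∀ z, y * z = 0 → z = 0) (hk : RingHom.ker f = Ideal.span {y}) :
    QR (Fin.cons y x : Fin (k + 1) → R) := by
  intro n
  induction n with
  | zero =>
    intro p hp he m
    by_cases hm : m = 0
    · subst hm
      have h1 : p = MvPolynomial.C (p.coeff 0) := by
        have := MvPolynomial.totalDegree_eq_zero_iff_eq_C.1 (Nat.le_zero.1 hp.totalDegree_le)
        exact this
      rw [h1] at he
      simpa using he
    · rw [hp.coeff_eq_zero (by simpa [Finsupp.degree_eq_zero_iff] using hm)]; exact zero_mem _
  | succ n ih =>
    intro p hp he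
    rw [sp_cons] at he
    set P := MvPolynomial.finSuccEquiv R k p with hP
    set p0 := P.coeff 0 with hp0
    set p1 := (MvPolynomial.finSuccEquiv R k).symm P.divX with hp1
    have hc0 : ∀ m, p0.coeff m = p.coeff (m.cons 0) := fun m => by
      rw [hp0, hP, MvPolynomial.finSuccEquiv_coeff_coeff]
    have hc1 : ∀ m, p1.coeff m = p.coeff (m + Finsupp.single 0 1) := fun m => by
      have : m = (Finsupp.tail m).cons (m 0) := (Finsupp.cons_tail m).symm
      rw [this, ← MvPolynomial.finSuccEquiv_coeff_coeff, hp1, AlgEquiv.apply_symm_apply, coeff_divX,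
        hP, MvPolynomial.finSuccEquiv_coeff_coeff]
      congr 1
      ext i
      refine Fin.cases ?_ (fun i => ?_) i
      · simp
      · simp [Finsupp.tail_apply]
    have hh0 : p0.IsHomogeneous (n + 1) := by
      intro m hm
      rw [hc0] at hm
      have := hp hm
      rw [← this]
      simp [Finsupp.weight_apply, Finsupp.sum_cons]
    have hh1 : p1.IsHomogeneous n := by
      intro m hm
      rw [hc1] at hm
      have := hp hm
      rw [map_add] at this
      simpa [Finsupp.weight_single] using this
    have hev : MvPolynomial.eval (Fin.cons y x : Fin (k + 1) → R) p
        = MvPolynomial.eval x p0 + y * MvPolynomial.eval (Fin.cons y x : Fin (k + 1) → R) p1 := by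
      have e1 := MvPolynomial.eval_eq_eval_mv_eval' x y p
      have e2 := MvPolynomial.eval_eq_eval_mv_eval' x y p1
      rw [e1, e2, hp1, AlgEquiv.apply_symm_apply, ← hP]
      conv_lhs => rw [← divX_mul_X_add P]
      simp [hp0, mul_comm, add_comm]
    have hker : RingHom.ker f = Ideal.span {y} := hk
    have e1 := pow_sup_le (Ideal.span {y}) (sp x) (n + 1) he
    rw [hev] at e1
    have e2 : MvPolynomial.eval x p0 ∈ RingHom.ker f ⊔ sp x ^ (n + 1 + 1) := by
      rw [hk]
      have hle : Ideal.span {y} * (Ideal.span {y} ⊔ sp x) ^ (n + 1) ⊔ sp x ^ (n + 1 + 1)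
          ≤ Ideal.span {y} ⊔ sp x ^ (n + 1 + 1) := sup_le_sup_right Ideal.mul_le_left _
      have := hle e1
      have h3 := sub_mem this (Ideal.mem_sup_left
        (Ideal.mul_mem_right (MvPolynomial.eval (Fin.cons y x : Fin (k + 1) → R) p1) _
          (Ideal.mem_span_singleton_self y)) : _ ∈ Ideal.span {y} ⊔ sp x ^ (n + 1 + 1))
      simpa using h3
    have e3 := qr_coeff_of_map f hf h hh0 e2
    have e4 : MvPolynomial.eval x p0 ∈ Ideal.span {y} * sp x ^ (n + 1) ⊔ sp x ^ (n + 1 + 1) := by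
      have := eval_mem_mul x hh0 _ e3
      rwa [Ideal.sup_mul, hk, ← pow_succ'] at this
    have e5 : y * MvPolynomial.eval (Fin.cons y x : Fin (k + 1) → R) p1 ∈
        Ideal.span {y} * (Ideal.span {y} ⊔ sp x) ^ (n + 1) ⊔ sp x ^ (n + 1 + 1) := by
      have hle : Ideal.span {y} * sp x ^ (n + 1) ⊔ sp x ^ (n + 1 + 1) ≤
        Ideal.span {y} * (Ideal.span {y} ⊔ sp x) ^ (n + 1) ⊔ sp x ^ (n + 1 + 1) :=
        sup_le_sup_right (Ideal.mul_mono_right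
        (Ideal.pow_right_mono (le_sup_right : sp x ≤ Ideal.span {y} ⊔ sp x) (n + 1))) _
      have e4' := hle e4
      simpa using sub_mem e1 e4'
    obtain ⟨a, ha, b, hb, hab⟩ := Submodule.mem_sup.1 e5
    obtain ⟨a', ha', rfl⟩ := Ideal.mem_span_singleton_mul.1 ha
    have hbK : b ∈ RingHom.ker f := by
      rw [hk, Ideal.mem_span_singleton']
      exact ⟨MvPolynomial.eval (Fin.cons y x : Fin (k + 1) → R) p1 - a', by rw [mul_comm, mul_sub, ← hab]; ring⟩
    have hb' := qr_inter f hf h _ ⟨hb, hbK⟩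
    rw [hk, mul_comm, Ideal.mem_span_singleton_mul] at hb'
    obtain ⟨b', hb', rfl⟩ := hb'
    have e6 : MvPolynomial.eval (Fin.cons y x : Fin (k + 1) → R) p1 = a' + b' := by
      rw [← sub_eq_zero]
      apply hy
      rw [mul_sub, mul_add, hab, sub_self]
    have e7 := ih p1 hh1 (by
      rw [e6, sp_cons]
      exact add_mem ha' (Ideal.pow_right_mono le_sup_right _ (Ideal.pow_le_pow_right (by omega) hb')))
    intro m
    by_cases hm : m 0 = 0
    · have : m = (Finsupp.tail m).cons 0 := by rw [← hm, Finsupp.cons_tail]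
      rw [this, ← hc0, sp_cons, ← hk]
      exact e3 _
    · have : m = (m - Finsupp.single 0 1) + Finsupp.single 0 1 := by
        rw [tsub_add_cancel_of_le]
        simpa using Nat.one_le_iff_ne_zero.2 hm
      rw [this, ← hc1]
      exact e7 _

open RingTheory.Sequence Pointwise in
theorem qr_of_reg {R : Type*} [CommRing R] [IsNoetherianRing R] (rs : List R) (K : Ideal R)
    (h : IsWeaklyRegular (R ⧸ K) rs) : QR (fun i => Ideal.Quotient.mk K (rs.get i)) := by
  induction rs generalizing K with
  | nil =>
    intro n p hp he m
    have hem : IsEmpty (Fin ([] : List R).length) := Fin.isEmpty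
    rw [sp, Set.range_eq_empty, Ideal.span_empty] at he ⊢
    have hp0 : p = MvPolynomial.C (p.coeff 0) := MvPolynomial.eq_C_of_isEmpty p
    rw [hp0] at he
    have h1 : p.coeff 0 = 0 := by
      have : (⊥ : Ideal (R ⧸ K)) ^ (n + 1) = ⊥ := by
        rw [pow_succ, Ideal.mul_bot]
      rw [this] at he
      simpa using he
    rw [hp0, h1]; simp
  | cons r rs ih =>
    rw [isWeaklyRegular_cons_iff] at h
    obtain ⟨h1, h2⟩ := h
    have hsm : (r • ⊤ : Submodule R (R ⧸ K)) = Submodule.map (Submodule.mkQ K) (Ideal.span {r}) := by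
      ext z
      rw [Submodule.mem_smul_pointwise_iff_exists, Submodule.mem_map]
      constructor
      · rintro ⟨w, -, rfl⟩
        obtain ⟨w, rfl⟩ := Submodule.mkQ_surjective K w
        exact ⟨r * w, Ideal.mul_mem_right _ _ (Ideal.mem_span_singleton_self r), by
          rw [← smul_eq_mul, map_smul]⟩
      · rintro ⟨w, hw, rfl⟩
        obtain ⟨c, rfl⟩ := Ideal.mem_span_singleton'.1 hw
        exact ⟨Submodule.mkQ K c, trivial, by rw [← map_smul, smul_eq_mul, mul_comm]⟩
    have e : QuotSMulTop r (R ⧸ K) ≃ₗ[R] R ⧸ (K ⊔ Ideal.span {r}) :=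
      (Submodule.quotEquivOfEq _ _ hsm).trans (Submodule.quotientQuotientEquivQuotientSup K (Ideal.span {r}))
    have h3 := ih (K ⊔ Ideal.span {r}) ((e.isWeaklyRegular_congr rs).1 h2)
    let f : R ⧸ K →+* R ⧸ (K ⊔ Ideal.span {r}) := Ideal.Quotient.factor le_sup_left
    have hf : Function.Surjective f := Ideal.Quotient.factor_surjective le_sup_left
    have := qr_cons f hf (x := fun i => Ideal.Quotient.mk K (rs.get i)) h3 (Ideal.Quotient.mk K r) (by
      intro z hz
      obtain ⟨z, rfl⟩ := Ideal.Quotient.mk_surjective z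
      exact isSMulRegular_iff_right_eq_zero_of_smul.1 h1 (Ideal.Quotient.mk K z) hz) (by
        ext z
        obtain ⟨z, rfl⟩ := Ideal.Quotient.mk_surjective z
        rw [RingHom.mem_ker, Ideal.Quotient.factor_mk, Ideal.Quotient.eq_zero_iff_mem,
          ← Set.image_singleton, ← Ideal.map_span, Ideal.mem_map_iff_of_surjective _ Ideal.Quotient.mk_surjective,
          Submodule.mem_sup]
        constructor
        · rintro ⟨a, ha, b, hb, rfl⟩
          exact ⟨b, hb, by rw [map_add, Ideal.Quotient.eq_zero_iff_mem.2 ha, zero_add]⟩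
        · rintro ⟨b, hb, hbz⟩
          exact ⟨z - b, by rwa [← Ideal.Quotient.eq, eq_comm], b, hb, by ring⟩)
    have hfun : (fun i : Fin (r :: rs).length => Ideal.Quotient.mk K ((r :: rs).get i)) =
        (Fin.cons (Ideal.Quotient.mk K r) (fun i => Ideal.Quotient.mk K (rs.get i)) :
          Fin (rs.length + 1) → R ⧸ K) := by
      funext i
      refine Fin.cases ?_ (fun i => ?_) i <;> rfl
    rw [hfun]
    exact this

end NH

end

section
set_option synthInstance.maxHeartbeats 1000000
set_option maxHeartbeats 400000

open IsLocalRing Polynomial Finset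

namespace NH

theorem qr_of_map_bot {R S ι : Type*} [CommRing R] [CommRing S] (f : R →+* S)
    (hf : Function.Bijective f) {x : ι → R} (h : QR (f ∘ x)) : QR x := by
  intro n p hp he m
  have := qr_coeff_of_map f hf.2 h hp (Ideal.mem_sup_right he) m
  rwa [(RingHom.injective_iff_ker_eq_bot f).1 hf.1, bot_sup_eq] at this

theorem qr_change {R ι : Type*} [CommRing R] [Fintype ι] [DecidableEq ι] {x x' : ι → R}
    (hx : QR x) (hs : sp x = sp x') : QR x' := by
  have hA : ∀ i, ∃ c : ι → R, ∑ j, c j * x j = x' i := fun i => by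
    have : x' i ∈ sp x := hs ▸ Ideal.subset_span ⟨i, rfl⟩
    rwa [Ideal.mem_span_range_iff_exists_fun] at this
  have hB : ∀ i, ∃ c : ι → R, ∑ j, c j * x' j = x i := fun i => by
    have : x i ∈ sp x' := hs ▸ Ideal.subset_span ⟨i, rfl⟩
    rwa [Ideal.mem_span_range_iff_exists_fun] at this
  choose A hA using hA
  choose B hB using hB
  set J := sp x with hJ
  let q := Ideal.Quotient.mk J
  have lin : ∀ c : ι → R, (∑ k, c k * x k = 0) → ∀ k, c k ∈ J := by
    intro c hc k
    have h1 : (∑ k, MvPolynomial.C (c k) * MvPolynomial.X k : MvPolynomial ι R).IsHomogeneous 1 := by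
      refine MvPolynomial.IsHomogeneous.sum _ _ _ fun i _ => ?_
      simpa using (MvPolynomial.isHomogeneous_X R i).C_mul (c i)
    have h2 := hx 1 _ h1 (by simp [hc]) (Finsupp.single k 1)
    simpa [MvPolynomial.coeff_sum, MvPolynomial.coeff_C_mul, MvPolynomial.coeff_X, Finsupp.single_left_inj,
      Finset.sum_ite_eq'] using h2
  let Am : Matrix ι ι (R ⧸ J) := Matrix.of fun i j => q (A i j)
  let Bm : Matrix ι ι (R ⧸ J) := Matrix.of fun i j => q (B i j)
  have hBA : Bm * Am = 1 := by
    ext i k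
    have h1 := lin (fun k => (∑ j, B i j * A j k) - if i = k then 1 else 0) (by
      simp only [sub_mul, Finset.sum_sub_distrib, ite_mul, one_mul, zero_mul, Finset.sum_ite_eq,
        Finset.mem_univ, if_true, Finset.sum_mul]
      rw [Finset.sum_comm, sub_eq_zero, ← hB i]
      refine Finset.sum_congr rfl fun j _ => ?_
      rw [← hA j, Finset.mul_sum]
      exact Finset.sum_congr rfl fun k _ => by ring) k
    have h2 := Ideal.Quotient.eq.2 h1
    rw [Matrix.mul_apply, Matrix.one_apply]
    simp only [Am, Bm, Matrix.of_apply, q]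
    rw [map_sum] at h2
    simp only [map_mul] at h2
    rw [h2]
    split_ifs <;> simp
  have hAB : Am * Bm = 1 := mul_eq_one_comm.1 hBA
  intro n p hp he m
  rw [← hs] at he ⊢
  let l : ι → MvPolynomial ι R := fun i => ∑ j, MvPolynomial.C (A i j) * MvPolynomial.X j
  have hl : ∀ i, (l i).IsHomogeneous 1 := fun i => by
    refine MvPolynomial.IsHomogeneous.sum _ _ _ fun j _ => ?_
    simpa using (MvPolynomial.isHomogeneous_X R j).C_mul (A i j)
  have h1 : (MvPolynomial.bind₁ l p).IsHomogeneous n := by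
    have := hp.aeval l hl
    simpa using this
  have h2 : MvPolynomial.eval x (MvPolynomial.bind₁ l p) = MvPolynomial.eval x' p := by
    have e1 : MvPolynomial.eval x (MvPolynomial.bind₁ l p)
      = MvPolynomial.eval (fun i => MvPolynomial.eval x (l i)) p := by
      simp only [MvPolynomial.eval]
      exact MvPolynomial.eval₂Hom_bind₁ _ _ _ _
    rw [e1]
    congr 2
    funext i
    simp [l, hA i]
  have h3 := hx n _ h1 (by rw [h2]; exact he)
  have h4 : MvPolynomial.map q (MvPolynomial.bind₁ l p) = 0 := by
    ext m
    rw [MvPolynomial.coeff_map, MvPolynomial.coeff_zero]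
    exact Ideal.Quotient.eq_zero_iff_mem.2 (h3 m)
  rw [MvPolynomial.map_bind₁] at h4
  let l' : ι → MvPolynomial ι (R ⧸ J) := fun i => ∑ j, MvPolynomial.C (Bm i j) * MvPolynomial.X j
  have h5 : MvPolynomial.map q p = 0 := by
    have h6 := congrArg (MvPolynomial.bind₁ l') h4
    rw [MvPolynomial.bind₁_bind₁, map_zero] at h6
    have h7 : (fun i => MvPolynomial.bind₁ l' (MvPolynomial.map q (l i))) = MvPolynomial.X := by
      funext i
      have : MvPolynomial.bind₁ l' (MvPolynomial.map q (l i)) =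
          ∑ k, MvPolynomial.C ((Am * Bm) i k) * MvPolynomial.X k := by
        simp only [l, l', map_sum, map_mul, MvPolynomial.map_C, MvPolynomial.map_X,
          MvPolynomial.bind₁_C_right, MvPolynomial.bind₁_X_right, Matrix.mul_apply, Finset.sum_mul,
          Finset.mul_sum, Am, Matrix.of_apply]
        rw [Finset.sum_comm]
        exact Finset.sum_congr rfl fun k _ => Finset.sum_congr rfl fun j _ => by ring
      rw [this, hAB]
      simp [Matrix.one_apply]
    have h8 : (fun i => MvPolynomial.bind₁ l' (MvPolynomial.map q (l i))) =
      (fun i => MvPolynomial.bind₁ l' ((fun i => MvPolynomial.map q (l i)) i)) := rfl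
    rw [← h8, h7, MvPolynomial.bind₁_X_left] at h6
    simpa using h6
  have h9 := congrArg (MvPolynomial.coeff m) h5
  rw [MvPolynomial.coeff_map, MvPolynomial.coeff_zero] at h9
  exact Ideal.Quotient.eq_zero_iff_mem.1 h9

universe u
open RingTheory.Sequence in
theorem cm_qr {R : Type u} [CommRing R] [IsLocalRing R] [IsNoetherianRing R] {d : ℕ} (hd : 0 < d)
    (hdim : ringKrullDim R = d) (hCM : IsCMLocal R) (s : Fin d → R) (N : ℕ)
    (hN : maximalIdeal R ^ N ≤ sp s) (hm : sp s ≤ maximalIdeal R) :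
    QR s ∧ ∃ rs : List R, rs.length = d ∧ IsRegular R rs ∧ sp s = Ideal.ofList rs := by
  have h1 : rdepth R (maximalIdeal R) R = d := by
    have := hCM
    unfold IsCMLocal at this
    rw [hdim] at this
    exact_mod_cast this
  obtain ⟨rs0, hl0, hm0, hr0⟩ : ∃ rs : List R, rs.length = d ∧ (∀ x ∈ rs, x ∈ maximalIdeal R) ∧
      IsRegular R rs := by
    unfold rdepth at h1
    have hlt : ((d - 1 : ℕ) : ℕ∞) < (d : ℕ∞) := by exact_mod_cast (by omega : d - 1 < d)
    conv_rhs at hlt => rw [← h1]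
    obtain ⟨a, ⟨rs, h2, h3, h4⟩, ha⟩ := lt_sSup_iff.1 hlt
    have hle : a ≤ d := h1 ▸ le_sSup ⟨rs, h2, h3, h4⟩
    rw [← h2] at ha hle
    have ha' : d - 1 < rs.length := by exact_mod_cast ha
    have hle' : rs.length ≤ d := by exact_mod_cast hle
    exact ⟨rs, by omega, h3, h4⟩
  have hlt : ∀ J : Ideal R, J ≤ maximalIdeal R → J • (⊤ : Submodule R (ModuleCat.of R R)) < ⊤ := by
    intro J hJ
    have : J • (⊤ : Submodule R R) < ⊤ := by
      rw [smul_eq_mul, Ideal.mul_top]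
      exact lt_of_le_of_lt hJ (lt_top_iff_ne_top.2 (maximalIdeal.isMaximal R).ne_top)
    exact this
  have htf := (ModuleCat.exists_isRegular_tfae (maximalIdeal R) d
    (ModuleCat.of R R) (hlt _ le_rfl)).out 3 2 rfl rfl
  obtain ⟨M, hM1, hM2, hM3, hM4⟩ := htf.1 ⟨rs0, hl0, hm0, hr0⟩
  have hz : PrimeSpectrum.zeroLocus (maximalIdeal R : Set R) = PrimeSpectrum.zeroLocus (sp s : Set R) := by
    rw [PrimeSpectrum.zeroLocus_eq_iff]
    apply le_antisymm
    · rw [Ideal.radical_le_radical_iff]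
      intro x hx
      exact ⟨N, hN (Ideal.pow_mem_pow hx N)⟩
    · exact Ideal.radical_mono hm
  have htf2 := (ModuleCat.exists_isRegular_tfae (sp s) d
    (ModuleCat.of R R) (hlt _ hm)).out 3 2 rfl rfl
  have hreg := htf2.2 ⟨M, hM1, hM2, by rw [hM3, hz], hM4⟩
  obtain ⟨rs, hl, hr, hJ⟩ := exists_reg_gen (sp s) d (ModuleCat.of R R) (hlt _ hm) ⊥ (by
    intro r hr z; rw [(Submodule.mem_bot R).1 hr, zero_smul]) s (by rw [bot_sup_eq]) hreg
  rw [bot_sup_eq] at hJ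
  refine ⟨?_, rs, hl, hr, hJ⟩
  have hw : IsWeaklyRegular R rs := hr.toIsWeaklyRegular
  have e : R ≃ₗ[R] R ⧸ (⊥ : Ideal R) := (Submodule.quotEquivOfEqBot ⊥ rfl).symm
  have hq := qr_of_reg rs ⊥ ((e.isWeaklyRegular_congr rs).1 hw)
  have hq' : QR (fun i => rs.get i) := by
    refine qr_of_map_bot (Ideal.Quotient.mk ⊥) ⟨?_, Ideal.Quotient.mk_surjective⟩ hq
    rw [RingHom.injective_iff_ker_eq_bot, Ideal.mk_ker]
  subst hl
  refine qr_change hq' ?_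
  rw [hJ, Ideal.ofList, sp]
  congr 1
  ext z
  simp [List.mem_iff_get]

end NH

end

section
set_option synthInstance.maxHeartbeats 1000000
set_option maxHeartbeats 400000

open IsLocalRing Polynomial Finset


namespace NH

abbrev xm {R ι : Type*} [CommRing R] (x : ι → R) (m : ι →₀ ℕ) : R := m.prod fun i k => x i ^ k

theorem xm_add {R ι : Type*} [CommRing R] (x : ι → R) (a b : ι →₀ ℕ) : xm x (a + b) = xm x a * xm x b := by
  classical
  exact Finsupp.prod_add_index' (by simp) (by intros; rw [pow_add])

theorem xm_single {R ι : Type*} [CommRing R] (x : ι → R) (i : ι) (k : ℕ) :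
    xm x (Finsupp.single i k) = x i ^ k := by
  simp [xm]

/-- ideal generated by the monomials with exponents in `E` of degree at least `i`. -/
def mi {R ι : Type*} [CommRing R] (x : ι → R) (E : Set (ι →₀ ℕ)) (i : ℕ) : Ideal R :=
  Ideal.span (xm x '' {β | β ∈ E ∧ i ≤ β.degree})

theorem mi_le_pow {R ι : Type*} [CommRing R] (x : ι → R) (E : Set (ι →₀ ℕ)) (i : ℕ) :
    mi x E i ≤ sp x ^ i := by
  rw [mi, Ideal.span_le]
  rintro _ ⟨β, ⟨_, h⟩, rfl⟩
  exact Ideal.pow_le_pow_right h (prod_mem x β)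

/-- split off the lowest degree part -/
theorem mi_split {R ι : Type*} [CommRing R] (x : ι → R) (E : Set (ι →₀ ℕ)) (i : ℕ) {b : R}
    (hb : b ∈ mi x E i) : ∃ q : MvPolynomial ι R, q.IsHomogeneous i ∧ (∀ β, β ∉ E → q.coeff β = 0) ∧
      b - MvPolynomial.eval x q ∈ mi x E (i + 1) := by
  classical
  refine Submodule.span_induction (p := fun b _ => ∃ q : MvPolynomial ι R, q.IsHomogeneous i ∧
    (∀ β, β ∉ E → q.coeff β = 0) ∧ b - MvPolynomial.eval x q ∈ mi x E (i + 1)) ?_ ?_ ?_ ?_ hb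
  · rintro _ ⟨β, ⟨hE, h⟩, rfl⟩
    by_cases hi : β.degree = i
    · refine ⟨MvPolynomial.monomial β 1, MvPolynomial.isHomogeneous_monomial _ hi, ?_, ?_⟩
      · intro γ hγ
        rw [MvPolynomial.coeff_monomial, if_neg]
        rintro rfl; exact hγ hE
      · rw [MvPolynomial.eval_monomial, one_mul, sub_self]; exact zero_mem _
    · refine ⟨0, MvPolynomial.isHomogeneous_zero _ _ _, by simp, ?_⟩
      simp only [map_zero, sub_zero]
      exact Ideal.subset_span ⟨β, ⟨hE, by omega⟩, rfl⟩
  · exact ⟨0, MvPolynomial.isHomogeneous_zero _ _ _, by simp, by simp⟩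
  · rintro a b _ _ ⟨p, hp, hpE, hpe⟩ ⟨q, hq, hqE, hqe⟩
    refine ⟨p + q, hp.add hq, fun β h => by rw [MvPolynomial.coeff_add, hpE β h, hqE β h, add_zero], ?_⟩
    rw [map_add, add_sub_add_comm]
    exact add_mem hpe hqe
  · rintro c a _ ⟨p, hp, hpE, hpe⟩
    refine ⟨MvPolynomial.C c * p, by simpa using hp.C_mul c, fun β h => by
      rw [MvPolynomial.coeff_C_mul, hpE β h, mul_zero], ?_⟩
    rw [map_mul, MvPolynomial.eval_C, smul_eq_mul, ← mul_sub]
    exact Ideal.mul_mem_left _ _ hpe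

theorem Q5 {R ι : Type*} [CommRing R] {x : ι → R} (hx : QR x) (E : Set (ι →₀ ℕ))
    (hE : ∀ β ∈ E, ∀ γ, β + γ ∈ E) {n : ℕ} {p : MvPolynomial ι R} (hp : p.IsHomogeneous n)
    (h : MvPolynomial.eval x p ∈ mi x E 0 ⊔ sp x ^ (n + 1)) : ∀ β, β ∉ E → p.coeff β ∈ sp x := by
  classical
  have key : ∀ i ≤ n, MvPolynomial.eval x p ∈ mi x E i ⊔ sp x ^ (n + 1) := by
    intro i
    induction i with
    | zero => intro _; exact h
    | succ i ih =>
      intro hi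
      obtain ⟨a, ha, r, hr, har⟩ := Submodule.mem_sup.1 (ih (by omega))
      obtain ⟨q, hq, hqE, hqe⟩ := mi_split x E i ha
      have h1 : MvPolynomial.eval x q ∈ sp x ^ (i + 1) := by
        have e1 : MvPolynomial.eval x q = MvPolynomial.eval x p - r - (a - MvPolynomial.eval x q) := by
          rw [← har]; ring
        rw [e1]
        refine sub_mem (sub_mem ?_ ?_) (mi_le_pow x E _ hqe)
        · exact Ideal.pow_le_pow_right hi (eval_mem_pow x hp)
        · exact Ideal.pow_le_pow_right (by omega) hr
      have h2 := hx i q hq h1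
      have h3 : MvPolynomial.eval x q ∈ mi x E (i + 1) := by
        rw [MvPolynomial.eval_eq]
        refine Ideal.sum_mem _ fun m hm => ?_
        have hmE : m ∈ E := by
          by_contra hne; exact MvPolynomial.mem_support_iff.1 hm (hqE m hne)
        have hmd : m.degree = i := by
          by_contra hne
          exact MvPolynomial.mem_support_iff.1 hm (hq.coeff_eq_zero hne)
        have h4 : sp x ≤ Submodule.comap (LinearMap.mulRight R (xm x m)) (mi x E (i + 1)) := by
          rw [sp, Ideal.span_le]
          rintro _ ⟨j, rfl⟩
          change x j * xm x m ∈ mi x E (i + 1)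
          refine Ideal.subset_span ⟨m + Finsupp.single j 1, ⟨hE m hmE _, ?_⟩, ?_⟩
          · simp [hmd]
          · rw [xm_add, xm_single, pow_one, mul_comm]
        exact h4 (h2 m)
      refine Submodule.mem_sup.2 ⟨a, ?_, r, hr, har⟩
      have : a = (a - MvPolynomial.eval x q) + MvPolynomial.eval x q := by ring
      rw [this]; exact add_mem hqe h3
  intro β hβ
  obtain ⟨a, ha, r, hr, har⟩ := Submodule.mem_sup.1 (key n le_rfl)
  obtain ⟨q, hq, hqE, hqe⟩ := mi_split x E n ha
  have h1 : MvPolynomial.eval x (p - q) ∈ sp x ^ (n + 1) := by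
    have : MvPolynomial.eval x (p - q) = (a - MvPolynomial.eval x q) + r := by
      rw [map_sub, ← har]; ring
    rw [this]
    exact add_mem (mi_le_pow x E _ hqe) hr
  have h2 := hx n _ (hp.sub hq) h1 β
  rwa [MvPolynomial.coeff_sub, hqE β hβ, sub_zero] at h2

/-- McCoy type lemma -/
theorem mccoy {R ι : Type*} [CommRing R] [IsLocalRing R] [LinearOrder ι]
    {G p : MvPolynomial ι R} (hG : ∃ m, IsUnit (G.coeff m)) {K : Ideal R} {N : ℕ}
    (hK : maximalIdeal R ^ N ≤ K) (h : ∀ m, (G * p).coeff m ∈ K) : ∀ m, p.coeff m ∈ K := by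
  classical
  have key : ∀ j m, p.coeff m ∈ maximalIdeal R ^ j ⊔ K := by
    intro j
    induction j with
    | zero => intro m; simp
    | succ j ih =>
      by_contra hcon
      push Not at hcon
      let U := G.support.filter fun a => IsUnit (G.coeff a)
      let W := p.support.filter fun b => p.coeff b ∉ maximalIdeal R ^ (j + 1) ⊔ K
      have hU : U.Nonempty := by
        obtain ⟨m, hm⟩ := hG
        refine ⟨m, Finset.mem_filter.2 ⟨MvPolynomial.mem_support_iff.2 hm.ne_zero, hm⟩⟩
      have hW : W.Nonempty := by
        obtain ⟨m, hm⟩ := hcon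
        refine ⟨m, Finset.mem_filter.2 ⟨MvPolynomial.mem_support_iff.2 ?_, hm⟩⟩
        intro h0; rw [h0] at hm; exact hm (zero_mem _)
      obtain ⟨a0, ha0, ha0m⟩ := Finset.exists_max_image U (toLex : (ι →₀ ℕ) → Lex (ι →₀ ℕ)) hU
      obtain ⟨b0, hb0, hb0m⟩ := Finset.exists_max_image W (toLex : (ι →₀ ℕ) → Lex (ι →₀ ℕ)) hW
      have hb0' := (Finset.mem_filter.1 hb0).2
      have ha0' := (Finset.mem_filter.1 ha0).2
      apply hb0'
      have h1 : (G * p).coeff (a0 + b0) ∈ maximalIdeal R ^ (j + 1) ⊔ K := Ideal.mem_sup_right (h _)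
      rw [MvPolynomial.coeff_mul, ← Finset.add_sum_erase _ _
        (Finset.HasAntidiagonal.mem_antidiagonal.2 rfl : (a0, b0) ∈ Finset.HasAntidiagonal.antidiagonal (a0 + b0))] at h1
      have h2 : ∑ z ∈ (Finset.HasAntidiagonal.antidiagonal (a0 + b0)).erase (a0, b0), G.coeff z.1 * p.coeff z.2 ∈
          maximalIdeal R ^ (j + 1) ⊔ K := by
        refine Ideal.sum_mem _ ?_
        rintro ⟨a, b⟩ hab
        obtain ⟨hne, hab⟩ := Finset.mem_erase.1 hab
        rw [Finset.HasAntidiagonal.mem_antidiagonal] at hab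
        simp only at hab ⊢
        by_cases hau : IsUnit (G.coeff a)
        · have h3 := ha0m a (Finset.mem_filter.2 ⟨MvPolynomial.mem_support_iff.2 hau.ne_zero, hau⟩)
          have h4 : b ∉ W := by
            intro hb
            have h5 := hb0m b hb
            have h6 : toLex a + toLex b = toLex a0 + toLex b0 := by
              rw [← toLex_add, ← toLex_add, hab]
            have h7 : toLex a = toLex a0 := by
              apply le_antisymm h3
              by_contra hlt
              exact absurd h6 (ne_of_lt (add_lt_add_of_lt_of_le (not_le.1 hlt) h5))
            have h8 : a = a0 := toLex.injective h7
            subst h8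
            exact hne (by rw [add_left_cancel hab])
          have h5 : p.coeff b ∈ maximalIdeal R ^ (j + 1) ⊔ K := by
            by_contra hb
            refine h4 (Finset.mem_filter.2 ⟨MvPolynomial.mem_support_iff.2 ?_, hb⟩)
            intro h0; rw [h0] at hb; exact hb (zero_mem _)
          exact Ideal.mul_mem_left _ _ h5
        · have h3 : G.coeff a ∈ maximalIdeal R := (mem_maximalIdeal _).2 hau
          have h4 := Ideal.mul_mem_mul h3 (ih b)
          rw [Ideal.mul_sup, ← pow_succ'] at h4
          exact (sup_le_sup_left Ideal.mul_le_right _ :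
            maximalIdeal R ^ (j+1) ⊔ maximalIdeal R * K ≤ _) h4
      have h3 := (Submodule.add_mem_iff_left _ h2).1 h1
      exact (Ideal.unit_mul_mem_iff_mem _ ha0').1 h3
  intro m
  exact (sup_le hK le_rfl : maximalIdeal R ^ N ⊔ K ≤ K) (key N m)

/-- multiplication by a form with a unit coefficient is strict for the `J`-adic filtration -/
theorem q1 {R ι : Type*} [CommRing R] [IsLocalRing R] [LinearOrder ι] {x : ι → R} (hx : QR x)
    {N : ℕ} (hN : maximalIdeal R ^ N ≤ sp x) {G : MvPolynomial ι R} {e : ℕ} (hG : G.IsHomogeneous e)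
    (hGu : ∃ m, IsUnit (G.coeff m)) {s : ℕ} {a : R}
    (h : MvPolynomial.eval x G * a ∈ sp x ^ (s + e)) : a ∈ sp x ^ s := by
  have key : ∀ i ≤ s, a ∈ sp x ^ i := by
    intro i
    induction i with
    | zero => simp
    | succ i ih =>
      intro hi
      obtain ⟨p, hp, rfl⟩ := mem_form.1 (ih (by omega))
      have h1 : MvPolynomial.eval x (G * p) ∈ sp x ^ (e + i + 1) := by
        rw [map_mul]; exact Ideal.pow_le_pow_right (by omega) h
      have h2 := mccoy hGu hN (hx _ _ (hG.mul hp) h1)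
      rw [pow_succ']; exact eval_mem_mul x hp _ h2
  exact key s le_rfl

end NH

end

section
set_option synthInstance.maxHeartbeats 1000000
set_option maxHeartbeats 400000

open IsLocalRing Polynomial Finset


namespace NH

theorem Q5_split {R ι : Type*} [CommRing R] (x : ι → R) (E : Set (ι →₀ ℕ)) {n : ℕ}
    {p : MvPolynomial ι R} (hp : p.IsHomogeneous n) (h : ∀ β, β ∉ E → p.coeff β ∈ sp x) :
    MvPolynomial.eval x p ∈ mi x E 0 ⊔ sp x ^ (n + 1) := by
  rw [MvPolynomial.eval_eq]
  refine Ideal.sum_mem _ fun m hm => ?_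
  have hmd : m.degree = n := by
    by_contra hne
    exact MvPolynomial.mem_support_iff.1 hm (hp.coeff_eq_zero hne)
  by_cases hE : m ∈ E
  · exact Ideal.mem_sup_left (Ideal.mul_mem_left _ _ (Ideal.subset_span ⟨m, ⟨hE, Nat.zero_le _⟩, rfl⟩))
  · refine Ideal.mem_sup_right ?_
    rw [pow_succ']
    refine Ideal.mul_mem_mul (h m hE) ?_
    rw [← hmd]; exact prod_mem x m

theorem mi_single {R ι : Type*} [CommRing R] [DecidableEq ι] (x : ι → R) (i : ι) (r : ℕ) :
    mi x {β | r ≤ β i} 0 = Ideal.span {x i ^ r} := by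
  apply le_antisymm
  · rw [mi, Ideal.span_le]
    rintro _ ⟨β, ⟨h, _⟩, rfl⟩
    have : β = Finsupp.single i r + (β - Finsupp.single i r) := by
      rw [add_tsub_cancel_of_le]
      rwa [Finsupp.single_le_iff]
    rw [this, xm_add, xm_single]
    exact Ideal.mul_mem_right _ _ (Ideal.mem_span_singleton_self _)
  · rw [Ideal.span_singleton_le_iff_mem]
    refine Ideal.subset_span ⟨Finsupp.single i r, ⟨by simp, Nat.zero_le _⟩, xm_single _ _ _⟩

theorem q3 {R ι : Type*} [CommRing R] [DecidableEq ι] {x : ι → R} (hx : QR x) {i j : ι} (hij : i ≠ j)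
    (r l n : ℕ) {a : R} (h : x i ^ l * a ∈ Ideal.span {x j ^ r} ⊔ sp x ^ (n + l)) :
    a ∈ Ideal.span {x j ^ r} ⊔ sp x ^ n := by
  have key : ∀ s ≤ n, a ∈ Ideal.span {x j ^ r} ⊔ sp x ^ s := by
    intro s
    induction s with
    | zero => simp
    | succ s ih =>
      intro hs
      obtain ⟨b, hb, c, hc, hbc⟩ := Submodule.mem_sup.1 (ih (by omega))
      obtain ⟨p, hp, rfl⟩ := mem_form.1 hc
      have h1 : MvPolynomial.eval x (MvPolynomial.monomial (Finsupp.single i l) 1 * p) ∈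
          mi x {β | r ≤ β j} 0 ⊔ sp x ^ (l + s + 1) := by
        rw [map_mul, MvPolynomial.eval_monomial, one_mul, ← xm, xm_single, mi_single]
        have h2 : x i ^ l * MvPolynomial.eval x p = x i ^ l * a - x i ^ l * b := by rw [← hbc]; ring
        rw [h2]
        refine sub_mem ?_ (Ideal.mem_sup_left (Ideal.mul_mem_left _ _ hb))
        exact (sup_le_sup_left (Ideal.pow_le_pow_right (by omega)) _ :
          Ideal.span {x j ^ r} ⊔ sp x ^ (n + l) ≤ _) h
      have h2 := Q5 hx _ (by intro β hβ γ; simp only [Set.mem_setOf_eq, Finsupp.add_apply] at *; omega)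
        ((MvPolynomial.isHomogeneous_monomial (1:R) (by simp)).mul hp) h1
      have h3 := Q5_split x {β | r ≤ β j} hp (by
        intro β hβ
        have := h2 (Finsupp.single i l + β) (by
          simp only [Set.mem_setOf_eq, Finsupp.add_apply] at *
          rwa [Finsupp.single_eq_of_ne hij.symm, zero_add])
        rwa [MvPolynomial.coeff_monomial_mul, one_mul] at this)
      rw [mi_single] at h3
      rw [← hbc]
      exact add_mem (Ideal.mem_sup_left hb) h3
  exact key n le_rfl

/-- the key lemma for step 7 -/
theorem q4 {R ι : Type*} [CommRing R] [Fintype ι] [DecidableEq ι] {x : ι → R} (hx : QR x)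
    {s k : ℕ} {p : MvPolynomial ι R} (hp : p.IsHomogeneous s) (b c : ι →₀ ℕ)
    (hbc : ∀ i, b i + c i + 1 = k)
    (h : xm x c * MvPolynomial.eval x p ∈ Ideal.span (Set.range fun i => x i ^ k)) :
    p.coeff b ∈ sp x := by
  have h1 : MvPolynomial.eval x (MvPolynomial.monomial c 1 * p) ∈
      mi x {β | ∃ i, k ≤ β i} 0 ⊔ sp x ^ (c.degree + s + 1) := by
    rw [map_mul, MvPolynomial.eval_monomial, one_mul]
    refine Ideal.mem_sup_left ((Ideal.span_le.2 ?_ : Ideal.span (Set.range fun i => x i ^ k) ≤ _) h)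
    rintro _ ⟨i, rfl⟩
    exact Ideal.subset_span ⟨Finsupp.single i k, ⟨⟨i, by simp⟩, Nat.zero_le _⟩, xm_single _ _ _⟩
  have h2 := Q5 hx _ (by
      rintro β ⟨i, hi⟩ γ; exact ⟨i, by simp only [Finsupp.add_apply]; omega⟩)
        ((MvPolynomial.isHomogeneous_monomial (1:R) rfl).mul hp) h1 (c + b) (by
        rintro ⟨i, hi⟩
        have := hbc i
        simp only [Finsupp.add_apply] at hi
        omega)
  rwa [MvPolynomial.coeff_monomial_mul, one_mul] at h2

theorem rl_pi {R M σ : Type*} [CommRing R] [AddCommGroup M] [Module R M] [Fintype σ]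
    (K L : Submodule R M) :
    rl (Submodule.pi Set.univ fun _ : σ => K) (Submodule.pi Set.univ fun _ : σ => L) =
      Fintype.card σ * rl K L := by
  unfold rl
  let f : (Submodule.pi Set.univ fun _ : σ => L) →ₗ[R] (σ → L ⧸ K.comap L.subtype) :=
    LinearMap.pi fun i => (Submodule.mkQ _).comp
      ((LinearMap.proj i ∘ₗ Submodule.subtype _).codRestrict L (fun c => c.2 i trivial))
  have hf : Function.Surjective f := by
    intro y
    choose z hz using fun i => Submodule.mkQ_surjective (K.comap L.subtype) (y i)
    exact ⟨⟨fun i => z i, fun i _ => (z i).2⟩, funext fun i => hz i⟩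
  have hk : LinearMap.ker f = (Submodule.pi Set.univ fun _ : σ => K).comap
      (Submodule.pi Set.univ fun _ : σ => L).subtype := by
    ext z
    simp only [LinearMap.mem_ker, Submodule.mem_comap, Submodule.mem_pi, Set.mem_univ, true_implies]
    rw [funext_iff]
    refine forall_congr' fun i => ?_
    exact Submodule.Quotient.mk_eq_zero _
  rw [← hk, (f.quotKerEquivOfSurjective hf).length_eq, Module.length_pi]
  simp

/-- number of monomials of degree n in d variables -/
def cb (d n : ℕ) : ℕ := (d + n - 1).choose n

theorem rl_mul_pow_le {R : Type*} [CommRing R] {d : ℕ} (x : Fin d → R) (n : ℕ) (K L : Ideal R) :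
    rl (K * sp x ^ n) (L * sp x ^ n) ≤ cb d n * rl K L := by
  classical
  let M := (Finset.univ : Finset (Fin d)).finsuppAntidiag n
  have hcard : Fintype.card M = cb d n := by
    rw [Fintype.card_coe, Finset.card_finsuppAntidiag_nat_eq_choose, cb, Finset.card_univ, Fintype.card_fin]
  rw [← hcard, ← rl_pi]
  let φ : (M → R) →ₗ[R] R := ∑ m : M, (LinearMap.mulRight R (xm x m.1)).comp (LinearMap.proj m)
  have hφ : ∀ a, φ a = ∑ m : M, a m * xm x m.1 := by intro a; simp [φ]
  have hM : ∀ m : M, xm x m.1 ∈ sp x ^ n := by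
    intro m
    have h1 : (m.1).degree = n := by
      rw [Finsupp.degree_eq_sum]; exact (Finset.mem_finsuppAntidiag.1 m.2).1
    have := prod_mem x m.1
    rwa [h1] at this
  have hmem : ∀ (K : Ideal R) (a : M → R), (∀ m, a m ∈ K) → φ a ∈ K * sp x ^ n := by
    intro K a ha
    rw [hφ]
    exact Ideal.sum_mem _ fun m _ => Ideal.mul_mem_mul (ha m) (hM m)
  refine rl_le_of_surj φ ?_ ?_ ?_
  · intro a _ ha; exact hmem K a (fun m => ha m trivial)
  · intro a ha; exact hmem L a (fun m => ha m trivial)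
  · intro y hy
    suffices h : ∃ a : M → R, (∀ m, a m ∈ L) ∧ φ a = y by
      obtain ⟨a, ha, rfl⟩ := h
      exact ⟨a, fun m _ => ha m, by simp⟩
    refine Submodule.mul_induction_on hy ?_ ?_
    · intro l hl z hz
      obtain ⟨p, hp, rfl⟩ := mem_form.1 hz
      refine ⟨fun m => l * p.coeff m.1, fun m => Ideal.mul_mem_right _ _ hl, ?_⟩
      rw [hφ, MvPolynomial.eval_eq, Finset.mul_sum]
      simp only [mul_assoc]
      rw [Finset.sum_coe_sort M (fun m => l * (p.coeff m * xm x m))]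
      symm
      refine Finset.sum_subset ?_ ?_
      · intro m hm
        refine Finset.mem_finsuppAntidiag.2 ⟨?_, Finset.subset_univ _⟩
        rw [← Finsupp.degree_eq_sum]
        by_contra hne
        exact MvPolynomial.mem_support_iff.1 hm (hp.coeff_eq_zero hne)
      · intro m _ hm
        rw [MvPolynomial.notMem_support_iff.1 hm]; ring
    · rintro a b ⟨u, hu, rfl⟩ ⟨v, hv, rfl⟩
      exact ⟨u + v, fun m => add_mem (hu m) (hv m), map_add _ _ _⟩

theorem le_rl_mul_pow {R : Type*} [CommRing R] {d : ℕ} {x : Fin d → R} (hx : QR x) (n : ℕ) (K L : Ideal R)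
    (hKL : sp x ≤ K ∨ (K ≤ sp x ∧ L ⊓ sp x ≤ K)) :
    cb d n * rl K L ≤ rl (K * sp x ^ n) (L * sp x ^ n) := by
  classical
  let M := (Finset.univ : Finset (Fin d)).finsuppAntidiag n
  have hcard : Fintype.card M = cb d n := by
    rw [Fintype.card_coe, Finset.card_finsuppAntidiag_nat_eq_choose, cb, Finset.card_univ, Fintype.card_fin]
  rw [← hcard, ← rl_pi]
  let φ : (M → R) →ₗ[R] R := ∑ m : M, (LinearMap.mulRight R (xm x m.1)).comp (LinearMap.proj m)
  have hφ : ∀ a, φ a = ∑ m : M, a m * xm x m.1 := by intro a; simp [φ]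
  have hd : ∀ m : M, (m.1).degree = n := by
    intro m
    rw [Finsupp.degree_eq_sum]; exact (Finset.mem_finsuppAntidiag.1 m.2).1
  have hM : ∀ m : M, xm x m.1 ∈ sp x ^ n := by
    intro m
    have := prod_mem x m.1
    rwa [hd] at this
  have hmem : ∀ (K : Ideal R) (a : M → R), (∀ m, a m ∈ K) → φ a ∈ K * sp x ^ n := by
    intro K a ha
    rw [hφ]
    exact Ideal.sum_mem _ fun m _ => Ideal.mul_mem_mul (ha m) (hM m)
  let P : (M → R) → MvPolynomial (Fin d) R := fun a => ∑ m : M, MvPolynomial.monomial m.1 (a m)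
  have hP : ∀ a, (P a).IsHomogeneous n := fun a =>
    MvPolynomial.IsHomogeneous.sum _ _ _ fun m _ => MvPolynomial.isHomogeneous_monomial _ (hd m)
  have hPe : ∀ a, MvPolynomial.eval x (P a) = φ a := by
    intro a
    rw [hφ, map_sum]
    exact Finset.sum_congr rfl fun m _ => by rw [MvPolynomial.eval_monomial]
  have hPc : ∀ a (m : M), (P a).coeff m.1 = a m := by
    intro a m
    simp only [P, MvPolynomial.coeff_sum, MvPolynomial.coeff_monomial]
    rw [Finset.sum_eq_single m]
    · simp
    · intro b _ hb
      rw [if_neg]; intro h; exact hb (Subtype.ext h)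
    · simp
  refine rl_le_of_inj φ (fun a ha => hmem L a (fun m => ha m trivial)) ?_
  intro a ha hφa m _
  rcases hKL with h | ⟨h1, h2⟩
  · rw [← hPc a m]
    have hle : K * sp x ^ n ≤ K := Ideal.mul_le_left
    -- write as a form with coefficients in K
    have hex : ∃ p : MvPolynomial (Fin d) R, p.IsHomogeneous n ∧ (∀ m, p.coeff m ∈ K) ∧
        MvPolynomial.eval x p = φ a := by
      refine Submodule.mul_induction_on hφa ?_ ?_
      · intro l hl z hz
        obtain ⟨p, hp, rfl⟩ := mem_form.1 hz
        refine ⟨MvPolynomial.C l * p, by simpa using hp.C_mul l, fun m => ?_, by simp⟩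
        rw [MvPolynomial.coeff_C_mul]; exact Ideal.mul_mem_right _ _ hl
      · rintro a b ⟨u, hu, hu1, rfl⟩ ⟨v, hv, hv1, rfl⟩
        exact ⟨u + v, hu.add hv, fun m => by
          rw [MvPolynomial.coeff_add]; exact add_mem (hu1 m) (hv1 m), map_add _ _ _⟩
    obtain ⟨p, hp, hpK, hpe⟩ := hex
    have h3 := hx n (P a - p) ((hP a).sub hp) (by rw [map_sub, hPe, hpe, sub_self]; exact zero_mem _) m.1
    rw [MvPolynomial.coeff_sub] at h3
    have := add_mem (h h3) (hpK m.1)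
    rwa [sub_add_cancel] at this
  · refine h2 ⟨ha m trivial, ?_⟩
    rw [← hPc a m]
    refine hx n (P a) (hP a) ?_ _
    rw [hPe, pow_succ']
    exact Ideal.mul_mono_left h1 hφa

theorem rl_pow {R : Type*} [CommRing R] {d : ℕ} {x : Fin d → R} (hx : QR x) (n : ℕ) :
    rl (sp x ^ (n + 1)) (sp x ^ n) = cb d n * rl (sp x) ⊤ := by
  have h1 := rl_mul_pow_le x n (sp x) ⊤
  have h2 := le_rl_mul_pow hx n (sp x) ⊤ (Or.inl le_rfl)
  rw [Ideal.top_mul, ← pow_succ'] at h1 h2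
  exact le_antisymm h1 h2

theorem sum_cb (d n : ℕ) : ∑ i ∈ Finset.range n, cb (d + 1) i = (n + d).choose (d + 1) := by
  induction n with
  | zero => simp
  | succ n ih =>
    rw [Finset.sum_range_succ, ih, cb, show d + 1 + n - 1 = n + d by omega,
      show n + 1 + d = (n + d) + 1 by omega, Nat.choose_succ_succ, ← Nat.choose_symm_add, add_comm]

theorem rl_pow_top {R : Type*} [CommRing R] {d : ℕ} {x : Fin (d + 1) → R} (hx : QR x) (n : ℕ) :
    rl (sp x ^ n) ⊤ = ((n + d).choose (d + 1) : ℕ) * rl (sp x) ⊤ := by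
  rw [← sum_cb]
  induction n with
  | zero => simp [rl_eq_zero]
  | succ n ih =>
    rw [rl_add (Ideal.pow_le_pow_right (Nat.le_succ n)) le_top, ih, rl_pow hx, Finset.sum_range_succ]
    push_cast
    ring

end NH

end

section
set_option synthInstance.maxHeartbeats 1000000
set_option maxHeartbeats 400000

open IsLocalRing Polynomial Finset


namespace NH

/-- the normal filtration -/
def NF {R ι : Type*} [CommRing R] (x : ι → R) (n : ℕ) : Ideal R := intCl (sp x ^ n)

section
variable {R ι : Type*} [CommRing R] [IsNoetherianRing R] {x : ι → R}

theorem mem_NF {n : ℕ} {a : R} : a ∈ NF x n ↔ AC (sp x ^ n) a := mem_intCl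

theorem NF_mul {n m : ℕ} {a b : R} (ha : a ∈ NF x n) (hb : b ∈ NF x m) : a * b ∈ NF x (n + m) := by
  rw [mem_NF] at *
  rw [pow_add]; exact ha.mul hb

theorem pow_le_NF (n : ℕ) : sp x ^ n ≤ NF x n := fun _ h => mem_NF.2 (AC.of_mem h)

theorem NF_anti {n m : ℕ} (h : n ≤ m) : NF x m ≤ NF x n := fun a ha =>
  mem_NF.2 ((mem_NF.1 ha).mono (Ideal.pow_le_pow_right h))

theorem NF_zero : NF x 0 = ⊤ := by
  rw [eq_top_iff]
  intro a _
  exact pow_le_NF 0 (by simp)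

theorem NF_pow {n : ℕ} {a : R} (ha : a ∈ NF x n) (k : ℕ) : a ^ k ∈ NF x (n * k) := by
  rw [mem_NF] at *
  rw [pow_mul]; exact ha.pow k

theorem NF_of_pow {n k : ℕ} (hk : 0 < k) {a : R} (ha : a ^ k ∈ NF x (n * k)) : a ∈ NF x n := by
  rw [mem_NF] at *
  rw [pow_mul] at ha; exact ha.of_pow hk

theorem NF_mul_le (n m : ℕ) : NF x n * NF x m ≤ NF x (n + m) :=
  Ideal.mul_le.2 fun _ ha _ hb => NF_mul ha hb

theorem pow_mul_NF_le (n m : ℕ) : sp x ^ n * NF x m ≤ NF x (n + m) :=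
  (Ideal.mul_mono_left (pow_le_NF n)).trans (NF_mul_le n m)

end

theorem unit_coeff_iff {R ι : Type*} [CommRing R] [IsLocalRing R] (G : MvPolynomial ι R) :
    (∃ m, IsUnit (G.coeff m)) ↔ MvPolynomial.map (residue R) G ≠ 0 := by
  rw [Ne, MvPolynomial.ext_iff, not_forall]
  refine exists_congr fun m => ?_
  rw [MvPolynomial.coeff_map, MvPolynomial.coeff_zero, residue_eq_zero_iff, mem_maximalIdeal,
    mem_nonunits_iff, not_not]

section
variable {R ι : Type*} [CommRing R] [IsNoetherianRing R] [IsLocalRing R] {x : ι → R} [LinearOrder ι]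

/-- forms with a unit coefficient are strict for the normal filtration -/
theorem NF_cancel (hx : QR x) {N : ℕ} (hN : maximalIdeal R ^ N ≤ sp x) {G : MvPolynomial ι R} {D : ℕ}
    (hG : G.IsHomogeneous D) (hGu : ∃ m, IsUnit (G.coeff m)) {n : ℕ} {a : R}
    (h : MvPolynomial.eval x G * a ∈ NF x (n + D)) : a ∈ NF x n := by
  rcases Nat.eq_zero_or_pos n with rfl | hn
  · rw [NF_zero]; trivial
  rw [mem_NF] at *
  obtain ⟨r, hr⟩ := h
  refine ⟨r + D * r, fun N' => ?_⟩
  have h1 := hr (N' + D * r)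
  rw [mul_pow, ← map_pow, ← pow_mul] at h1
  have h2 : ∃ m, IsUnit ((G ^ (N' + D * r + r)).coeff m) := by
    rw [unit_coeff_iff, map_pow]
    exact pow_ne_zero _ ((unit_coeff_iff G).1 hGu)
  obtain ⟨n, rfl⟩ := Nat.exists_eq_add_of_lt hn
  have h3 := q1 hx hN (hG.pow _) h2 (s := (0 + n + 1) * N' + n * (D * r)) (a := a ^ (N' + D * r + r)) (by
    convert h1 using 2; ring)
  rw [← pow_mul, show N' + (r + D * r) = N' + D * r + r by ring]
  exact Ideal.pow_le_pow_right (Nat.le_add_right _ _) h3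

theorem NF_cancel_x (hx : QR x) {N : ℕ} (hN : maximalIdeal R ^ N ≤ sp x) (i : ι) (k : ℕ) {n : ℕ} {a : R}
    (h : x i ^ k * a ∈ NF x (n + k)) : a ∈ NF x n := by
  refine NF_cancel hx hN (D := k) (G := MvPolynomial.monomial (Finsupp.single i k) 1)
    (MvPolynomial.isHomogeneous_monomial _ (by simp)) ⟨Finsupp.single i k, by simp⟩ ?_
  rwa [MvPolynomial.eval_monomial, one_mul, ← xm, xm_single]

theorem pow_inf_NF (hx : QR x) {N : ℕ} (hN : maximalIdeal R ^ N ≤ sp x) (h1 : NF x 1 ≠ ⊤) (n : ℕ) :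
    sp x ^ n ⊓ NF x (n + 1) ≤ maximalIdeal R * sp x ^ n := by
  rintro f ⟨hf, hf'⟩
  obtain ⟨p, hp, rfl⟩ := mem_form.1 hf
  refine eval_mem_mul x hp _ fun m => ?_
  by_contra hm
  apply h1
  rw [Ideal.eq_top_iff_one]
  refine NF_cancel hx hN hp ⟨m, by simpa using hm⟩ ?_
  rw [mul_one, add_comm]; exact hf'

end

section
variable {R : Type*} [CommRing R] [IsNoetherianRing R] [IsLocalRing R] {d : ℕ} {x : Fin (d + 1) → R}

theorem low_bd (hx : QR x) {N : ℕ} (hN : maximalIdeal R ^ N ≤ sp x)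
    (hF1 : NF x 1 = maximalIdeal R) (n : ℕ) :
    rl (NF x (n + 2)) ⊤ + cb (d + 1) n * rl (maximalIdeal R * sp x) (NF x 2) +
      cb (d + 1) (n + 1) * rl (sp x) (maximalIdeal R) ≤ ((n + 2 + d).choose (d + 1) : ℕ) * rl (sp x) ⊤ := by
  set m := maximalIdeal R
  have hJm : sp x ≤ m := by rw [← hF1]; simpa using pow_le_NF (x := x) 1
  have hne : NF x 1 ≠ ⊤ := by rw [hF1]; exact (maximalIdeal.isMaximal R).ne_top
  have hF2 : NF x 2 * sp x ^ n ≤ NF x (n + 2) := by rw [mul_comm]; exact pow_mul_NF_le n 2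
  have hF1' : m * sp x ^ (n + 1) ≤ NF x (n + 2) := by
    rw [mul_comm, ← hF1]; exact pow_mul_NF_le (n + 1) 1
  rw [← rl_pow_top hx]
  have e1 : rl (sp x ^ (n + 2)) ⊤ = rl (sp x ^ (n + 2)) (m * sp x ^ (n + 1)) +
      (rl (m * sp x ^ (n + 1)) (NF x (n + 2)) + rl (NF x (n + 2)) ⊤) := by
    rw [← rl_add hF1' le_top, ← rl_add _ le_top]
    rw [pow_succ' _ (n+1)]; exact Ideal.mul_mono_left hJm
  have e2 : cb (d + 1) (n + 1) * rl (sp x) m ≤ rl (sp x ^ (n + 2)) (m * sp x ^ (n + 1)) := by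
    have := le_rl_mul_pow hx (n + 1) (sp x) m (Or.inl le_rfl)
    rwa [← pow_succ'] at this
  have e3 : cb (d + 1) n * rl (m * sp x) (NF x 2) ≤ rl (m * sp x ^ (n + 1)) (NF x (n + 2)) := by
    have := le_rl_mul_pow hx n (m * sp x) (NF x 2) (Or.inr ⟨Ideal.mul_le_right, by
      rw [inf_comm]; simpa using pow_inf_NF hx hN hne 1⟩)
    rw [mul_assoc, ← pow_succ'] at this
    exact this.trans (rl_mono _ hF2)
  rw [e1, add_comm (rl (m * sp x ^ (n + 1)) (NF x (n + 2))), add_comm _ (_ + _)]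
  gcongr

theorem up_bd (hx : QR x) {N : ℕ} (hN : maximalIdeal R ^ N ≤ sp x)
    (hF1 : NF x 1 = maximalIdeal R) (n : ℕ) (h2 : NF x (n + 3) ≤ sp x ^ (n + 1)) :
    ((n + 2 + d).choose (d + 1) : ℕ) * rl (sp x) ⊤ ≤
    rl (NF x (n + 2)) ⊤ + cb (d + 1) n * rl (sp x) ((sp x).colon (maximalIdeal R)) +
      cb (d + 1) (n + 1) * rl (sp x) (maximalIdeal R) := by
  set m := maximalIdeal R
  have hJm : sp x ≤ m := by rw [← hF1]; simpa using pow_le_NF (x := x) 1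
  have hne : NF x 1 ≠ ⊤ := by rw [hF1]; exact (maximalIdeal.isMaximal R).ne_top
  rw [← rl_pow_top hx]
  have e1 : rl (sp x ^ (n + 2)) ⊤ = rl (sp x ^ (n + 2)) (sp x ^ (n + 1) ⊓ NF x (n + 2)) +
      (rl (sp x ^ (n + 1) ⊓ NF x (n + 2)) (NF x (n + 2)) + rl (NF x (n + 2)) ⊤) := by
    rw [← rl_add inf_le_right le_top, ← rl_add _ le_top]
    exact le_inf (Ideal.pow_le_pow_right (by omega)) (pow_le_NF _)
  have e2 : rl (sp x ^ (n + 2)) (sp x ^ (n + 1) ⊓ NF x (n + 2)) ≤ cb (d + 1) (n + 1) * rl (sp x) m := by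
    refine (rl_mono _ (pow_inf_NF hx hN hne (n + 1))).trans ?_
    have := rl_mul_pow_le x (n + 1) (sp x) m
    rwa [← pow_succ'] at this
  have e3 : rl (sp x ^ (n + 1) ⊓ NF x (n + 2)) (NF x (n + 2)) ≤
      cb (d + 1) n * rl (sp x) ((sp x).colon m) := by
    rw [rl_inf]
    have h3 : NF x (n + 2) ≤ (sp x).colon m * sp x ^ n := by
      intro a ha
      have hma : ∀ r ∈ m, a * r ∈ sp x ^ (n + 1) := by
        intro r hr
        rw [← hF1] at hr
        have h5 : a * r ∈ NF x (n + 2 + 1) := NF_mul ha hr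
        rw [add_assoc] at h5
        exact h2 h5
      have haJ : a ∈ sp x ^ n := by
        refine q1 hx hN (G := MvPolynomial.X 0) (MvPolynomial.isHomogeneous_X _ _)
          ⟨Finsupp.single 0 1, by simp⟩ ?_
        rw [MvPolynomial.eval_X, mul_comm]
        exact hma _ (hJm (Ideal.subset_span ⟨0, rfl⟩))
      obtain ⟨p, hp, rfl⟩ := mem_form.1 haJ
      refine eval_mem_mul x hp _ fun k => ?_
      rw [Submodule.mem_colon]
      intro r hr
      have := hx n (MvPolynomial.C r * p) (by simpa using hp.C_mul r) (by
        rw [map_mul, MvPolynomial.eval_C, mul_comm]; exact hma r hr) k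
      rw [MvPolynomial.coeff_C_mul] at this
      rwa [smul_eq_mul, mul_comm]
    refine (rl_mono _ h3).trans ?_
    have := rl_mul_pow_le x n (sp x) ((sp x).colon m)
    rwa [← pow_succ'] at this
  rw [e1, add_comm (rl (sp x ^ (n + 1) ⊓ NF x (n + 2)) (NF x (n + 2))), add_comm _ (_ + _)]
  gcongr

end

/-- comparison of binomials -/
theorem cmp_choose (A B : ℤ) (k N : ℕ) (h : ∀ n ≥ N, A * ((n + (k + 1)).choose (k + 1) : ℕ) ≤
    B * ((n + k).choose k : ℕ)) : A ≤ 0 := by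
  by_contra hA
  push Not at hA
  have h1 := h (N + (B * (k + 1)).toNat) (by omega)
  set n := N + (B * (k + 1)).toNat with hn
  have h2 := Nat.add_one_mul_choose_eq (n + k) k
  have h3 : (0 : ℤ) < ((n + k).choose k : ℕ) := by
    exact_mod_cast Nat.choose_pos (by omega)
  have h2' : ((n + k + 1 : ℕ) : ℤ) * ((n + k).choose k : ℕ) =
    ((n + (k + 1)).choose (k + 1) : ℕ) * ((k + 1 : ℕ) : ℤ) := by exact_mod_cast h2
  have h4 : A * (((n + k + 1 : ℕ) : ℤ) * ((n + k).choose k : ℕ)) ≤ B * (k + 1) * ((n + k).choose k : ℕ) := by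
    rw [h2']
    push_cast at h1 ⊢
    nlinarith
  have h5 : A * ((n + k + 1 : ℕ) : ℤ) ≤ B * (k + 1) := by
    rw [← mul_assoc] at h4
    exact le_of_mul_le_mul_right h4 h3
  have h6 : B * (k + 1) ≤ n := by rw [hn]; push_cast; have := Int.self_le_toNat (B * (k + 1)); omega
  push_cast at h5
  nlinarith

theorem choose_diag_mono {n j k : ℕ} (h : j ≤ k) : (n + j).choose j ≤ (n + k).choose k := by
  induction k, h using Nat.le_induction with
  | base => rfl
  | succ k _ ih =>
    refine ih.trans ?_
    rw [← add_assoc, Nat.choose_succ_succ]; omega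

end NH

end

section
set_option synthInstance.maxHeartbeats 1000000
set_option maxHeartbeats 400000

open IsLocalRing Polynomial Finset


namespace NH

/-- numerical conclusion -/
theorem numeric (d : ℕ) (L : ℕ → ℕ) (e : ℕ → ℤ) (N : ℕ) (hL : ∀ n ≥ N, (L n : ℤ) =
      ∑ i ∈ Finset.range (d + 2 + 1), (-1 : ℤ) ^ i * e i * ((n + (d + 2) - i).choose (d + 2 - i)))
    (e0 ℓ t : ℕ)
    (hlow : ∀ n, L (n + 1) + cb (d + 2) n * ℓ + cb (d + 2) (n + 1) * (e0 - 1) ≤ (n + 2 + (d + 1)).choose (d + 2) * e0)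
    (hup : ∀ n, (n + 2 + (d + 1)).choose (d + 2) * e0 ≤ L (n + 1) + cb (d + 2) n * t + cb (d + 2) (n + 1) * (e0 - 1))
    (he0 : 1 ≤ e0) :
    e 0 - 1 + ℓ ≤ e 1 ∧ e 1 ≤ e 0 - 1 + t := by
  set B : ℤ := ∑ i ∈ Finset.range (d + 1), |e (i + 2)| with hB
  have hBnn : 0 ≤ B := Finset.sum_nonneg fun i _ => abs_nonneg _
  have key : ∀ n ≥ N + 1, ∃ ρ : ℤ, |ρ| ≤ B * ((n + d).choose d : ℕ) ∧
      (L n : ℤ) = e 0 * ((n + (d + 2)).choose (d + 2) : ℕ) - e 1 * ((n + (d + 1)).choose (d + 1) : ℕ) + ρ := by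
    intro n hn
    refine ⟨∑ i ∈ Finset.range (d + 1), (-1 : ℤ) ^ (i + 2) * e (i + 2) *
      ((n + (d + 2) - (i + 2)).choose (d + 2 - (i + 2)) : ℕ), ?_, ?_⟩
    · refine (Finset.abs_sum_le_sum_abs _ _).trans ?_
      rw [hB, Finset.sum_mul]
      refine Finset.sum_le_sum fun i hi => ?_
      rw [abs_mul, abs_mul, abs_pow, abs_neg, abs_one, one_pow, one_mul, Nat.abs_cast]
      refine mul_le_mul_of_nonneg_left ?_ (abs_nonneg _)
      have hi' := Finset.mem_range.1 hi
      have := choose_diag_mono (n := n) (j := d - i) (k := d) (by omega)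
      rw [show n + (d + 2) - (i + 2) = n + (d - i) by omega, show d + 2 - (i + 2) = d - i by omega]
      exact_mod_cast this
    · rw [hL n (by omega), Finset.sum_range_succ', Finset.sum_range_succ']
      simp only [pow_zero, one_mul, Nat.sub_zero, zero_add, pow_one]
      rw [show n + (d + 2) - 1 = n + (d + 1) by omega, show d + 2 - 1 = d + 1 by omega]
      ring
  have hc1 : ∀ n, cb (d + 2) (n + 1) = (n + 1 + (d + 1)).choose (d + 1) := by
    intro n
    rw [cb, show d + 2 + (n + 1) - 1 = n + 1 + (d + 1) by omega]
    exact Nat.choose_symm_add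
  have hc0 : ∀ n, (cb (d + 2) n : ℤ) = ((n + 1 + (d + 1)).choose (d + 1) : ℕ) - ((n + 1 + d).choose d : ℕ) := by
    intro n
    have h1 : cb (d + 2) n = (n + (d + 1)).choose (d + 1) := by
      rw [cb, show d + 2 + n - 1 = n + (d + 1) by omega]
      exact Nat.choose_symm_add
    rw [h1, show n + 1 + (d + 1) = (n + 1 + d) + 1 by omega, Nat.choose_succ_succ,
      show n + (d + 1) = n + 1 + d by omega]
    push_cast; ring
  -- inequalities over ℤ
  have low : ∀ n ≥ N + 1, ∃ ρ : ℤ, |ρ| ≤ B * ((n + d).choose d : ℕ) ∧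
      (e 0 - e0) * ((n + (d + 2)).choose (d + 2) : ℕ) + (ℓ + (e0 - 1) - e 1) * ((n + (d + 1)).choose (d + 1) : ℕ)
        + ρ - ℓ * ((n + d).choose d : ℕ) ≤ 0 := by
    intro n hn
    obtain ⟨n, rfl⟩ : ∃ m, n = m + 1 := ⟨n - 1, by omega⟩
    obtain ⟨ρ, hρ, hρe⟩ := key (n + 1) hn
    refine ⟨ρ, hρ, ?_⟩
    have h := hlow n
    zify [he0] at h
    rw [hρe, hc0, hc1, show n + 2 + (d + 1) = n + 1 + (d + 2) by omega] at h
    linarith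
  have up : ∀ n ≥ N + 1, ∃ ρ : ℤ, |ρ| ≤ B * ((n + d).choose d : ℕ) ∧
      0 ≤ (e 0 - e0) * ((n + (d + 2)).choose (d + 2) : ℕ) + (t + (e0 - 1) - e 1) * ((n + (d + 1)).choose (d + 1) : ℕ)
        + ρ - t * ((n + d).choose d : ℕ) := by
    intro n hn
    obtain ⟨n, rfl⟩ : ∃ m, n = m + 1 := ⟨n - 1, by omega⟩
    obtain ⟨ρ, hρ, hρe⟩ := key (n + 1) hn
    refine ⟨ρ, hρ, ?_⟩
    have h := hup n
    zify [he0] at h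
    rw [hρe, hc0, hc1, show n + 2 + (d + 1) = n + 1 + (d + 2) by omega] at h
    linarith
  have hmono : ∀ n, (((n + d).choose d : ℕ) : ℤ) ≤ ((n + (d + 1)).choose (d + 1) : ℕ) := fun n => by
    exact_mod_cast choose_diag_mono (Nat.le_succ d)
  have hE1 : e 0 - e0 ≤ 0 := by
    refine cmp_choose _ (|ℓ + (e0 - 1) - e 1| + B + ℓ) (d + 1) (N + 1) fun n hn => ?_
    obtain ⟨ρ, hρ, h⟩ := low n hn
    have h1 := hmono n
    have h2 := neg_abs_le ρ
    have h3 := neg_abs_le ((ℓ : ℤ) + (e0 - 1) - e 1)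
    have hb : (0 : ℤ) ≤ ((n + (d + 1)).choose (d + 1) : ℕ) := Nat.cast_nonneg _
    have h4 := mul_le_mul_of_nonneg_left h1 hBnn
    have h5 := mul_le_mul_of_nonneg_left h1 (Nat.cast_nonneg ℓ : (0:ℤ) ≤ ℓ)
    have h6 := mul_le_mul_of_nonneg_right h3 hb
    have e1 : d + 1 + 1 = d + 2 := rfl
    rw [e1]
    nlinarith
  have hE2 : e0 - e 0 ≤ 0 := by
    refine cmp_choose _ (|t + (e0 - 1) - e 1| + B + t) (d + 1) (N + 1) fun n hn => ?_
    obtain ⟨ρ, hρ, h⟩ := up n hn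
    have h1 := hmono n
    have h2 := le_abs_self ρ
    have h3 := le_abs_self ((t : ℤ) + (e0 - 1) - e 1)
    have hb : (0 : ℤ) ≤ ((n + (d + 1)).choose (d + 1) : ℕ) := Nat.cast_nonneg _
    have hc : (0 : ℤ) ≤ ((n + d).choose d : ℕ) := Nat.cast_nonneg _
    have h4 := mul_le_mul_of_nonneg_left h1 hBnn
    have h5 := mul_nonneg (Nat.cast_nonneg t : (0:ℤ) ≤ t) hc
    have h7 := mul_nonneg (Nat.cast_nonneg t : (0:ℤ) ≤ t) hb
    have h6 := mul_le_mul_of_nonneg_right h3 hb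
    have e1 : d + 1 + 1 = d + 2 := rfl
    rw [e1]
    nlinarith
  have hE : e 0 = e0 := by omega
  rw [hE] at low up ⊢
  simp only [sub_self, zero_mul, zero_add] at low up
  constructor
  · have : (ℓ : ℤ) + (e0 - 1) - e 1 ≤ 0 := by
      refine cmp_choose _ (B + ℓ) d (N + 1) fun n hn => ?_
      obtain ⟨ρ, hρ, h⟩ := low n hn
      have h2 := neg_abs_le ρ
      nlinarith
    omega
  · have : e 1 - (t + (e0 - 1)) ≤ 0 := by
      refine cmp_choose _ (B + t) d (N + 1) fun n hn => ?_
      obtain ⟨ρ, hρ, h⟩ := up n hn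
      have h2 := le_abs_self ρ
      have hc : (0 : ℤ) ≤ ((n + d).choose d : ℕ) := Nat.cast_nonneg _
      have h5 := mul_nonneg (Nat.cast_nonneg t : (0:ℤ) ≤ t) hc
      nlinarith
    omega

theorem red_intCl {R : Type*} [CommRing R] [IsNoetherianRing R] {I J : Ideal R} (hJI : J ≤ I) {N : ℕ}
    (hN : ∀ n ≥ N, I ^ (n + 1) = J * I ^ n) (n : ℕ) : intCl (I ^ n) = intCl (J ^ n) := by
  ext a
  rw [mem_intCl, mem_intCl]
  refine ⟨fun h => AC.trans ?_ h, fun h => h.mono (Ideal.pow_right_mono hJI n)⟩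
  intro y hy
  have h1 : ∀ M, I ^ (M + N) = J ^ M * I ^ N := by
    intro M
    induction M with
    | zero => simp
    | succ M ih => rw [show M + 1 + N = (M + N) + 1 by omega, hN _ (by omega), ih, pow_succ', mul_assoc]
  rcases Nat.eq_zero_or_pos n with rfl | hn
  · exact AC.of_mem (by simp)
  refine ⟨N, fun M => ?_⟩
  have h2 := Ideal.pow_mem_pow hy (M + N)
  rw [← pow_mul] at h2 ⊢
  have h3 : I ^ (n * (M + N)) ≤ J ^ (n * M) := by
    refine (Ideal.pow_le_pow_right (by nlinarith : n * M + N ≤ n * (M + N))).trans ?_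
    rw [h1]; exact Ideal.mul_le_left
  exact h3 h2

theorem rl_max_top {R : Type*} [CommRing R] [IsLocalRing R] : rl (maximalIdeal R) ⊤ = 1 := by
  rw [rl_top, Module.length_eq_one_iff]
  exact isSimpleModule_iff_isCoatom.2 (maximalIdeal.isMaximal R).out

/-- setup data extracted from the hypotheses -/
theorem setup {R : Type*} [CommRing R] [IsLocalRing R] [IsNoetherianRing R] {d : ℕ} (hd : 3 ≤ d)
    {I J : Ideal R} (hIm : intCl I = maximalIdeal R)
    (hJ : IsMinimalReduction d J I) : ∃ s : Fin d → R, J = sp s ∧ (∃ N, maximalIdeal R ^ N ≤ sp s) ∧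
      sp s ≤ maximalIdeal R ∧ NF s 1 = maximalIdeal R ∧ ∀ n, intCl (I ^ n) = NF s n := by
  obtain ⟨hJI, ⟨s, rfl⟩, N, hN⟩ := hJ
  have hF : ∀ n, intCl (I ^ n) = NF s n := red_intCl hJI hN
  have hF1 : NF s 1 = maximalIdeal R := by rw [← hF, pow_one, hIm]
  refine ⟨s, rfl, ?_, ?_, hF1, hF⟩
  · refine Ideal.exists_pow_le_of_le_radical_of_fg ?_ (IsNoetherian.noetherian _)
    intro y hy
    rw [← hF1, mem_NF] at hy
    obtain ⟨r, hr⟩ := hy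
    refine ⟨1 + r, by simpa using hr 1⟩
  · rw [← hF1]; simpa using pow_le_NF (x := s) 1

theorem assemble
    (R : Type*) [CommRing R] [IsLocalRing R] [IsNoetherianRing R]
    (d : ℕ) (hd : 3 ≤ d) (hdim : ringKrullDim R = d)
    (hCM : IsCMLocal R)
    (t : ℕ) (ht : CMTypeData R d t)
    (I J : Ideal R) (hIm : intCl I = maximalIdeal R)
    (hJ : IsMinimalReduction d J I)
    (L : ℕ → ℕ) (e : ℕ → ℤ) (hHilb : NormalHilbertData d I L e)
    (ℓ : ℕ)
    (hℓ : mlen R (idealQuot (intCl (I ^ 2)) (J * intCl I)) = (ℓ : WithBot ℕ∞))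
    (main : ∀ s : Fin d → R, QR s → (∃ N, maximalIdeal R ^ N ≤ sp s) →
      sp s ≤ maximalIdeal R → NF s 1 = maximalIdeal R → (∀ n, rl (NF s (n + 1)) ⊤ = L n) → ∀ n, NF s (n + 2) ≤ sp s ^ n) :
    e 0 - 1 + ℓ ≤ e 1 ∧ e 1 ≤ e 0 - 1 + t := by
  obtain ⟨s, rfl, ⟨N, hN⟩, hm, hF1, hF⟩ := setup hd hIm hJ
  obtain ⟨hQ, rs, hrl, hrr, hrs⟩ := cm_qr (by omega) hdim hCM s N hN hm
  obtain ⟨hL, N', hL'⟩ := hHilb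
  have hL2 : ∀ n, rl (NF s (n + 1)) ⊤ = L n := by
    intro n
    have := hL n
    rw [hF, mlen_eq, ← rl_top] at this
    exact_mod_cast this
  have hmain := main s hQ ⟨N, hN⟩ hm hF1 hL2
  have ht' : rl (sp s) ((sp s).colon (maximalIdeal R)) = t := by
    have h1 := ht rs hrl (by
      intro y hy
      apply hm; rw [hrs]; exact Ideal.subset_span hy) hrr
    rw [rl_eq_mlen] at h1
    have h2 : sp s = Ideal.span {x | x ∈ rs} := hrs
    rw [← h2] at h1
    exact_mod_cast h1
  have hℓ' : rl (maximalIdeal R * sp s) (NF s 2) = ℓ := by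
    rw [rl_eq_mlen, hF, hIm, mul_comm] at hℓ
    exact_mod_cast hℓ
  obtain ⟨e0, he0⟩ := ENat.ne_top_iff_exists.1 (rl_ne_top_of_pow_le hN ⊤)
  obtain ⟨em, hem⟩ := ENat.ne_top_iff_exists.1 (rl_ne_top_of_pow_le hN (maximalIdeal R))
  have hee : e0 = em + 1 := by
    have := rl_add (N := sp s) hm le_top
    rw [rl_max_top, ← he0, ← hem] at this
    exact_mod_cast this
  obtain ⟨d, rfl⟩ : ∃ d', d = d' + 2 := ⟨d - 2, by omega⟩
  refine numeric d L e N' hL' e0 ℓ t ?_ ?_ (by omega)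
  · intro n
    have := low_bd (d := d + 1) hQ hN hF1 n
    rw [hL2, hℓ', ← he0, ← hem] at this
    rw [hee, Nat.add_sub_cancel, ← hee]
    exact_mod_cast this
  · intro n
    have := up_bd (d := d + 1) hQ hN hF1 n (hmain (n + 1))
    rw [hL2, ht', ← he0, ← hem] at this
    rw [hee, Nat.add_sub_cancel, ← hee]
    exact_mod_cast this

end NH

end

section
set_option synthInstance.maxHeartbeats 1000000
set_option maxHeartbeats 400000

open IsLocalRing Polynomial Finset

namespace NH

theorem star_step {R ι : Type*} [CommRing R] [IsNoetherianRing R] [DecidableEq ι] {x : ι → R}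
    (hx : QR x) {c : ℕ} (hc : ∀ n, NF x (n + c) ≤ sp x ^ n) {i j : ι} (hij : i ≠ j) {k : ℕ} (hk : 0 < k)
    {a₁ a₂ b : R} (hb : b ∈ NF x (2 * k)) (h : x i ^ k * a₂ = x j ^ k * a₁ + b) (t : ℕ)
    (ht : a₁ ^ (t + 1) ∈ NF x (k * t)) : a₂ ^ (t + 2) ∈ NF x (k * (t + 1)) := by
  rw [mem_NF]
  refine ⟨1 + c, fun N' => ?_⟩
  rw [← pow_mul, ← pow_mul]
  set q := N' + (1 + c) with hq
  have h1 : x i ^ (k * ((t + 2) * q)) * a₂ ^ ((t + 2) * q) ∈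
      Ideal.span {x j ^ (k * ((t + 1) * q))} ⊔ sp x ^ (k * (t + 1) * N' + k * ((t + 2) * q)) := by
    rw [pow_mul (x i), ← mul_pow, h, add_pow]
    refine Ideal.sum_mem _ fun l hl => ?_
    have hl' : l ≤ (t + 2) * q := by simpa [Nat.lt_succ_iff] using hl
    refine Ideal.mul_mem_right _ _ ?_
    rw [mul_pow, ← pow_mul]
    rcases le_or_gt ((t + 1) * q) l with hlq | hlq
    · refine Ideal.mem_sup_left (Ideal.mul_mem_right _ _ (Ideal.mul_mem_right _ _ ?_))
      exact Ideal.mem_span_singleton.2 (pow_dvd_pow _ (Nat.mul_le_mul_left _ hlq))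
    · refine Ideal.mem_sup_right ?_
      have e1 : x j ^ (k * l) ∈ NF x (k * l) :=
        pow_le_NF _ (Ideal.pow_mem_pow (show x j ∈ sp x from Ideal.subset_span ⟨j, rfl⟩) _)
      have e2 : a₁ ^ l ∈ NF x (k * t * l / (t + 1)) := by
        refine NF_of_pow (Nat.succ_pos t) ?_
        rw [← pow_mul, mul_comm l, pow_mul]
        exact NF_anti (Nat.div_mul_le_self _ _) (NF_pow ht l)
      have e3 : b ^ ((t + 2) * q - l) ∈ NF x (2 * k * ((t + 2) * q - l)) := NF_pow hb _
      refine hc _ (NF_anti ?_ (NF_mul (NF_mul e1 e2) e3))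
      obtain ⟨w, hw⟩ := Nat.exists_eq_add_of_le hl'
      rw [hw, Nat.add_sub_cancel_left]
      have e4 : k * l ≤ k * t * l / (t + 1) + k * q + 1 := by
        have := Nat.div_add_mod (k * t * l) (t + 1)
        have h5 := Nat.mod_lt (k * t * l) (Nat.succ_pos t)
        set y := k * t * l / (t + 1)
        have h6 : k * l ≤ k * ((t + 1) * q) := Nat.mul_le_mul_left _ hlq.le
        have h7 : (t + 1) * (k * l) ≤ (t + 1) * (y + k * q + 1) := by nlinarith
        exact Nat.le_of_mul_le_mul_left h7 (Nat.succ_pos t)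
      have e5 : k * ((t + 2) * q) = k * (l + w) := by rw [hw]
      have e6 : (1 + c) ≤ k * (t + 1) * (1 + c) := Nat.le_mul_of_pos_left _ (by positivity)
      have e7 : k * (t + 1) * q = k * (t + 1) * N' + k * (t + 1) * (1 + c) := by rw [hq]; ring
      nlinarith
  have h2 := q3 hx hij _ _ _ h1
  refine (sup_le ?_ le_rfl : Ideal.span {x j ^ (k * ((t + 1) * q))} ⊔ sp x ^ (k * (t + 1) * N') ≤ _) h2
  rw [Ideal.span_singleton_le_iff_mem]
  have hxj : x j ∈ sp x := Ideal.subset_span ⟨j, rfl⟩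
  refine Ideal.pow_le_pow_right ?_ (Ideal.pow_mem_pow hxj _)
  rw [← mul_assoc]; exact Nat.mul_le_mul_left _ (by omega)

/-- vanishing of the Koszul-type cohomology -/
theorem star {R ι : Type*} [CommRing R] [IsLocalRing R] [IsNoetherianRing R] [DecidableEq ι] {x : ι → R}
    (hx : QR x) {c : ℕ} (hc : ∀ n, NF x (n + c) ≤ sp x ^ n) (hm : sp x ≤ maximalIdeal R)
    {i j : ι} (hij : i ≠ j) {k : ℕ} (hk : 0 < k)
    {a₁ a₂ b : R} (hb : b ∈ NF x (2 * k)) (h : x i ^ k * a₂ = x j ^ k * a₁ + b) :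
    a₁ ∈ NF x k ∧ a₂ ∈ NF x k := by
  have h' : x j ^ k * a₁ = x i ^ k * a₂ + (-b) := by rw [h]; ring
  have hb' : -b ∈ NF x (2 * k) := neg_mem hb
  have key : ∀ t, a₁ ^ (t + 1) ∈ NF x (k * t) ∧ a₂ ^ (t + 1) ∈ NF x (k * t) := by
    intro t
    induction t with
    | zero => simp [NF_zero]
    | succ t ih =>
      exact ⟨star_step hx hc hij.symm hk hb' h' t ih.2, star_step hx hc hij hk hb h t ih.1⟩
  have fin : ∀ a, (∀ t, a ^ (t + 1) ∈ NF x (k * t)) → a ∈ NF x k := by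
    intro a ha
    rw [mem_NF]
    refine AC.of_asymptotic fun N => ?_
    obtain ⟨r, hr⟩ := mem_NF.1 (ha (N + 1))
    refine ⟨(N + 1) * (N * (N + 2) * r + 1), (N + 1 + 1) * (N * (N + 2) * r + 1 + r), by positivity, ?_, ?_⟩
    · have := hr (N * (N + 2) * r + 1)
      rw [← pow_mul a, ← pow_mul (sp x)] at this
      rwa [← pow_mul (sp x), ← mul_assoc]
    · nlinarith
  exact ⟨fin _ fun t => (key t).1, fin _ fun t => (key t).2⟩

end NH

end

section
set_option synthInstance.maxHeartbeats 1000000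
set_option maxHeartbeats 400000

open IsLocalRing Polynomial Finset

namespace NH

theorem rl_mul_step {R : Type*} [CommRing R] (Q : Ideal R) (u : R) (k : ℕ) :
    rl (Q ⊔ Ideal.span {u ^ k}) ⊤ ≤ k * rl (Q ⊔ Ideal.span {u}) ⊤ := by
  induction k with
  | zero => simp [rl_eq_zero]
  | succ k ih =>
    have h1 : Q ⊔ Ideal.span {u ^ (k + 1)} ≤ Q ⊔ Ideal.span {u ^ k} := by
      refine sup_le_sup le_rfl ?_
      rw [Ideal.span_singleton_le_span_singleton]; exact pow_dvd_pow _ (Nat.le_succ k)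
    rw [rl_add h1 le_top]
    have h2 : rl (Q ⊔ Ideal.span {u ^ (k + 1)}) (Q ⊔ Ideal.span {u ^ k}) ≤ rl (Q ⊔ Ideal.span {u}) ⊤ := by
      refine rl_le_of_surj (LinearMap.mulLeft R (u ^ k)) ?_ ?_ ?_
      · intro a _ ha
        obtain ⟨q, hq, r, hr, rfl⟩ := Submodule.mem_sup.1 ha
        obtain ⟨r, rfl⟩ := Ideal.mem_span_singleton'.1 hr
        rw [LinearMap.mulLeft_apply, mul_add]
        refine Submodule.add_mem_sup (Ideal.mul_mem_left _ _ hq) ?_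
        exact Ideal.mem_span_singleton'.2 ⟨r, by ring⟩
      · intro a _
        exact Ideal.mem_sup_right (Ideal.mem_span_singleton'.2 ⟨a, by simp [mul_comm]⟩)
      · intro y hy
        obtain ⟨q, hq, r, hr, rfl⟩ := Submodule.mem_sup.1 hy
        obtain ⟨r, rfl⟩ := Ideal.mem_span_singleton'.1 hr
        refine ⟨r, trivial, Ideal.mem_sup_left ?_⟩
        rw [LinearMap.mulLeft_apply, mul_comm (u ^ k), add_sub_cancel_right]
        exact hq
    push_cast
    rw [add_mul, one_mul, add_comm]
    exact add_le_add ih h2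

theorem rl_pows {R : Type*} [CommRing R] (x : Fin 3 → R) (k : ℕ) :
    rl (Ideal.span (Set.range fun i => x i ^ k)) ⊤ ≤ (k ^ 3 : ℕ) * rl (sp x) ⊤ := by
  have e : ∀ y : Fin 3 → R, Ideal.span (Set.range y) =
      Ideal.span {y 0} ⊔ Ideal.span {y 1} ⊔ Ideal.span {y 2} := by
    intro y
    rw [← Ideal.span_union, ← Ideal.span_union]
    congr 1
    ext z
    simp only [Set.mem_range, Fin.exists_fin_succ, Set.mem_union, Set.mem_singleton_iff]
    simp [eq_comm, or_assoc]
  rw [e, sp, e]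
  calc _ ≤ k * rl (Ideal.span {x 0 ^ k} ⊔ Ideal.span {x 1 ^ k} ⊔ Ideal.span {x 2}) ⊤ := rl_mul_step _ _ _
    _ = k * rl (Ideal.span {x 0 ^ k} ⊔ Ideal.span {x 2} ⊔ Ideal.span {x 1 ^ k}) ⊤ := by
      rw [sup_right_comm]
    _ ≤ k * (k * rl (Ideal.span {x 0 ^ k} ⊔ Ideal.span {x 2} ⊔ Ideal.span {x 1}) ⊤) := by
      gcongr; exact rl_mul_step _ _ _
    _ = k * (k * rl (Ideal.span {x 2} ⊔ Ideal.span {x 1} ⊔ Ideal.span {x 0 ^ k}) ⊤) := by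
      rw [sup_assoc, sup_comm]
    _ ≤ k * (k * (k * rl (Ideal.span {x 2} ⊔ Ideal.span {x 1} ⊔ Ideal.span {x 0}) ⊤)) := by
      gcongr; exact rl_mul_step _ _ _
    _ = _ := by
      rw [sup_comm, ← sup_assoc, sup_right_comm]; push_cast; ring

theorem koszul_ineq {R : Type*} [CommRing R] [IsLocalRing R] [IsNoetherianRing R] {x : Fin 3 → R}
    (hx : QR x) {c : ℕ} (hc : ∀ n, NF x (n + c) ≤ sp x ^ n) (hm : sp x ≤ maximalIdeal R)
    {k : ℕ} (hk : 0 < k) :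
    rl (NF x (3 * k)) ⊤ + 3 * rl (NF x k) ⊤ ≤ 3 * rl (NF x (2 * k)) ⊤ +
      rl (Ideal.span (Set.range fun i => x i ^ k) ⊔ NF x (3 * k)) ⊤ := by
  set Q := Ideal.span (Set.range fun i => x i ^ k) with hQ
  have hxk : ∀ i, x i ^ k ∈ NF x k := fun i =>
    pow_le_NF _ (Ideal.pow_mem_pow (show x i ∈ sp x from Ideal.subset_span ⟨i, rfl⟩) _)
  let φ : (Fin 3 → R) →ₗ[R] R := Fintype.linearCombination R (fun i => x i ^ k)
  have hφ : ∀ a, φ a = a 0 * x 0 ^ k + a 1 * x 1 ^ k + a 2 * x 2 ^ k := by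
    intro a; simp [φ, Fintype.linearCombination_apply, Fin.sum_univ_three]
  let ψ : (Fin 3 → R) →ₗ[R] (Fin 3 → R) := Matrix.toLin' !![0, -x 2 ^ k, x 1 ^ k; x 2 ^ k, 0, -x 0 ^ k; -x 1 ^ k, x 0 ^ k, 0]
  have hψ : ∀ a, ψ a = ![-x 2 ^ k * a 1 + x 1 ^ k * a 2, x 2 ^ k * a 0 + -x 0 ^ k * a 2, -x 1 ^ k * a 0 + x 0 ^ k * a 1] := by
    intro a
    simp [ψ, Matrix.toLin'_apply, dotProduct, Fin.sum_univ_three]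
  let W : Submodule R (Fin 3 → R) := Submodule.pi Set.univ fun _ => NF x (2 * k)
  have h0 : rl (NF x (3 * k)) ⊤ = rl (NF x (3 * k)) Q + rl (Q ⊔ NF x (3 * k)) ⊤ := by
    rw [rl_add (le_sup_right : NF x (3 * k) ≤ Q ⊔ NF x (3 * k)) le_top, sup_comm, rl_sup]
  have h1 : rl (NF x (3 * k)) Q ≤ rl (Submodule.comap φ (NF x (3 * k))) ⊤ := by
    refine rl_le_of_surj φ (fun a _ h => h) (fun a _ => ?_) ?_
    · rw [hφ]
      refine add_mem (add_mem ?_ ?_) ?_ <;>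
      exact Ideal.mul_mem_left _ _ (Ideal.subset_span ⟨_, rfl⟩)
    · intro y hy
      obtain ⟨a, rfl⟩ := (Submodule.mem_span_range_iff_exists_fun R).1 hy
      exact ⟨a, trivial, by simp [φ, Fintype.linearCombination_apply]⟩
  have hW : W ≤ Submodule.comap φ (NF x (3 * k)) := by
    intro a ha
    rw [Submodule.mem_comap, hφ]
    have : ∀ i, a i * x i ^ k ∈ NF x (3 * k) := fun i => by
      have := NF_mul (ha i trivial) (hxk i)
      rwa [show 2 * k + k = 3 * k by ring] at this
    exact add_mem (add_mem (this _) (this _)) (this _)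
  have h2 : 3 * rl (NF x (2 * k)) ⊤ = rl W (Submodule.comap φ (NF x (3 * k))) +
      rl (Submodule.comap φ (NF x (3 * k))) ⊤ := by
    rw [← rl_add hW le_top]
    have := rl_pi (σ := Fin 3) (NF x (2 * k)) (⊤ : Submodule R R)
    rw [Submodule.pi_top] at this
    rw [this]; simp
  have h3 : 3 * rl (NF x k) ⊤ ≤ rl W (Submodule.comap φ (NF x (3 * k))) := by
    have := rl_pi (σ := Fin 3) (NF x k) (⊤ : Submodule R R)
    rw [Submodule.pi_top] at this
    have e : 3 * rl (NF x k) ⊤ = rl (Submodule.pi Set.univ fun _ : Fin 3 => NF x k) ⊤ := by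
      rw [this]; simp
    rw [e]
    refine rl_le_of_inj ψ ?_ ?_
    · intro a _
      rw [Submodule.mem_comap, hφ, hψ]
      simp only [Matrix.cons_val]
      convert Submodule.zero_mem _ using 1
      ring
    · intro a _ ha i _
      rw [hψ] at ha
      have t0 := ha 0 trivial
      have t2 := ha 2 trivial
      simp only [Matrix.cons_val] at t0 t2
      have s0 := star hx hc hm (i := 1) (j := 2) (by decide) hk t0 (a₁ := a 1) (a₂ := a 2) (by ring)
      have s2 := star hx hc hm (i := 0) (j := 1) (by decide) hk t2 (a₁ := a 0) (a₂ := a 1) (by ring)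
      fin_cases i
      · exact s2.1
      · exact s0.1
      · exact s0.2
  rw [h0, h2]
  calc _ = rl (NF x (3 * k)) Q + 3 * rl (NF x k) ⊤ + rl (Q ⊔ NF x (3 * k)) ⊤ := by ring
    _ ≤ _ := by
      refine add_le_add ?_ le_rfl
      rw [add_comm]
      exact add_le_add h3 h1

end NH

end

section
set_option synthInstance.maxHeartbeats 1000000
set_option maxHeartbeats 400000

open IsLocalRing Polynomial Finset

namespace NH

/-- polynomial Hilbert function of the normal filtration with vanishing third coefficient -/
def HP {R : Type*} [CommRing R] {d : ℕ} (x : Fin d → R) : Prop :=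
  ∃ (e : ℕ → ℤ) (N : ℕ), e 3 = 0 ∧ ∀ n ≥ N, ∃ l : ℕ, rl (NF x (n + 1)) ⊤ = l ∧ (l : ℤ) =
      ∑ i ∈ Finset.range (d + 1), (-1 : ℤ) ^ i * e i * ((n + d - i).choose (d - i))

theorem cubic_cmp (A B C D : ℤ) (c N : ℕ) (hA : 0 ≤ A)
    (h : ∀ m : ℕ, N ≤ m → A * ((m + 2) * (m + 1) * m) ≤ B * ((m + c + 2) * (m + c + 1) * (m + c)) +
      C * ((m + c + 1) * (m + c)) + D * (m + c)) : A ≤ B := by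
  by_contra hcon
  push Not at hcon
  set K : ℤ := |B| * (c + 2) ^ 3 * 7 + |C| * (c + 2) ^ 2 + |D| * (c + 2) with hK
  have hK0 : 0 ≤ K := by positivity
  have h1 := h (N + K.toNat + 1) (by omega)
  set m := N + K.toNat + 1 with hm
  have hmK : K < m := by have := Int.self_le_toNat K; rw [hm]; push_cast; omega
  have hm1 : (1 : ℤ) ≤ m := by rw [hm]; push_cast; omega
  clear_value m
  have hc : (0 : ℤ) ≤ c := by positivity
  set M : ℤ := (m : ℤ)
  set w : ℤ := (c : ℤ)
  have e1 : B * ((M + w + 2) * (M + w + 1) * (M + w)) ≤ B * M ^ 3 + |B| * ((w + 2) ^ 3 * 7 * M ^ 2) := by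
    have h5 : 0 ≤ (M + w + 2) * (M + w + 1) * (M + w) - M ^ 3 := by
      have : (M + w + 2) * (M + w + 1) * (M + w) - M ^ 3 =
        3 * M ^ 2 * (w + 1) + M * ((w + 1) * w + (w + 2) * w + (w + 2) * (w + 1)) + (w + 2) * (w + 1) * w := by ring
      rw [this]; positivity
    have h6 : (M + w + 2) * (M + w + 1) * (M + w) - M ^ 3 ≤ (w + 2) ^ 3 * 7 * M ^ 2 := by
      have a1 : (M + w + 2) * (M + w + 1) * (M + w) ≤ (M + (w + 2)) ^ 3 := by
        rw [show (M + (w + 2)) ^ 3 = (M + (w + 2)) * (M + (w + 2)) * (M + (w + 2)) by ring]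
        gcongr ?_ * ?_ * ?_ <;> linarith
      have a2 : (M + (w + 2)) ^ 3 - M ^ 3 = 3 * M ^ 2 * (w + 2) + 3 * M * (w + 2) ^ 2 + (w + 2) ^ 3 := by ring
      have b0 : (1 : ℤ) ≤ w + 2 := by linarith
      have b1 : M ≤ M ^ 2 := by nlinarith
      have b2 : (1 : ℤ) ≤ M ^ 2 := by nlinarith
      have b3 : w + 2 ≤ (w + 2) ^ 3 := le_self_pow₀ b0 (by norm_num)
      have b4 : (w + 2) ^ 2 ≤ (w + 2) ^ 3 := pow_le_pow_right₀ b0 (by norm_num)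
      have c1 : 3 * M ^ 2 * (w + 2) ≤ 3 * M ^ 2 * (w + 2) ^ 3 := by gcongr
      have c2 : 3 * M * (w + 2) ^ 2 ≤ 3 * M ^ 2 * (w + 2) ^ 3 := by gcongr
      have c3 : (w + 2) ^ 3 ≤ M ^ 2 * (w + 2) ^ 3 := le_mul_of_one_le_left (by positivity) b2
      linarith
    have h7 : B * ((M + w + 2) * (M + w + 1) * (M + w) - M ^ 3) ≤ |B| * ((w + 2) ^ 3 * 7 * M ^ 2) :=
      mul_le_mul (le_abs_self B) h6 h5 (abs_nonneg B)
    linarith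
  have e2 : C * ((M + w + 1) * (M + w)) ≤ |C| * ((w + 2) ^ 2 * M ^ 2) := by
    refine mul_le_mul (le_abs_self C) ?_ (by positivity) (abs_nonneg C)
    rw [← mul_pow, sq]
    gcongr <;> nlinarith
  have e3 : D * (M + w) ≤ |D| * ((w + 2) * M ^ 2) := by
    refine mul_le_mul (le_abs_self D) ?_ (by positivity) (abs_nonneg D)
    have b1 : M ≤ M ^ 2 := by nlinarith
    have b2 : (1 : ℤ) ≤ M ^ 2 := by nlinarith
    have b3 : w ≤ w * M ^ 2 := le_mul_of_one_le_right hc b2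
    nlinarith
  have e4 : A * M ^ 3 ≤ A * ((M + 2) * (M + 1) * M) := by
    refine mul_le_mul_of_nonneg_left ?_ hA
    nlinarith [sq_nonneg M]
  have e5 : (A - B) * M ^ 3 ≤ K * M ^ 2 := by
    rw [hK]; linarith
  have e6 : 1 * M ^ 3 ≤ (A - B) * M ^ 3 := by
    gcongr; linarith
  have e7 : K * M ^ 2 < M * M ^ 2 := by
    have : 0 < M ^ 2 := by positivity
    exact mul_lt_mul_of_pos_right hmK this
  nlinarith

end NH

end

section
set_option synthInstance.maxHeartbeats 1000000
set_option maxHeartbeats 400000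

open IsLocalRing Polynomial Finset

namespace NH

theorem choose3 (m : ℕ) : ((m + 2).choose 3 : ℤ) * 6 = (m + 2) * (m + 1) * m := by
  have h := Nat.descFactorial_eq_factorial_mul_choose (m + 2) 3
  have h2 : (m + 2).descFactorial 3 = (m + 2) * (m + 1) * m := by
    simp [Nat.descFactorial]; ring
  rw [h2] at h
  have h3 : Nat.factorial 3 = 6 := rfl
  rw [h3] at h
  have : (((m + 2) * (m + 1) * m : ℕ) : ℤ) = ((6 * (m + 2).choose 3 : ℕ) : ℤ) := by rw [h]
  push_cast at this
  linarith

theorem choose2 (m : ℕ) : ((m + 1).choose 2 : ℤ) * 2 = (m + 1) * m := by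
  have h := Nat.descFactorial_eq_factorial_mul_choose (m + 1) 2
  have h2 : (m + 1).descFactorial 2 = (m + 1) * m := by
    simp [Nat.descFactorial]; ring
  rw [h2] at h
  have h3 : Nat.factorial 2 = 2 := rfl
  rw [h3] at h
  have : (((m + 1) * m : ℕ) : ℤ) = ((2 * (m + 1).choose 2 : ℕ) : ℤ) := by rw [h]
  push_cast at this
  linarith

theorem claim3_poly {R : Type*} [CommRing R] {x : Fin 3 → R} (h : HP x) :
    ∃ (e0 e1 e2 : ℤ) (N : ℕ), ∀ m ≥ N, ∃ l : ℕ, rl (NF x m) ⊤ = l ∧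
      (l : ℤ) * 6 = e0 * ((m + 2) * (m + 1) * m) - 3 * e1 * ((m + 1) * m) + 6 * e2 * m := by
  obtain ⟨e, N, h3, hl⟩ := h
  refine ⟨e 0, e 1, e 2, N + 1, ?_⟩
  intro m hm
  obtain ⟨n, rfl⟩ : ∃ n, m = n + 1 := ⟨m - 1, by omega⟩
  obtain ⟨l, h1, h2⟩ := hl n (by omega)
  refine ⟨l, h1, ?_⟩
  rw [h2]
  simp only [Finset.sum_range_succ, Finset.range_zero, Finset.sum_empty, h3]
  have a1 := choose3 (n + 1)
  have a2 := choose2 (n + 1)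
  rw [show n + 3 - 0 = n + 1 + 2 by omega, show n + 3 - 1 = n + 1 + 1 by omega,
    show n + 3 - 2 = n + 1 by omega, show 3 - 0 = 3 by omega, show 3 - 1 = 2 by omega,
    show 3 - 2 = 1 by omega, Nat.choose_one_right]
  push_cast at a1 a2 ⊢
  linear_combination e 0 * a1 - 3 * e 1 * a2

theorem claim3 {R : Type*} [CommRing R] [IsLocalRing R] [IsNoetherianRing R] {x : Fin 3 → R}
    (hx : QR x) {c : ℕ} (hc : ∀ n, NF x (n + c) ≤ sp x ^ n) (hm : sp x ≤ maximalIdeal R)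
    {N0 : ℕ} (hN0 : maximalIdeal R ^ N0 ≤ sp x) (h : HP x) (n : ℕ) : NF x (n + 2) ≤ sp x ^ n := by
  obtain ⟨e0, e1, e2, N, hl⟩ := claim3_poly h
  obtain ⟨E, hE⟩ := ENat.ne_top_iff_exists.1 (rl_ne_top_of_pow_le hN0 ⊤)
  have hEe : (E : ℤ) ≤ e0 := by
    refine cubic_cmp E e0 (-3 * e1) (6 * e2) c N (by positivity) ?_
    intro m hmN
    obtain ⟨l, h1, h2⟩ := hl (m + c) (by omega)
    have h3 : rl (sp x ^ m) ⊤ ≤ rl (NF x (m + c)) ⊤ := rl_anti _ (hc m)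
    rw [rl_pow_top hx, ← hE, h1] at h3
    have h4 : (m + 2).choose 3 * E ≤ l := by exact_mod_cast h3
    have h5 : ((m + 2).choose 3 : ℤ) * E ≤ l := by exact_mod_cast h4
    have h6 := choose3 m
    push_cast at h2
    have : (E : ℤ) * ((m + 2) * (m + 1) * m) ≤ l * 6 := by
      rw [← h6]; linarith
    linarith
  have hbig : ∀ k : ℕ, N + 1 ≤ k → NF x (3 * k) ≤ Ideal.span (Set.range fun i => x i ^ k) := by
    intro k hk
    have hko := koszul_ineq hx hc hm (k := k) (by omega)
    set Q := Ideal.span (Set.range fun i => x i ^ k) with hQ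
    obtain ⟨l1, a1, b1⟩ := hl k (by omega)
    obtain ⟨l2, a2, b2⟩ := hl (2 * k) (by omega)
    obtain ⟨l3, a3, b3⟩ := hl (3 * k) (by omega)
    have hp := rl_pows x k
    rw [← hQ, ← hE] at hp
    have hadd := rl_add (N := Q) (K := Q ⊔ NF x (3 * k)) (L := ⊤) le_sup_left le_top
    rw [hadd] at hp
    have hfin : rl Q (Q ⊔ NF x (3 * k)) + rl (Q ⊔ NF x (3 * k)) ⊤ ≠ ⊤ := by
      refine ne_top_of_le_ne_top ?_ hp
      exact_mod_cast ENat.natCast_ne_top (k ^ 3 * E)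
    have hf1 := ne_top_of_le_ne_top hfin le_self_add
    have hf2 := ne_top_of_le_ne_top hfin le_add_self
    obtain ⟨u, hu⟩ := ENat.ne_top_iff_exists.1 hf1
    obtain ⟨v, hv⟩ := ENat.ne_top_iff_exists.1 hf2
    rw [← hu, ← hv] at hp
    rw [← hv, a1, a2, a3] at hko
    have hp' : u + v ≤ k ^ 3 * E := by exact_mod_cast hp
    have hko' : l3 + 3 * l1 ≤ 3 * l2 + v := by exact_mod_cast hko
    have hp2 : (u : ℤ) + v ≤ k ^ 3 * E := by exact_mod_cast hp'
    have hko2 : (l3 : ℤ) + 3 * l1 ≤ 3 * l2 + v := by exact_mod_cast hko'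
    have h9 : (k : ℤ) ^ 3 * E ≤ k ^ 3 * e0 := mul_le_mul_of_nonneg_left hEe (by positivity)
    push_cast at b1 b2 b3
    have h10 : (u : ℤ) ≤ 0 := by linarith
    have h11 : u = 0 := by omega
    rw [h11] at hu
    have := rl_eq_zero.1 hu.symm
    exact le_sup_right.trans this
  intro f hf
  have key : ∀ s ≤ n, f ∈ sp x ^ s := by
    intro s
    induction s with
    | zero => intro _; simp
    | succ s ih =>
      intro hs
      obtain ⟨p, hp, hpf⟩ := mem_form.1 (ih (by omega))
      rw [← hpf, pow_succ']
      refine eval_mem_mul x hp _ fun b => ?_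
      by_cases hb0 : p.coeff b = 0
      · rw [hb0]; exact zero_mem _
      have hbd : b.degree = s := by
        have := hp hb0
        rwa [Finsupp.degree_eq_weight_one]
      have hbs : ∀ i, b i ≤ s := fun i => by rw [← hbd]; exact Finsupp.le_degree i b
      set k := N + 1 + s with hk
      let cc : Fin 3 →₀ ℕ := Finsupp.equivFunOnFinite.symm fun i => k - 1 - b i
      have hcc : ∀ i, cc i = k - 1 - b i := fun i => rfl
      refine q4 hx (k := k) hp b cc ?_ ?_
      · intro i; rw [hcc]; have := hbs i; omega
      · apply hbig k (by omega)
        have hdeg : cc.degree + s = 3 * (k - 1) := by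
          rw [← hbd, Finsupp.degree_eq_sum, Finsupp.degree_eq_sum, Fin.sum_univ_three, Fin.sum_univ_three, hcc, hcc, hcc]
          have := hbs 0; have := hbs 1; have := hbs 2; omega
        rw [hpf]
        have h1 : xm x cc ∈ NF x cc.degree := pow_le_NF _ (prod_mem x cc)
        exact NF_anti (by omega) (NF_mul h1 hf)
  exact key n le_rfl

end NH

end

section
set_option synthInstance.maxHeartbeats 1000000
set_option maxHeartbeats 400000

open IsLocalRing Polynomial Finset

namespace NH

section
variable {R ι : Type*} [CommRing R] [IsNoetherianRing R] {x : ι → R}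

/-- asymptotic membership for the normal filtration -/
theorem NF_asy {n : ℕ} {f : R} (h : ∀ N : ℕ, ∃ a b : ℕ, 0 < b ∧ f ^ b ∈ NF x (n * a) ∧ N * b ≤ (N + 1) * a) :
    f ∈ NF x n := by
  rw [mem_NF]
  apply AC.of_asymptotic
  intro N
  obtain ⟨a, b, hb, hf, hab⟩ := h (2 * N + 1)
  rw [mem_NF, pow_mul] at hf
  obtain ⟨r, hr⟩ := hf
  set M := 2 * N * r + 1 with hM
  refine ⟨a * M, b * (M + r), by positivity, ?_, ?_⟩
  · rw [pow_mul, pow_mul]; exact hr M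
  · have h1 : (2 * N + 1) * b * M ≤ (2 * N + 1 + 1) * a * M := Nat.mul_le_mul_right _ hab
    have h2 : 2 * N * r * b ≤ M * b := Nat.mul_le_mul_right _ (by omega)
    nlinarith

/-- the refined filtration -/
def FD (x : ι → R) (D : ℕ) (hD : 0 < D) (n : ℕ) : Ideal R where
  carrier := {f | f ^ D ∈ NF x n}
  zero_mem' := by simp [zero_pow hD.ne']
  smul_mem' := by
    intro c f hf
    simp only [Set.mem_ofPred_eq, smul_eq_mul, mul_pow] at *
    exact Ideal.mul_mem_left _ _ hf
  add_mem' := by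
    intro f g hf hg
    simp only [Set.mem_ofPred_eq] at *
    have key : ∀ (f : R), f ^ D ∈ NF x n → ∀ a, f ^ a ∈ NF x (n * (a / D)) := by
      intro f hf a
      have : f ^ a = f ^ (a % D) * (f ^ D) ^ (a / D) := by
        rw [← pow_mul, ← pow_add, Nat.mod_add_div]
      rw [this]
      exact Ideal.mul_mem_left _ _ (NF_pow hf _)
    apply NF_asy
    intro N
    refine ⟨N, N + 1, by omega, ?_, by rw [mul_comm]⟩
    rw [← pow_mul, add_pow]
    refine Ideal.sum_mem _ fun i hi => ?_
    rw [Finset.mem_range] at hi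
    refine Ideal.mul_mem_right _ _ ?_
    refine NF_anti ?_ (NF_mul (key f hf i) (key g hg (D * (N + 1) - i)))
    rw [← mul_add]
    refine Nat.mul_le_mul_left _ ?_
    have h1 := Nat.div_add_mod i D
    have h2 := Nat.div_add_mod (D * (N + 1) - i) D
    have h3 := Nat.mod_lt i hD
    have h4 := Nat.mod_lt (D * (N + 1) - i) hD
    by_contra hcon
    push Not at hcon
    have h5 : D * (i / D) + D * ((D * (N + 1) - i) / D) + D ≤ D * N := by
      rw [← mul_add, ← Nat.mul_succ]
      exact Nat.mul_le_mul_left _ hcon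
    have h6 : D * (N + 1) = D * N + D := by ring
    omega

variable {D : ℕ} {hD : 0 < D}

theorem mem_FD {n : ℕ} {f : R} : f ∈ FD x D hD n ↔ f ^ D ∈ NF x n := Iff.rfl

theorem FD_anti {n m : ℕ} (h : n ≤ m) : FD x D hD m ≤ FD x D hD n := fun _ hf => NF_anti h hf

theorem FD_mul {n m : ℕ} {f g : R} (hf : f ∈ FD x D hD n) (hg : g ∈ FD x D hD m) :
    f * g ∈ FD x D hD (n + m) := by
  rw [mem_FD] at *
  rw [mul_pow]; exact NF_mul hf hg

theorem FD_D {n : ℕ} : FD x D hD (D * n) = NF x n := by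
  ext f
  rw [mem_FD, mul_comm]
  exact ⟨fun h => NF_of_pow hD h, fun h => NF_pow h D⟩

theorem FD_zero : FD x D hD 0 = ⊤ := by
  rw [eq_top_iff]; intro f _; rw [mem_FD, NF_zero]; trivial

end

theorem FD_cancel {R ι : Type*} [CommRing R] [IsLocalRing R] [IsNoetherianRing R] [LinearOrder ι] {x : ι → R}
    {D : ℕ} {hD : 0 < D}
    (hx : QR x) {N : ℕ} (hN : maximalIdeal R ^ N ≤ sp x) {G : MvPolynomial ι R} {j : ℕ}
    (hG : G.IsHomogeneous j) (hGu : ∃ m, IsUnit (G.coeff m)) {n : ℕ} {a : R}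
    (h : MvPolynomial.eval x G * a ∈ FD x D hD (n + D * j)) : a ∈ FD x D hD n := by
  rw [mem_FD] at *
  rw [mul_pow, ← map_pow] at h
  refine NF_cancel hx hN (hG.pow D) ?_ (n := n) (by rwa [mul_comm j D])
  rw [unit_coeff_iff] at hGu ⊢
  rw [map_pow]; exact pow_ne_zero _ hGu

end NH

end

section
set_option synthInstance.maxHeartbeats 1000000
set_option maxHeartbeats 400000

open IsLocalRing Polynomial Finset

namespace NH

theorem choose_shift (k M n : ℕ) :
    (M + n + (k + 1)).choose (k + 1) ≤ (M + (k + 1)).choose (k + 1) + n * (M + n + k).choose k := by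
  induction n with
  | zero => simp
  | succ n ih =>
    have h1 : (M + (n + 1) + (k + 1)).choose (k + 1) =
        (M + (n + 1) + k).choose k + (M + n + (k + 1)).choose (k + 1) := by
      rw [show M + (n + 1) + (k + 1) = (M + (n + 1) + k) + 1 by ring, Nat.choose_succ_succ,
        show M + (n + 1) + k = M + n + (k + 1) by ring]
    have h2 : (M + n + k).choose k ≤ (M + (n + 1) + k).choose k := Nat.choose_le_choose _ (by omega)
    have h3 := Nat.mul_le_mul_left n h2
    rw [h1, add_mul, one_mul]
    omega

theorem choose_ratio (k q e n : ℕ) (h : ∀ M, q * (M + k).choose k ≤ e * (M + n + k).choose k) : q ≤ e := by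
  rcases k with _ | k
  · simpa using h 0
  have := cmp_choose ((q : ℤ) - e) (q * n) k n (by
    intro m hm
    obtain ⟨M, rfl⟩ : ∃ M, m = M + n := ⟨m - n, by omega⟩
    have h1 := h M
    have h2 := Nat.mul_le_mul_left q (choose_shift k M n)
    have h3 : q * (M + n + (k + 1)).choose (k + 1) ≤
      e * (M + n + (k + 1)).choose (k + 1) + q * n * (M + n + k).choose k := by
      rw [mul_add, ← mul_assoc] at h2
      exact h2.trans (by omega)
    have h4 : (q : ℤ) * ((M + n + (k + 1)).choose (k + 1) : ℕ) ≤
      e * ((M + n + (k + 1)).choose (k + 1) : ℕ) + q * n * ((M + n + k).choose k : ℕ) := by exact_mod_cast h3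
    linarith)
  omega

theorem rl_count {R B : Type*} [CommRing R] [IsLocalRing R] [Fintype B] (N K : Ideal R) (y : B → R)
    (hy : ∀ b, y b ∈ K) (h : ∀ a : B → R, ∑ b, a b * y b ∈ N → ∀ b, a b ∈ maximalIdeal R) :
    (Fintype.card B : ℕ∞) ≤ rl N K := by
  have h1 := rl_pi (σ := B) (maximalIdeal R) (⊤ : Ideal R)
  rw [rl_max_top, mul_one] at h1
  rw [← h1]
  refine rl_le_of_inj (Fintype.linearCombination R y) ?_ ?_
  · intro a _
    rw [Fintype.linearCombination_apply]
    exact Ideal.sum_mem _ fun b _ => Ideal.mul_mem_left _ _ (hy b)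
  · intro a _ ha
    rw [Fintype.linearCombination_apply] at ha
    rw [Submodule.mem_pi]
    intro b _
    exact h a ha b

/-- monomials of degree n in d variables -/
abbrev Mon (d n : ℕ) := (Finset.univ : Finset (Fin d)).finsuppAntidiag n

theorem card_Mon (d n : ℕ) : Fintype.card (Mon d n) = cb d n := by
  rw [Fintype.card_coe, Finset.card_finsuppAntidiag_nat_eq_choose]
  simp [cb]

theorem Mon_degree {d n : ℕ} (m : Mon d n) : (m : Fin d →₀ ℕ).degree = n := by
  have := (Finset.mem_finsuppAntidiag.1 m.2).1
  rw [Finsupp.degree_eq_sum]; exact this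

/-- the form with coefficients a -/
noncomputable def mkForm {R : Type*} [CommRing R] {d n : ℕ} (a : Mon d n → R) : MvPolynomial (Fin d) R :=
  ∑ m : Mon d n, MvPolynomial.monomial m.1 (a m)

theorem mkForm_hom {R : Type*} [CommRing R] {d n : ℕ} (a : Mon d n → R) : (mkForm a).IsHomogeneous n :=
  MvPolynomial.IsHomogeneous.sum _ _ _ fun m _ => MvPolynomial.isHomogeneous_monomial _ (Mon_degree m)

theorem mkForm_coeff {R : Type*} [CommRing R] {d n : ℕ} (a : Mon d n → R) (m : Mon d n) :
    (mkForm a).coeff m.1 = a m := by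
  classical
  unfold mkForm
  rw [MvPolynomial.coeff_sum, Finset.sum_eq_single m]
  · simp
  · intro b _ hb
    rw [MvPolynomial.coeff_monomial, if_neg]
    intro h; exact hb (Subtype.ext h)
  · simp

theorem mkForm_eval {R : Type*} [CommRing R] {d n : ℕ} (x : Fin d → R) (a : Mon d n → R) :
    MvPolynomial.eval x (mkForm a) = ∑ m : Mon d n, a m * xm x m.1 := by
  unfold mkForm
  rw [map_sum]
  refine Finset.sum_congr rfl fun m _ => ?_
  rw [MvPolynomial.eval_monomial, xm]

theorem lemC1 {R : Type*} [CommRing R] [IsLocalRing R] {d : ℕ} (x : Fin d → R)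
    {q : ℕ} (f : Fin q → R) (n : ℕ) (N K : Ideal R)
    (hK : ∀ i, ∀ y ∈ sp x ^ n, y * f i ∈ K)
    (hind : ∀ p : Fin q → MvPolynomial (Fin d) R, (∀ i, (p i).IsHomogeneous n) →
      ∑ i, MvPolynomial.eval x (p i) * f i ∈ N → ∀ i b, (p i).coeff b ∈ maximalIdeal R) :
    ((q * cb d n : ℕ) : ℕ∞) ≤ rl N K := by
  have := rl_count (B := Fin q × Mon d n) N K (fun b => xm x b.2.1 * f b.1) ?_ ?_
  · rwa [Fintype.card_prod, card_Mon, Fintype.card_fin] at this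
  · rintro ⟨i, m⟩
    refine hK i _ ?_
    have := prod_mem x m.1
    rwa [Mon_degree] at this
  · intro a ha b
    have h1 := hind (fun i => mkForm fun m => a (i, m)) (fun i => mkForm_hom _) (by
      rw [Fintype.sum_prod_type] at ha
      convert ha using 1
      refine Finset.sum_congr rfl fun i _ => ?_
      rw [mkForm_eval, Finset.sum_mul]
      refine Finset.sum_congr rfl fun m _ => ?_
      ring) b.1 b.2.1
    rwa [mkForm_coeff] at h1

theorem cb_eq (d n : ℕ) : cb (d + 1) n = (n + d).choose d := by
  unfold cb
  rw [show d + 1 + n - 1 = n + d by omega, Nat.choose_symm_add]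

/-- an independent family has at most e₀ members -/
theorem lemC2 {R : Type*} [CommRing R] [IsLocalRing R] [IsNoetherianRing R] {d : ℕ} {x : Fin (d + 1) → R}
    (hx : QR x) {e0 : ℕ} (he0 : rl (sp x) ⊤ = e0)
    (E : ℕ → Ideal R) (hanti : ∀ m, E (m + 1) ≤ E m) (hJE : ∀ m, sp x ^ (m + 1) ≤ E m)
    {q : ℕ} (n0 : ℕ) (h : ∀ m, ((q * cb (d + 1) m : ℕ) : ℕ∞) ≤ rl (E (n0 + m + 1)) (E (n0 + m))) : q ≤ e0 := by
  have hA : ∀ M, ((q * ∑ i ∈ Finset.range M, cb (d + 1) i : ℕ) : ℕ∞) ≤ rl (E (n0 + M)) (E n0) := by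
    intro M
    induction M with
    | zero => simp
    | succ M ih =>
      have hle : E (n0 + M) ≤ E n0 := antitone_nat_of_succ_le hanti (by omega)
      have h1 := rl_add (N := E (n0 + M + 1)) (hanti _) hle
      rw [show n0 + (M + 1) = n0 + M + 1 by ring, h1, Finset.sum_range_succ, mul_add, add_comm]
      push_cast at h ih ⊢
      exact add_le_add (h M) ih
  refine choose_ratio (d + 1) q e0 (n0 + 2) fun M => ?_
  have h1 := hA (M + 1)
  have h2 : rl (E (n0 + (M + 1))) (E n0) ≤ rl (sp x ^ (n0 + (M + 1) + 1)) ⊤ :=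
    (rl_mono _ le_top).trans (rl_anti _ (hJE _))
  have h3 := h1.trans h2
  rw [rl_pow_top hx, he0, sum_cb] at h3
  have h4 : q * (M + 1 + d).choose (d + 1) ≤ (n0 + (M + 1) + 1 + d).choose (d + 1) * e0 := by exact_mod_cast h3
  rw [mul_comm _ e0] at h4
  rw [show M + (d + 1) = M + 1 + d by ring]
  refine h4.trans (Nat.mul_le_mul_left _ (Nat.choose_le_choose _ (by omega)))

end NH

end

section
set_option synthInstance.maxHeartbeats 1000000
set_option maxHeartbeats 400000

open IsLocalRing Polynomial Finset

namespace NH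

theorem val_exists {R ι : Type*} [CommRing R] [IsNoetherianRing R] {x : ι → R} (h1 : NF x 1 ≠ ⊤)
    {f : R} {D n : ℕ} (hD : 0 < D) (hf : f ^ D ∉ NF x (n + 1)) :
    ∃ v : ℝ, 0 ≤ v ∧ ∀ q p : ℕ, f ^ q ∈ NF x p ↔ (p : ℝ) ≤ q * v := by
  set S : Set ℝ := {r | ∃ p q : ℕ, 0 < q ∧ f ^ q ∈ NF x p ∧ r = p / q} with hS
  have hb : ∀ r ∈ S, r ≤ (n + 1) / D := by
    rintro r ⟨p, q, hq, hpq, rfl⟩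
    rw [div_le_div_iff₀ (by positivity) (by positivity)]
    by_contra hcon
    push Not at hcon
    have hc : (n + 1) * q < p * D := by exact_mod_cast hcon
    apply hf
    apply NF_of_pow hq
    rw [← pow_mul, mul_comm D q, pow_mul]
    exact NF_anti hc.le (NF_pow hpq D)
  have hbdd : BddAbove S := ⟨_, hb⟩
  have h0 : (0 : ℝ) ∈ S := ⟨0, 1, one_pos, by rw [NF_zero]; trivial, by simp⟩
  have hv0 : 0 ≤ sSup S := le_csSup hbdd h0
  refine ⟨sSup S, hv0, fun q p => ⟨fun h => ?_, fun h => ?_⟩⟩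
  · rcases Nat.eq_zero_or_pos q with rfl | hq
    · rcases Nat.eq_zero_or_pos p with rfl | hp
      · simp
      · exfalso
        apply h1
        rw [Ideal.eq_top_iff_one]
        rw [pow_zero] at h
        exact NF_anti hp h
    · have := le_csSup hbdd (show (p : ℝ) / q ∈ S from ⟨p, q, hq, h, rfl⟩)
      rwa [div_le_iff₀ (by positivity), mul_comm] at this
  · rcases Nat.eq_zero_or_pos p with rfl | hp
    · rw [NF_zero]; trivial
    have hp' : (0 : ℝ) < p := by exact_mod_cast hp
    have hqv : 0 < q * sSup S := lt_of_lt_of_le hp' h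
    have hq : 0 < (q : ℝ) := by
      rcases Nat.eq_zero_or_pos q with rfl | hq
      · simp at hqv
      · exact_mod_cast hq
    have hv : 0 < sSup S := by
      by_contra hcon
      have : sSup S = 0 := le_antisymm (not_lt.1 hcon) hv0
      rw [this] at hqv; simp at hqv
    apply NF_asy
    intro N
    have hlt : sSup S * (N / (N + 1)) < sSup S := by
      refine mul_lt_of_lt_one_right hv ?_
      rw [div_lt_one (by positivity)]; linarith
    obtain ⟨r, ⟨p', q', hq', hpq', rfl⟩, hr⟩ := exists_lt_of_lt_csSup ⟨0, h0⟩ hlt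
    refine ⟨p' * q, q' * p, by positivity, ?_, ?_⟩
    · rw [← pow_mul, show q * (q' * p) = q' * (q * p) by ring, pow_mul,
        show p * (p' * q) = p' * (q * p) by ring]
      exact NF_pow hpq' _
    · have hq'' : (0 : ℝ) < q' := by exact_mod_cast hq'
      have hN : (0 : ℝ) < N + 1 := by positivity
      rw [lt_div_iff₀ hq'', mul_div_assoc', div_mul_eq_mul_div, div_lt_iff₀ hN] at hr
      have h3 : (N : ℝ) * (q' * p) ≤ (N + 1) * (p' * q) := by
        calc (N : ℝ) * (q' * p) ≤ N * (q' * (q * sSup S)) := by gcongr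
          _ = (sSup S * N * q') * q := by ring
          _ ≤ (p' * (N + 1)) * q := by gcongr
          _ = _ := by ring
      exact_mod_cast h3

theorem strict_aux {R : Type*} [CommRing R] [IsLocalRing R] [IsNoetherianRing R] {d : ℕ} {x : Fin (d + 1) → R}
    (hx : QR x) {N : ℕ} (hN : maximalIdeal R ^ N ≤ sp x) (hF1 : NF x 1 = maximalIdeal R)
    {e0 : ℕ} (he0 : rl (sp x) ⊤ = e0) {f : R} {v : ℝ} (hv0 : 0 ≤ v)
    (hv : ∀ q p : ℕ, f ^ q ∈ NF x p ↔ (p : ℝ) ≤ q * v)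
    (hIntg : ∀ m : ℕ, 0 < m → m ≤ e0 → ∀ z : ℕ, (m : ℝ) * v ≠ z) : False := by
  let nn : ℕ → ℕ := fun i => ⌊(i : ℝ) * v⌋₊
  have hnn : ∀ i : ℕ, (nn i : ℝ) ≤ i * v := fun i => Nat.floor_le (by positivity)
  have hnn' : ∀ i : ℕ, (i : ℝ) * v < nn i + 1 := fun i => Nat.lt_floor_add_one _
  let θ : ℕ → ℝ := fun i => i * v - nn i
  have hθ0 : ∀ i : ℕ, 0 ≤ θ i := fun i => sub_nonneg.2 (hnn i)
  have hθ1 : ∀ i : ℕ, θ i < 1 := fun i => by have := hnn' i; simp only [θ]; linarith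
  have hθd : ∀ i j : ℕ, i < j → j ≤ e0 → θ i ≠ θ j := by
    intro i j hij hj h
    have h1 : ((j - i : ℕ) : ℝ) * v = nn j - nn i := by
      rw [Nat.cast_sub hij.le]; simp only [θ] at h; linarith
    have h2 : nn i ≤ nn j := Nat.floor_mono (by gcongr)
    refine hIntg (j - i) (by omega) (by omega) (nn j - nn i) ?_
    rw [h1, Nat.cast_sub h2]
  have hθd' : ∀ i j : ℕ, i ≠ j → i ≤ e0 → j ≤ e0 → θ i ≠ θ j := by
    intro i j hij hi hj
    rcases lt_or_gt_of_ne hij with h | h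
    · exact hθd i j h hj
    · exact (hθd j i h hi).symm
  have hmn : ∀ i : ℕ, i ≤ e0 → nn i ≤ nn e0 := fun i hi => Nat.floor_mono (by gcongr)
  have hfF : ∀ i : ℕ, f ^ i ∈ NF x (nn i) := fun i => (hv _ _).2 (hnn i)
  -- main independence
  have ind : ∀ M, nn e0 ≤ M → ∀ p : Fin (e0 + 1) → MvPolynomial (Fin (d + 1)) R,
      (∀ i, (p i).IsHomogeneous (M - nn i)) → ∑ i, MvPolynomial.eval x (p i) * f ^ (i : ℕ) ∈ NF x (M + 1) →
      ∀ i b, (p i).coeff b ∈ maximalIdeal R := by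
    intro M hM p hp hsum
    by_contra hcon
    push Not at hcon
    classical
    let S : Finset (Fin (e0 + 1)) := univ.filter fun i => ∃ b, IsUnit ((p i).coeff b)
    have hSn : S.Nonempty := by
      obtain ⟨i, b, hb⟩ := hcon
      refine ⟨i, ?_⟩
      simp only [S, Finset.mem_filter, Finset.mem_univ, true_and]
      refine ⟨b, ?_⟩
      rwa [mem_maximalIdeal, mem_nonunits_iff, not_not] at hb
    obtain ⟨i0, hi0, hmin⟩ := S.exists_min_image (fun i => θ i) hSn
    -- choose L
    have hpos : ∀ i ∈ S, i ≠ i0 → 0 < θ i - θ i0 := by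
      intro i hi hne
      have h1 := hmin i hi
      have h2 := hθd' i i0 (fun h => hne (Fin.ext h)) (by omega) (by omega)
      rcases lt_or_eq_of_le h1 with h | h
      · linarith
      · exact absurd h.symm h2
    obtain ⟨L, hL0, hL1, hL2⟩ : ∃ L : ℕ, 0 < L ∧ 1 ≤ L * (1 - θ i0) ∧ ∀ i ∈ S, i ≠ i0 → 1 ≤ L * (θ i - θ i0) := by
      have hex : ∀ i : Fin (e0 + 1), ∃ L : ℕ, i ∈ S → i ≠ i0 → ∀ L' : ℕ, L ≤ L' → 1 ≤ L' * (θ i - θ i0) := by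
        intro i
        by_cases h : i ∈ S ∧ i ≠ i0
        · have h1 := hpos i h.1 h.2
          obtain ⟨L, hL⟩ := exists_nat_ge (1 / (θ i - θ i0))
          refine ⟨L, fun _ _ L' hL' => ?_⟩
          rw [div_le_iff₀ h1] at hL
          refine hL.trans ?_
          have : (L : ℝ) ≤ L' := by exact_mod_cast hL'
          gcongr
        · exact ⟨0, fun h1 h2 => absurd ⟨h1, h2⟩ h⟩
      choose g hg using hex
      have h1 : 0 < 1 - θ i0 := by have := hθ1 i0; linarith
      obtain ⟨L1, hL1⟩ := exists_nat_ge (1 / (1 - θ i0))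
      rw [div_le_iff₀ h1] at hL1
      refine ⟨L1 + (∑ i, g i) + 1, by omega, ?_, ?_⟩
      · refine hL1.trans ?_
        have : (L1 : ℝ) ≤ ((L1 + (∑ i, g i) + 1 : ℕ) : ℝ) := by exact_mod_cast (by omega)
        gcongr
      · intro i hi hne
        refine hg i hi hne _ ?_
        have := Finset.single_le_sum (f := g) (fun _ _ => Nat.zero_le _) (Finset.mem_univ i)
        omega
    set w : ℕ := ⌊(L : ℝ) * θ i0⌋₊ + 1 with hw
    have hLpos : (0 : ℝ) < L := by exact_mod_cast hL0
    have hw1 : (L : ℝ) * θ i0 < w := by rw [hw]; push_cast; exact Nat.lt_floor_add_one _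
    have hw2 : (w : ℝ) ≤ L * θ i0 + 1 := by
      rw [hw]; push_cast
      have := Nat.floor_le (mul_nonneg hLpos.le (hθ0 i0)); linarith
    have hwL : w ≤ L := by
      have : (w : ℝ) ≤ L := by linarith
      exact_mod_cast this
    -- each term
    have hterm : ∀ i ∈ (univ : Finset (Fin (e0 + 1))).erase i0,
        MvPolynomial.eval x (p i) * f ^ (i : ℕ) ∈ FD x L hL0 (L * M + w) := by
      intro i hi
      have hne := Finset.ne_of_mem_erase hi
      have hiM : nn i ≤ M := (hmn i (by omega)).trans hM
      by_cases hiS : i ∈ S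
      · rw [mem_FD, mul_pow, ← pow_mul]
        have h1 : MvPolynomial.eval x (p i) ^ L ∈ NF x ((M - nn i) * L) :=
          NF_pow (pow_le_NF _ (eval_mem_pow x (hp i))) L
        have h2 : f ^ ((i : ℕ) * L) ∈ NF x (L * nn i + w) := by
          rw [hv]
          have := hL2 i hiS hne
          have e : (L : ℝ) * θ i = i * L * v - L * nn i := by simp only [θ]; ring
          push_cast
          linarith
        refine NF_anti (le_of_eq ?_) (NF_mul h1 h2)
        obtain ⟨u, rfl⟩ := Nat.exists_eq_add_of_le hiM
        rw [Nat.add_sub_cancel_left]; ring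
      · have h1 : ∀ b, (p i).coeff b ∈ maximalIdeal R := by
          intro b
          by_contra hb
          apply hiS
          simp only [S, Finset.mem_filter, Finset.mem_univ, true_and]
          refine ⟨b, ?_⟩
          rwa [mem_maximalIdeal, mem_nonunits_iff, not_not] at hb
        have h2 := eval_mem_mul x (hp i) _ h1
        rw [← hF1] at h2
        have h3 : MvPolynomial.eval x (p i) ∈ NF x (1 + (M - nn i)) :=
          ((Ideal.mul_mono_right (pow_le_NF _)).trans (NF_mul_le 1 _)) h2
        have h4 : MvPolynomial.eval x (p i) * f ^ (i : ℕ) ∈ NF x (M + 1) :=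
          NF_anti (by omega) (NF_mul h3 (hfF i))
        rw [← FD_D (hD := hL0)] at h4
        exact FD_anti (by rw [mul_add, mul_one]; omega) h4
    have hsum' : ∑ i, MvPolynomial.eval x (p i) * f ^ (i : ℕ) ∈ FD x L hL0 (L * M + w) := by
      rw [← FD_D (hD := hL0)] at hsum
      exact FD_anti (by rw [mul_add, mul_one]; omega) hsum
    rw [← Finset.add_sum_erase _ _ (Finset.mem_univ i0)] at hsum'
    have h5 := (Ideal.add_mem_iff_left _ (Ideal.sum_mem _ hterm)).1 hsum'
    have hiM : nn i0 ≤ M := (hmn i0 (by omega)).trans hM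
    have h6 : f ^ (i0 : ℕ) ∈ FD x L hL0 (L * nn i0 + w) := by
      refine FD_cancel hx hN (hp i0) (by simpa [S] using hi0) ?_
      convert h5 using 2
      obtain ⟨u, hu⟩ := Nat.exists_eq_add_of_le hiM
      rw [hu, Nat.add_sub_cancel_left]; ring
    rw [mem_FD, ← pow_mul, hv] at h6
    push_cast at h6
    have e : (L : ℝ) * θ i0 = i0 * L * v - L * nn i0 := by simp only [θ]; ring
    linarith
  have hle : e0 + 1 ≤ e0 := by
    refine lemC2 hx he0 (NF x) (fun m => NF_anti (by omega)) (fun m => (pow_le_NF _).trans (NF_anti (by omega)))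
      (nn e0) (fun m => ?_)
    refine lemC1 x (fun i : Fin (e0 + 1) => x 0 ^ (nn e0 - nn i) * f ^ (i : ℕ)) m _ _ ?_ ?_
    · intro i y hy
      have h1 : x 0 ^ (nn e0 - nn i) ∈ NF x (nn e0 - nn i) :=
        pow_le_NF _ (Ideal.pow_mem_pow (show x 0 ∈ sp x from Ideal.subset_span ⟨0, rfl⟩) _)
      have := hmn i (by omega)
      exact NF_anti (by omega) (NF_mul (pow_le_NF _ hy) (NF_mul h1 (hfF i)))
    · intro p hp hs i b
      have h1 := ind (nn e0 + m) (by omega)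
        (fun i => MvPolynomial.monomial (Finsupp.single 0 (nn e0 - nn i)) 1 * p i) (fun i => by
          have h2 : (MvPolynomial.monomial (Finsupp.single (0 : Fin (d + 1)) (nn e0 - nn i)) (1 : R)).IsHomogeneous
            (nn e0 - nn i) := MvPolynomial.isHomogeneous_monomial _ (Finsupp.degree_single _ _)
          have := h2.mul (hp i)
          have h3 := hmn i (by omega)
          rwa [show nn e0 - nn i + m = nn e0 + m - nn i by omega] at this) (by
          convert hs using 2 with i
          rw [map_mul, MvPolynomial.eval_monomial, one_mul, ← xm, xm_single]; ring) i
          (Finsupp.single 0 (nn e0 - nn i) + b)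
      rw [MvPolynomial.coeff_monomial_mul, one_mul] at h1
      exact h1
  omega

theorem strict {R : Type*} [CommRing R] [IsLocalRing R] [IsNoetherianRing R] {d : ℕ} {x : Fin (d + 1) → R}
    (hx : QR x) {N : ℕ} (hN : maximalIdeal R ^ N ≤ sp x) (hF1 : NF x 1 = maximalIdeal R) :
    ∃ (D : ℕ) (hD : 0 < D), ∀ (f : R) (n j : ℕ), 0 < j → f ^ j ∈ FD x D hD (j * n + 1) → f ∈ FD x D hD (n + 1) := by
  obtain ⟨e0, he0⟩ := ENat.ne_top_iff_exists.1 (rl_ne_top_of_pow_le hN ⊤)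
  refine ⟨e0.factorial, Nat.factorial_pos _, fun f n j hj hf => ?_⟩
  rw [mem_FD] at hf ⊢
  by_contra hcon
  obtain ⟨v, hv0, hv⟩ := val_exists (by rw [hF1]; exact (maximalIdeal.isMaximal R).ne_top) (Nat.factorial_pos e0) hcon
  refine strict_aux hx hN hF1 he0.symm hv0 hv ?_
  intro m hm hme z hz
  obtain ⟨u, hu⟩ := Nat.dvd_factorial hm hme
  rw [hv] at hcon
  rw [← pow_mul, hv] at hf
  push Not at hcon
  have h1 : (e0.factorial : ℝ) * v = (u * z : ℕ) := by
    rw [hu]; push_cast; rw [← hz]; ring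
  rw [h1] at hcon
  have h2 : u * z < n + 1 := by exact_mod_cast hcon
  have h3 : ((j * n + 1 : ℕ) : ℝ) ≤ (j * (u * z) : ℕ) := by
    refine hf.trans (le_of_eq ?_)
    push_cast at h1 ⊢
    rw [mul_assoc, h1]
  have h4 : j * n + 1 ≤ j * (u * z) := by exact_mod_cast h3
  have h5 : j * (u * z) ≤ j * n := Nat.mul_le_mul_left _ (by omega)
  omega

end NH

end

section
set_option synthInstance.maxHeartbeats 1000000
set_option maxHeartbeats 400000

open IsLocalRing Polynomial Finset

namespace NH

theorem n2b {P B Ω K E : Type*} [CommRing P] [CommRing B] [IsDomain B] [IsIntegrallyClosed B] [IsNoetherianRing B]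
    [Field Ω] [Algebra P B] [Algebra B Ω] [Algebra P Ω] [IsScalarTower P B Ω] [Module.Finite P B]
    [Field K] [Algebra P K] [IsDomain P] [IsFractionRing P K] [Algebra K Ω] [IsScalarTower P K Ω]
    [Field E] [Algebra B E] [IsFractionRing B E] [Algebra E Ω] [IsScalarTower B E Ω] (a : Finset Ω)
    (ha : ∀ x ∈ a, IsSeparable E x) :
    ∃ W : Submodule P Ω, W.FG ∧ ∀ z ∈ IntermediateField.adjoin K (a : Set Ω), IsIntegral P z → z ∈ W := by
  set L := IntermediateField.adjoin E (a : Set Ω) with hL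
  have hsep : Algebra.IsSeparable E L := (IntermediateField.isSeparable_adjoin_iff_isSeparable E Ω).2 ha
  have hfd : FiniteDimensional E L :=
    IntermediateField.finiteDimensional_adjoin (fun x hx => (ha x hx).isIntegral)
  have hsub : ∀ z ∈ IntermediateField.adjoin K (a : Set Ω), z ∈ L := by
    intro z hz
    induction hz using IntermediateField.adjoin_induction with
    | mem x hx => exact IntermediateField.subset_adjoin _ _ hx
    | algebraMap x =>
      obtain ⟨u, v, hv, rfl⟩ := IsFractionRing.div_surjective (A := P) x
      rw [map_div₀, ← IsScalarTower.algebraMap_apply, ← IsScalarTower.algebraMap_apply,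
        IsScalarTower.algebraMap_apply P B Ω, IsScalarTower.algebraMap_apply P B Ω,
        IsScalarTower.algebraMap_apply B E Ω, IsScalarTower.algebraMap_apply B E Ω]
      exact div_mem (L.algebraMap_mem _) (L.algebraMap_mem _)
    | add x y _ _ hx hy => exact add_mem hx hy
    | mul x y _ _ hx hy => exact mul_mem hx hy
    | inv x _ hx => exact inv_mem hx
  have hC : Module.Finite B (integralClosure B L) := IsIntegralClosure.finite B E L (integralClosure B L)
  have hst : IsScalarTower B L Ω := IsScalarTower.of_algebraMap_eq fun b => by
    rw [IsScalarTower.algebraMap_apply B E Ω, IsScalarTower.algebraMap_apply B E L]; rfl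
  let φ : integralClosure B L →ₗ[B] Ω :=
    (IsScalarTower.toAlgHom B L Ω).toLinearMap ∘ₗ (integralClosure B L).val.toLinearMap
  have hfin : Module.Finite B (LinearMap.range φ) := inferInstance
  have hfin' : Module.Finite P (LinearMap.range φ) := Module.Finite.trans B _
  have hfin2 : Module.Finite P ((LinearMap.range φ).restrictScalars P) := hfin'
  refine ⟨(LinearMap.range φ).restrictScalars P, Module.Finite.iff_fg.1 hfin2, ?_⟩
  intro z hz hzi
  have h1 : IsIntegral B z := hzi.tower_top
  have h2 : IsIntegral B (⟨z, hsub z hz⟩ : L) := by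
    refine (isIntegral_algHom_iff (IsScalarTower.toAlgHom B L Ω) (algebraMap L Ω).injective).1 ?_
    exact h1
  exact ⟨⟨_, h2⟩, rfl⟩

theorem finB {k k' σ : Type*} [Field k] [Field k'] [Algebra k k'] [FiniteDimensional k k'] [Finite σ] {q : ℕ} (hq0 : q ≠ 0) :
    (MvPolynomial.eval₂Hom (MvPolynomial.C.comp (algebraMap k k')) (fun i => MvPolynomial.X i ^ q) :
      MvPolynomial σ k →+* MvPolynomial σ k').Finite := by
  set ψ : MvPolynomial σ k →+* MvPolynomial σ k' :=
    MvPolynomial.eval₂Hom (MvPolynomial.C.comp (algebraMap k k')) (fun i => MvPolynomial.X i ^ q) with hψ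
  have hX : ∀ i, ψ (MvPolynomial.X i) = MvPolynomial.X i ^ q := fun i => MvPolynomial.eval₂Hom_X' _ _ _
  have hC : ∀ c, ψ (MvPolynomial.C c) = MvPolynomial.C (algebraMap k k' c) := fun c => MvPolynomial.eval₂Hom_C _ _ _
  clear_value ψ
  let := ψ.toAlgebra
  have hft : (MvPolynomial.C.comp (algebraMap k k') : k →+* MvPolynomial σ k').FiniteType := by
    refine RingHom.FiniteType.comp ?_ ?_
    · have h : Algebra.FiniteType k' (MvPolynomial σ k') := inferInstance
      exact (RingHom.finiteType_algebraMap (A := k') (B := MvPolynomial σ k')).2 h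
    · have h : Algebra.FiniteType k k' := inferInstance
      exact (RingHom.finiteType_algebraMap (A := k) (B := k')).2 h
  have hft' : ψ.FiniteType := by
    refine RingHom.FiniteType.of_comp_finiteType (f := MvPolynomial.C) ?_
    convert hft using 1
    exact RingHom.ext fun c => hC c
  refine RingHom.IsIntegral.to_finite (fun g => ?_) hft'
  induction g using MvPolynomial.induction_on with
  | C c =>
    obtain ⟨f, hf, hfc⟩ := (Algebra.IsIntegral.isIntegral c : IsIntegral k c)
    refine ⟨f.map MvPolynomial.C, hf.map _, ?_⟩
    rw [Polynomial.eval₂_map, show ψ.comp MvPolynomial.C = MvPolynomial.C.comp (algebraMap k k') from RingHom.ext hC,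
      ← Polynomial.hom_eval₂, hfc, map_zero]
  | add u v hu hv => exact RingHom.IsIntegralElem.add ψ hu hv
  | mul_X u i hu =>
    refine RingHom.IsIntegralElem.mul ψ hu ?_
    refine ⟨Polynomial.X ^ q - Polynomial.C (MvPolynomial.X i), Polynomial.monic_X_pow_sub_C _ hq0, ?_⟩
    rw [Polynomial.eval₂_sub, Polynomial.eval₂_pow, Polynomial.eval₂_X, Polynomial.eval₂_C, hX, sub_self]

set_option maxHeartbeats 2000000 in
theorem n2 {k σ : Type*} [Field k] [Finite σ] {K Ω : Type*} [Field K] [Field Ω] [Algebra (MvPolynomial σ k) K]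
    [IsFractionRing (MvPolynomial σ k) K] [Algebra K Ω] [Algebra (MvPolynomial σ k) Ω] [Algebra k Ω]
    [IsScalarTower k (MvPolynomial σ k) Ω] [IsScalarTower (MvPolynomial σ k) K Ω] [IsAlgClosed Ω]
    [Algebra.IsAlgebraic K Ω] (a : Finset Ω) :
    ∃ W : Submodule (MvPolynomial σ k) Ω, W.FG ∧
      ∀ z ∈ IntermediateField.adjoin K (a : Set Ω), IsIntegral (MvPolynomial σ k) z → z ∈ W := by
  classical
  let P := MvPolynomial σ k
  obtain ⟨p, hp⟩ := ExpChar.exists K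
  have hpΩ : ExpChar Ω p := expChar_of_injective_algebraMap (algebraMap K Ω).injective p
  have h1 : ∀ x : Ω, ∃ n, x ^ p ^ n ∈ separableClosure K Ω := by
    intro x
    obtain ⟨n, y, hy⟩ := (isPurelyInseparable_iff_pow_mem (separableClosure K Ω) p).1 (inferInstance : IsPurelyInseparable (separableClosure K Ω) Ω) x
    exact ⟨n, hy ▸ y.2⟩
  choose n hn using h1
  set e := ∑ x ∈ a, n x with he
  set q := p ^ e with hq
  have hq0 : q ≠ 0 := pow_ne_zero _ (expChar_ne_zero K p)
  have hsep : ∀ x ∈ a, IsSeparable K (x ^ q) := by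
    intro x hx
    rw [← mem_separableClosure_iff]
    have : n x ≤ e := Finset.single_le_sum (f := n) (fun _ _ => Nat.zero_le _) hx
    obtain ⟨u, hu⟩ := Nat.exists_eq_add_of_le this
    rw [hq, hu, pow_add, pow_mul]
    exact pow_mem (hn x) _
  -- roots
  have hroot : ∀ z : Ω, ∃ w : Ω, w ^ q = z := fun z => IsAlgClosed.exists_pow_nat_eq z (Nat.pos_of_ne_zero hq0)
  choose r hr using hroot
  let S : Finset K := a.biUnion fun x => (minpoly K (x ^ q)).coeffs
  let U : Finset P := (S.image fun s => (IsLocalization.sec (nonZeroDivisors P) s).1) ∪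
    S.image fun s => (IsLocalization.sec (nonZeroDivisors P) s).2.1
  let T : Finset Ω := U.biUnion fun u => u.support.image fun m => r (algebraMap k Ω (u.coeff m))
  let k' := IntermediateField.adjoin k (T : Set Ω)
  have hT : ∀ z ∈ T, ∃ c : k, algebraMap k Ω c = z ^ q := by
    intro z hz
    simp only [T, Finset.mem_biUnion, Finset.mem_image] at hz
    obtain ⟨u, _, m, _, rfl⟩ := hz
    exact ⟨_, (hr _).symm⟩
  have hk'q : ∀ z ∈ k', ∃ c : k, algebraMap k Ω c = z ^ q := by
    intro z hz
    induction hz using IntermediateField.adjoin_induction with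
    | mem x hx => exact hT x hx
    | algebraMap x => exact ⟨x ^ q, by rw [map_pow]⟩
    | add x y _ _ hx hy =>
      obtain ⟨c, hc⟩ := hx
      obtain ⟨c', hc'⟩ := hy
      exact ⟨c + c', by rw [map_add, hc, hc', hq, add_pow_expChar_pow]⟩
    | mul x y _ _ hx hy =>
      obtain ⟨c, hc⟩ := hx
      obtain ⟨c', hc'⟩ := hy
      exact ⟨c * c', by rw [map_mul, hc, hc', mul_pow]⟩
    | inv x _ hx =>
      obtain ⟨c, hc⟩ := hx
      exact ⟨c⁻¹, by rw [map_inv₀, hc, inv_pow]⟩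
  have hfd : FiniteDimensional k k' := IntermediateField.finiteDimensional_adjoin (fun x hx => by
    obtain ⟨c, hc⟩ := hT x hx
    refine IsIntegral.of_pow (Nat.pos_of_ne_zero hq0) (n := q) ?_
    rw [← hc]; exact isIntegral_algebraMap)
  let y : σ → Ω := fun i => r (algebraMap P Ω (MvPolynomial.X i))
  have hy : ∀ i, y i ^ q = algebraMap P Ω (MvPolynomial.X i) := fun i => hr _
  choose c0 hc0 using hk'q
  let B := MvPolynomial σ k'
  let φ : B →+* Ω := MvPolynomial.eval₂Hom (algebraMap k' Ω) y
  have hkP : ∀ c : k, algebraMap k Ω c = algebraMap P Ω (MvPolynomial.C c) := fun c => by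
    rw [IsScalarTower.algebraMap_apply k P Ω]; rfl
  have hmon : ∀ (m : σ →₀ ℕ) (c : k), algebraMap P Ω (MvPolynomial.monomial m c) =
      algebraMap k Ω c * (m.prod fun i j => y i ^ j) ^ q := by
    intro m c
    rw [MvPolynomial.monomial_eq, map_mul, hkP, Finsupp.prod, Finsupp.prod, map_prod, ← Finset.prod_pow]
    congr 1
    refine Finset.prod_congr rfl fun i _ => ?_
    rw [map_pow, ← hy, ← pow_mul, ← pow_mul, mul_comm]
  have hφ : ∀ g : B, φ g ^ q = algebraMap P Ω (∑ m ∈ g.support, MvPolynomial.monomial m (c0 _ (g.coeff m).2)) := by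
    intro g
    rw [map_sum]
    have hφe : φ g = ∑ m ∈ g.support, algebraMap k' Ω (g.coeff m) * ∏ i ∈ m.support, y i ^ m i :=
      MvPolynomial.eval₂_eq _ _ _
    rw [hφe, hq, ← iterateFrobenius_def (R := Ω), map_sum]
    refine Finset.sum_congr rfl fun m _ => ?_
    rw [hmon, hc0, iterateFrobenius_def, mul_pow]; rfl
  have hinjP : Function.Injective (algebraMap P Ω) := by
    rw [IsScalarTower.algebraMap_eq P K Ω]
    exact (algebraMap K Ω).injective.comp (IsFractionRing.injective P K)
  have hφi : Function.Injective φ := by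
    rw [injective_iff_map_eq_zero]
    intro g hg
    have h2 := hφ g
    rw [hg, zero_pow hq0, eq_comm, map_eq_zero_iff _ hinjP] at h2
    ext m
    by_contra hm
    have hm' : m ∈ g.support := by rw [MvPolynomial.mem_support_iff]; exact fun h => hm (by rw [h]; simp)
    have h3 := congrArg (MvPolynomial.coeff m) h2
    rw [MvPolynomial.coeff_sum] at h3
    simp only [MvPolynomial.coeff_monomial, Finset.sum_ite_eq', MvPolynomial.coeff_zero] at h3
    rw [if_pos hm'] at h3
    have h4 := hc0 _ (g.coeff m).2
    rw [h3, map_zero, eq_comm] at h4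
    apply hm
    simpa using pow_eq_zero_iff hq0 |>.1 h4
  let : Algebra B Ω := φ.toAlgebra
  let ψ : P →+* B := MvPolynomial.eval₂Hom (MvPolynomial.C.comp (algebraMap k k')) (fun i => MvPolynomial.X i ^ q)
  let : Algebra P B := ψ.toAlgebra
  have hst : IsScalarTower P B Ω := IsScalarTower.of_algebraMap_eq' (by
    refine MvPolynomial.ringHom_ext (fun c => ?_) (fun i => ?_)
    · rw [← hkP]
      change _ = φ (ψ (MvPolynomial.C c))
      rw [show ψ (MvPolynomial.C c) = MvPolynomial.C (algebraMap k k' c) from MvPolynomial.eval₂Hom_C _ _ _,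
        show φ (MvPolynomial.C (algebraMap k k' c)) = algebraMap k' Ω (algebraMap k k' c) from MvPolynomial.eval₂Hom_C _ _ _]
      exact IsScalarTower.algebraMap_apply k k' Ω c
    · change _ = φ (ψ (MvPolynomial.X i))
      rw [show ψ (MvPolynomial.X i) = MvPolynomial.X i ^ q from MvPolynomial.eval₂Hom_X' _ _ _, map_pow,
        show φ (MvPolynomial.X i) = y i from MvPolynomial.eval₂Hom_X' _ _ _, hy])
  have hfinB : Module.Finite P B := finB (k := k) (k' := k') (σ := σ) hq0
  let E := FractionRing B
  have hfs : FaithfulSMul B Ω := (faithfulSMul_iff_algebraMap_injective B Ω).2 hφi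
  let : Algebra E Ω := FractionRing.liftAlgebra B Ω
  have hstE : IsScalarTower B E Ω := FractionRing.isScalarTower_liftAlgebra B Ω
  refine n2b (P := P) (B := B) (K := K) (E := E) a ?_
  have hU : ∀ u ∈ U, ∃ w : B, φ w ^ q = algebraMap P Ω u := by
    intro u hu
    have h2 : ∀ m, m ∈ u.support → r (algebraMap k Ω (u.coeff m)) ∈ k' := fun m hm =>
      IntermediateField.subset_adjoin _ _ (by
        simp only [T, Finset.coe_biUnion, Set.mem_iUnion, Finset.coe_image]
        exact ⟨u, hu, m, hm, rfl⟩)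
    refine ⟨∑ m ∈ u.support.attach, MvPolynomial.monomial m.1 ⟨_, h2 m.1 m.2⟩, ?_⟩
    conv_rhs => rw [u.as_sum]
    rw [map_sum, map_sum, hq, ← iterateFrobenius_def (R := Ω), map_sum, ← Finset.sum_attach u.support]
    refine Finset.sum_congr rfl fun m _ => ?_
    rw [hmon, iterateFrobenius_def]
    rw [show φ (MvPolynomial.monomial m.1 ⟨_, h2 m.1 m.2⟩) = r (algebraMap k Ω (u.coeff m)) * m.1.prod fun i j => y i ^ j from
      MvPolynomial.eval₂_monomial _ _, mul_pow, ← hq, hr]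
  have hS : ∀ s ∈ S, ∃ w : E, algebraMap E Ω w ^ q = algebraMap K Ω s := by
    intro s hs
    obtain ⟨w1, hw1⟩ := hU _ (Finset.mem_union_left _ (Finset.mem_image_of_mem _ hs))
    obtain ⟨w2, hw2⟩ := hU _ (Finset.mem_union_right _ (Finset.mem_image_of_mem _ hs))
    refine ⟨algebraMap B E w1 / algebraMap B E w2, ?_⟩
    rw [map_div₀, ← IsScalarTower.algebraMap_apply, ← IsScalarTower.algebraMap_apply, div_pow]
    change φ w1 ^ q / φ w2 ^ q = _
    rw [hw1, hw2, IsScalarTower.algebraMap_apply P K Ω, IsScalarTower.algebraMap_apply P K Ω, ← map_div₀]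
    congr 1
    rw [div_eq_iff]
    · exact (IsLocalization.sec_spec (nonZeroDivisors P) s).symm
    · exact IsFractionRing.to_map_ne_zero_of_mem_nonZeroDivisors (IsLocalization.sec (nonZeroDivisors P) s).2.2
  intro x hx
  have hS' : ∀ i, ∃ w : E, algebraMap E Ω w ^ q = algebraMap K Ω ((minpoly K (x ^ q)).coeff i) := by
    intro i
    by_cases hi : (minpoly K (x ^ q)).coeff i = 0
    · exact ⟨0, by rw [hi, map_zero, map_zero, zero_pow hq0]⟩
    · exact hS _ (Finset.mem_biUnion.2 ⟨x, hx, Polynomial.coeff_mem_coeffs hi⟩)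
  choose w hw using hS'
  set f := minpoly K (x ^ q) with hf
  let g : E[X] := ∑ i ∈ Finset.range (f.natDegree + 1), Polynomial.monomial i (w i)
  have hg : (g.map (algebraMap E Ω)).map (iterateFrobenius Ω p e) = f.map (algebraMap K Ω) := by
    conv_rhs => rw [f.as_sum_range]
    simp only [g, Polynomial.map_sum, Polynomial.map_monomial]
    refine Finset.sum_congr rfl fun i _ => ?_
    rw [iterateFrobenius_def, ← hq, hw]
  have hgs : g.Separable := by
    rw [← Polynomial.separable_map (algebraMap E Ω), ← Polynomial.separable_map (iterateFrobenius Ω p e), hg,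
      Polynomial.separable_map]
    exact hsep x hx
  have hgx : Polynomial.aeval x g = 0 := by
    rw [← pow_eq_zero_iff hq0, hq, ← iterateFrobenius_def (R := Ω), Polynomial.aeval_def, ← Polynomial.eval_map,
      ← Polynomial.eval₂_at_apply, ← Polynomial.eval_map, hg, Polynomial.eval_map, iterateFrobenius_def, ← hq]
    exact minpoly.aeval K (x ^ q)
  exact hgs.of_dvd (minpoly.dvd E x hgx)

end NH

end

section
set_option synthInstance.maxHeartbeats 1000000
set_option maxHeartbeats 400000

open IsLocalRing Polynomial Finset

namespace NH
open scoped TensorProduct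

theorem fin_of_reduced {k σ G : Type*} [Field k] [Finite σ] [CommRing G] [Algebra (MvPolynomial σ k) G] [IsReduced G]
    (htf : ∀ (p : MvPolynomial σ k) (g : G), p ≠ 0 → p • g = 0 → g = 0)
    (hIntg : ∀ g : G, IsIntegral (MvPolynomial σ k) g) (b : Finset G)
    (hb : ∀ g : G, ∃ u : MvPolynomial σ k, u ≠ 0 ∧ u • g ∈ Submodule.span (MvPolynomial σ k) (b : Set G)) :
    Module.Finite (MvPolynomial σ k) G := by
  classical
  let P := MvPolynomial σ k
  let K := FractionRing P
  let Ω := AlgebraicClosure K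
  let A := K ⊗[P] G
  let ι : G →ₐ[P] A := Algebra.TensorProduct.includeRight
  have hloc : IsLocalizedModule (nonZeroDivisors P) (TensorProduct.mk P K G 1) := inferInstance
  have hι : ∀ g, ι g = TensorProduct.mk P K G 1 g := fun g => rfl
  have hinj : ∀ g, ι g = 0 → g = 0 := by
    intro g hg
    rw [hι] at hg
    obtain ⟨c, hc⟩ := (IsLocalizedModule.eq_zero_iff (nonZeroDivisors P) _).1 hg
    exact htf c.1 g (nonZeroDivisors.ne_zero c.2) hc
  have htfA : ∀ (p : P) (a : A), p ≠ 0 → p • a = 0 → a = 0 := by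
    intro p a hp ha
    have h1 : algebraMap P K p ≠ 0 := by
      rw [Ne, map_eq_zero_iff _ (IsFractionRing.injective P K)]; exact hp
    have h2 : (algebraMap P K p) • a = 0 := by rw [algebraMap_smul]; exact ha
    rcases smul_eq_zero.1 h2 with h | h
    · exact absurd h h1
    · exact h
  have hsurj : ∀ a : A, ∃ (u : P) (g : G), u ≠ 0 ∧ u • a = ι g := by
    intro a
    obtain ⟨⟨g, u⟩, h⟩ := IsLocalizedModule.surj (nonZeroDivisors P) (TensorProduct.mk P K G 1) a
    exact ⟨u.1, g, nonZeroDivisors.ne_zero u.2, h⟩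
  have hred : IsReduced A := ⟨fun a ⟨n, hn⟩ => by
    obtain ⟨u, g, hu, hg⟩ := hsurj a
    have h1 : ι (g ^ n) = 0 := by rw [map_pow, ← hg, _root_.smul_pow, hn, smul_zero]
    have h2 : g = 0 := by
      have : IsNilpotent g := ⟨n, hinj _ h1⟩
      exact this.eq_zero
    rw [h2, map_zero] at hg
    exact htfA u a hu hg⟩
  have hspan : Submodule.span K ((b.image ι : Finset A) : Set A) = ⊤ := by
    rw [eq_top_iff]
    intro a _
    obtain ⟨u, g, hu, hg⟩ := hsurj a
    obtain ⟨v, hv, hvg⟩ := hb g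
    have h1 : ∀ z ∈ Submodule.span P (b : Set G), ι z ∈ Submodule.span K ((b.image ι : Finset A) : Set A) := by
      intro z hz
      induction hz using Submodule.span_induction with
      | mem x hx => exact Submodule.subset_span (by simpa using ⟨x, hx, rfl⟩)
      | zero => rw [map_zero]; exact zero_mem _
      | add x y _ _ hx hy => rw [map_add]; exact add_mem hx hy
      | smul p x _ hx => rw [map_smul, ← algebraMap_smul K]; exact Submodule.smul_mem _ _ hx
    have h2 := h1 _ hvg
    rw [map_smul, ← hg, smul_smul, ← algebraMap_smul K] at h2
    have h3 : algebraMap P K (v * u) ≠ 0 := by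
      rw [Ne, map_eq_zero_iff _ (IsFractionRing.injective P K)]; exact mul_ne_zero hv hu
    have h4 := Submodule.smul_mem _ (algebraMap P K (v * u))⁻¹ h2
    rwa [smul_smul, inv_mul_cancel₀ h3, one_smul] at h4
  have hfin : Module.Finite K A := ⟨⟨_, hspan⟩⟩
  have hart : IsArtinianRing A := IsArtinianRing.of_finite K A
  have hMfin : Finite (MaximalSpectrum A) := inferInstance
  -- for each maximal ideal
  have key : ∀ I : MaximalSpectrum A, ∃ (φ : G →ₗ[P] Ω) (W : Submodule P Ω), W.FG ∧ (∀ g, φ g ∈ W) ∧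
      ∀ g, φ g = 0 → ι g ∈ I.asIdeal := by
    intro I
    have := I.isMaximal
    let : Field (A ⧸ I.asIdeal) := Ideal.Quotient.field I.asIdeal
    have : FiniteDimensional K (A ⧸ I.asIdeal) := inferInstance
    let θ : (A ⧸ I.asIdeal) →ₐ[K] Ω := IsAlgClosed.lift
    let ψ : A →ₐ[K] Ω := θ.comp (Ideal.Quotient.mkₐ K I.asIdeal)
    let φ : G →ₐ[P] Ω := (ψ.restrictScalars P).comp ι
    obtain ⟨W, hW, hW2⟩ := n2 (k := k) (σ := σ) (K := K) (Ω := Ω) (b.image φ)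
    refine ⟨φ.toLinearMap, W, hW, fun g => hW2 _ ?_ ((hIntg g).map φ), ?_⟩
    · have h1 : ∀ a ∈ Submodule.span K ((b.image ι : Finset A) : Set A),
          ψ a ∈ IntermediateField.adjoin K ((b.image φ : Finset Ω) : Set Ω) := by
        intro a ha
        induction ha using Submodule.span_induction with
        | mem x hx =>
          simp only [Finset.coe_image, Set.mem_image, Finset.mem_coe] at hx
          obtain ⟨y, hy, rfl⟩ := hx
          exact IntermediateField.subset_adjoin _ _ (by simpa using ⟨y, hy, rfl⟩)
        | zero => rw [map_zero]; exact zero_mem _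
        | add x y _ _ hx hy => rw [map_add]; exact add_mem hx hy
        | smul p x _ hx => rw [map_smul]; exact IntermediateField.smul_mem _ hx
      exact h1 (ι g) (by rw [hspan]; trivial)
    · intro g hg
      have : θ (Ideal.Quotient.mk I.asIdeal (ι g)) = 0 := hg
      rw [map_eq_zero_iff θ θ.toRingHom.injective, Ideal.Quotient.eq_zero_iff_mem] at this
      exact this
  choose φ W hW hφW hφ0 using key
  have hWf : ∀ I, Module.Finite P (W I) := fun I => Module.Finite.iff_fg.2 (hW I)
  let Φ : G →ₗ[P] (∀ I, W I) := LinearMap.pi fun I => (φ I).codRestrict (W I) (hφW I)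
  have hΦ : Function.Injective Φ := by
    rw [injective_iff_map_eq_zero]
    intro g hg
    apply hinj
    have h1 : ι g ∈ nilradical A := by
      rw [nilpotent_iff_mem_prime.trans (Iff.refl _) |> fun h => (mem_nilradical.trans h)]
      intro J hJ
      have hJm : J.IsMaximal := Ideal.IsPrime.isMaximal' hJ
      refine hφ0 ⟨J, hJm⟩ g ?_
      have := congrFun hg ⟨J, hJm⟩
      exact congrArg Subtype.val this
    exact (mem_nilradical.1 h1).eq_zero
  have : IsNoetherianRing P := inferInstance
  exact Module.Finite.of_injective Φ hΦ

end NH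

end

section
set_option synthInstance.maxHeartbeats 1000000
set_option maxHeartbeats 400000

open IsLocalRing Polynomial Finset

namespace NH

/-- multiplicative filtration -/
structure MF (R : Type*) [CommRing R] where
  fil : ℕ → Ideal R
  zero' : fil 0 = ⊤
  anti' : ∀ n, fil (n + 1) ≤ fil n
  mul' : ∀ {n m : ℕ} {f g : R}, f ∈ fil n → g ∈ fil m → f * g ∈ fil (n + m)

namespace MF
variable {R : Type*} [CommRing R] (F : MF R)

theorem anti {n m : ℕ} (h : n ≤ m) : F.fil m ≤ F.fil n := antitone_nat_of_succ_le F.anti' h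

/-- the Rees algebra -/
def T : Subring R[X] where
  carrier := {p | ∀ n, p.coeff n ∈ F.fil n}
  mul_mem' := by
    intro p q hp hq n
    rw [Polynomial.coeff_mul]
    refine Ideal.sum_mem _ fun z hz => ?_
    rw [Finset.HasAntidiagonal.mem_antidiagonal] at hz
    rw [← hz]; exact F.mul' (hp _) (hq _)
  one_mem' := by
    intro n
    rw [Polynomial.coeff_one]
    split_ifs with h
    · subst h; rw [F.zero']; trivial
    · exact zero_mem _
  add_mem' := by
    intro p q hp hq n
    rw [Polynomial.coeff_add]; exact add_mem (hp n) (hq n)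
  zero_mem' := by intro n; rw [Polynomial.coeff_zero]; exact zero_mem _
  neg_mem' := by
    intro p hp n
    rw [Polynomial.coeff_neg]; exact neg_mem (hp n)

theorem mem_T {p : R[X]} : p ∈ F.T ↔ ∀ n, p.coeff n ∈ F.fil n := Iff.rfl

/-- the irrelevant ideal -/
def TP : Ideal F.T where
  carrier := {p | ∀ n, p.1.coeff n ∈ F.fil (n + 1)}
  add_mem' := by
    intro p q hp hq n
    change (p.1 + q.1).coeff n ∈ _
    rw [Polynomial.coeff_add]; exact add_mem (hp n) (hq n)
  zero_mem' := by
    intro n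
    change (0 : R[X]).coeff n ∈ _
    rw [Polynomial.coeff_zero]; exact zero_mem _
  smul_mem' := by
    intro p q hq n
    change (p.1 * q.1).coeff n ∈ _
    rw [Polynomial.coeff_mul]
    refine Ideal.sum_mem _ fun z hz => ?_
    rw [Finset.HasAntidiagonal.mem_antidiagonal] at hz
    rw [← hz, add_assoc]; exact F.mul' (p.2 _) (hq _)

theorem mem_TP {p : F.T} : p ∈ F.TP ↔ ∀ n, p.1.coeff n ∈ F.fil (n + 1) := Iff.rfl

/-- the associated graded ring -/
abbrev G := F.T ⧸ F.TP

/-- homogeneous element -/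
noncomputable def hT (n : ℕ) (f : R) (hf : f ∈ F.fil n) : F.T := ⟨Polynomial.monomial n f, fun m => by
  rw [Polynomial.coeff_monomial]
  split_ifs with h
  · exact h ▸ hf
  · exact zero_mem _⟩

noncomputable def hcl (n : ℕ) (f : R) (hf : f ∈ F.fil n) : F.G := Ideal.Quotient.mk F.TP (F.hT n f hf)

theorem hcl_mul {n m : ℕ} {f g : R} (hf : f ∈ F.fil n) (hg : g ∈ F.fil m) :
    F.hcl n f hf * F.hcl m g hg = F.hcl (n + m) (f * g) (F.mul' hf hg) := by
  unfold hcl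
  rw [← map_mul]
  congr 1
  exact Subtype.ext (Polynomial.monomial_mul_monomial _ _ _ _)

theorem hcl_add {n : ℕ} {f g : R} (hf : f ∈ F.fil n) (hg : g ∈ F.fil n) :
    F.hcl n f hf + F.hcl n g hg = F.hcl n (f + g) (add_mem hf hg) := by
  unfold hcl
  rw [← map_add]
  congr 1
  exact Subtype.ext (map_add (Polynomial.monomial n) f g).symm

theorem hcl_zero_iff {n : ℕ} {f : R} (hf : f ∈ F.fil n) : F.hcl n f hf = 0 ↔ f ∈ F.fil (n + 1) := by
  unfold hcl
  rw [Ideal.Quotient.eq_zero_iff_mem, mem_TP]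
  constructor
  · intro h
    have := h n
    rwa [show (F.hT n f hf).1 = Polynomial.monomial n f from rfl, Polynomial.coeff_monomial, if_pos rfl] at this
  · intro h m
    rw [show (F.hT n f hf).1 = Polynomial.monomial n f from rfl, Polynomial.coeff_monomial]
    split_ifs with hm
    · exact hm ▸ h
    · exact zero_mem _

theorem hcl_congr {n m : ℕ} {f g : R} (hf : f ∈ F.fil n) (hg : g ∈ F.fil m) (h1 : n = m) (h2 : f = g) :
    F.hcl n f hf = F.hcl m g hg := by subst h1; subst h2; rfl

theorem fil_pow {n : ℕ} {f : R} (hf : f ∈ F.fil n) (j : ℕ) : f ^ j ∈ F.fil (n * j) := by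
  induction j with
  | zero => rw [mul_zero, F.zero']; trivial
  | succ j ih => rw [pow_succ, mul_add, mul_one]; exact F.mul' ih hf

theorem hcl_one (h : (1 : R) ∈ F.fil 0) : F.hcl 0 1 h = 1 := by
  unfold hcl
  rw [← map_one (Ideal.Quotient.mk F.TP)]
  congr 1

theorem hcl_pow {n : ℕ} {f : R} (hf : f ∈ F.fil n) (j : ℕ) : F.hcl n f hf ^ j = F.hcl (n * j) (f ^ j) (F.fil_pow hf j) := by
  induction j with
  | zero =>
    rw [pow_zero, ← F.hcl_one (by rw [F.zero']; trivial)]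
    exact F.hcl_congr _ _ (by simp) (by simp)
  | succ j ih =>
    rw [pow_succ, ih, hcl_mul]
    exact F.hcl_congr _ _ (by ring) (by ring)

theorem hcl_sum {n : ℕ} {α : Type*} (s : Finset α) (f : α → R) (hf : ∀ i, f i ∈ F.fil n) :
    ∑ i ∈ s, F.hcl n (f i) (hf i) = F.hcl n (∑ i ∈ s, f i) (Ideal.sum_mem _ fun i _ => hf i) := by
  classical
  induction s using Finset.induction_on with
  | empty =>
    rw [Finset.sum_empty, eq_comm, hcl_zero_iff]; exact zero_mem _
  | insert a s ha ih =>
    rw [Finset.sum_insert ha, ih, hcl_add]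
    exact F.hcl_congr _ _ rfl (Finset.sum_insert ha).symm

theorem G_sum (q : F.T) : Ideal.Quotient.mk F.TP q = ∑ n ∈ Finset.range (q.1.natDegree + 1), F.hcl n (q.1.coeff n) (q.2 n) := by
  unfold hcl
  rw [← map_sum]
  congr 1
  apply Subtype.ext
  rw [AddSubmonoidClass.coe_finsetSum]
  exact q.1.as_sum_range

theorem G_ind {p : F.G → Prop} (h0 : p 0) (hadd : ∀ a b, p a → p b → p (a + b))
    (h : ∀ n f hf, p (F.hcl n f hf)) (g : F.G) : p g := by
  obtain ⟨q, rfl⟩ := Ideal.Quotient.mk_surjective g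
  rw [G_sum]
  exact Finset.sum_induction _ p hadd h0 fun n _ => h _ _ _

/-- leading coefficient predicate -/
def LC (q : R[X]) (n : ℕ) (f : R) : Prop := q.coeff n - f ∈ F.fil (n + 1) ∧ ∀ b < n, q.coeff b ∈ F.fil (b + 1)

theorem LC_mul {q q' : R[X]} (hq : q ∈ F.T) (hq' : q' ∈ F.T) {n n' : ℕ} {f f' : R} (h : F.LC q n f) (h' : F.LC q' n' f') :
    F.LC (q * q') (n + n') (f * f') := by
  have aux : ∀ a b, a + b ≤ n + n' → (a, b) ≠ (n, n') → q.coeff a * q'.coeff b ∈ F.fil (a + b + 1) := by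
    intro a b hab hne
    rcases lt_trichotomy a n with h1 | h1 | h1
    · rw [add_right_comm]; exact F.mul' (h.2 a h1) (hq' b)
    · have : b < n' := lt_of_le_of_ne (by omega) fun h2 => hne (by rw [h1, h2])
      rw [add_assoc]; exact F.mul' (hq a) (h'.2 b this)
    · rw [add_assoc]; exact F.mul' (hq a) (h'.2 b (by omega))
  constructor
  · rw [Polynomial.coeff_mul]
    rw [← Finset.add_sum_erase _ _ (show (n, n') ∈ Finset.HasAntidiagonal.antidiagonal (n + n') by
      rw [Finset.HasAntidiagonal.mem_antidiagonal])]
    rw [add_sub_right_comm]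
    refine add_mem ?_ (Ideal.sum_mem _ fun z hz => ?_)
    · have e : q.coeff n * q'.coeff n' - f * f' = (q.coeff n - f) * q'.coeff n' + f * (q'.coeff n' - f') := by ring
      have hf : f ∈ F.fil n := by
        have := sub_mem (hq n) (F.anti' _ h.1)
        rwa [sub_sub_cancel] at this
      change q.coeff n * q'.coeff n' - f * f' ∈ _
      rw [e]
      refine add_mem ?_ ?_
      · rw [add_right_comm]; exact F.mul' h.1 (hq' _)
      · rw [add_assoc]; exact F.mul' hf h'.1
    · rw [Finset.mem_erase, Finset.HasAntidiagonal.mem_antidiagonal] at hz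
      have := aux z.1 z.2 (by omega) hz.1
      rwa [hz.2] at this
  · intro b hb
    rw [Polynomial.coeff_mul]
    refine Ideal.sum_mem _ fun z hz => ?_
    rw [Finset.HasAntidiagonal.mem_antidiagonal] at hz
    have := aux z.1 z.2 (by omega) (by rintro ⟨⟩; omega)
    rwa [hz] at this

theorem LC_pow {q : R[X]} (hq : q ∈ F.T) {n : ℕ} {f : R} (h : F.LC q n f) (s : ℕ) : F.LC (q ^ s) (s * n) (f ^ s) := by
  induction s with
  | zero =>
    rw [zero_mul, pow_zero, pow_zero]
    exact ⟨by simp, by simp⟩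
  | succ s ih =>
    rw [pow_succ, pow_succ, add_mul, one_mul]
    exact F.LC_mul (pow_mem hq s) hq ih h

theorem exists_LC {q : F.T} (h : q ∉ F.TP) : ∃ n, F.LC q.1 n (q.1.coeff n) ∧ q.1.coeff n ∉ F.fil (n + 1) := by
  classical
  have : ∃ n, q.1.coeff n ∉ F.fil (n + 1) := by
    by_contra hcon
    push Not at hcon
    exact h hcon
  refine ⟨Nat.find this, ⟨by simp, fun b hb => ?_⟩, Nat.find_spec this⟩
  have := Nat.find_min this hb
  push Not at this
  exact this

theorem LC_TP {q : F.T} (hq : q ∈ F.TP) {n : ℕ} {f : R} (h : F.LC q.1 n f) : f ∈ F.fil (n + 1) := by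
  have := sub_mem (hq n) h.1
  rwa [sub_sub_cancel] at this

theorem G_reduced (hs : ∀ (f : R) (n j : ℕ), 0 < j → f ^ j ∈ F.fil (j * n + 1) → f ∈ F.fil (n + 1)) : IsReduced F.G := by
  refine ⟨fun g ⟨s, hg⟩ => ?_⟩
  obtain ⟨q, rfl⟩ := Ideal.Quotient.mk_surjective g
  rw [Ideal.Quotient.eq_zero_iff_mem]
  by_contra hq
  obtain ⟨n, hn, hn'⟩ := F.exists_LC hq
  rw [← map_pow, Ideal.Quotient.eq_zero_iff_mem] at hg
  have hg' : q ^ (s + 1) ∈ F.TP := by rw [pow_succ]; exact Ideal.mul_mem_right _ _ hg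
  apply hn'
  refine hs _ _ (s + 1) (by omega) ?_
  refine F.LC_TP hg' ?_
  exact F.LC_pow q.2 hn (s + 1)

end MF

end NH

end

section
set_option synthInstance.maxHeartbeats 1000000
set_option maxHeartbeats 400000

open IsLocalRing Polynomial Finset

namespace NH
namespace MF
section
variable {R ι : Type*} [CommRing R] (F : MF R) {x : ι → R} {D : ℕ} (hxD : ∀ i, x i ∈ F.fil D)

/-- constants -/
noncomputable def CT : R →+* F.T := (Polynomial.C : R →+* R[X]).codRestrict F.T (fun c n => by
  rw [Polynomial.coeff_C]
  split_ifs with h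
  · subst h; rw [F.zero']; trivial
  · exact zero_mem _)

noncomputable def QT : MvPolynomial ι R →+* F.T := MvPolynomial.eval₂Hom F.CT (fun i => F.hT D (x i) (hxD i))

theorem QT_coe (p : MvPolynomial ι R) :
    ((F.QT hxD p : F.T) : R[X]) = MvPolynomial.eval₂Hom (Polynomial.C : R →+* R[X]) (fun i => Polynomial.monomial D (x i)) p := by
  have : F.T.subtype.comp (F.QT hxD) = MvPolynomial.eval₂Hom (Polynomial.C : R →+* R[X]) (fun i => Polynomial.monomial D (x i)) := by
    apply MvPolynomial.ringHom_ext
    · intro r; simp [QT, CT]; rfl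
    · intro i; simp [QT, hT]
  exact RingHom.congr_fun this p

theorem QT_hom {p : MvPolynomial ι R} {j : ℕ} (hp : p.IsHomogeneous j) :
    ((F.QT hxD p : F.T) : R[X]) = Polynomial.monomial (D * j) (MvPolynomial.eval x p) := by
  rw [QT_coe]
  conv_lhs => rw [p.as_sum]
  conv_rhs => rw [p.as_sum]
  rw [map_sum, map_sum, map_sum]
  refine Finset.sum_congr rfl fun m hm => ?_
  have hd : m.degree = j := by
    rw [Finsupp.degree_eq_weight_one]; exact hp (MvPolynomial.mem_support_iff.1 hm)
  rw [MvPolynomial.eval_monomial, MvPolynomial.coe_eval₂Hom, MvPolynomial.eval₂_monomial,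
    ← Polynomial.C_mul_monomial]
  congr 1
  simp only [Polynomial.monomial_pow, Finsupp.prod]
  rw [← hd, Finsupp.degree_apply, Finset.mul_sum]
  classical
  generalize m.support = s
  induction s using Finset.induction_on with
  | empty => simp
  | insert a s ha ih =>
    rw [Finset.prod_insert ha, Finset.prod_insert ha, Finset.sum_insert ha, ih, Polynomial.monomial_mul_monomial]

theorem QT_coeff (hD : 0 < D) (p : MvPolynomial ι R) (j : ℕ) :
    ((F.QT hxD p : F.T) : R[X]).coeff (D * j) = MvPolynomial.eval x (MvPolynomial.homogeneousComponent j p) := by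
  conv_lhs => rw [← MvPolynomial.sum_homogeneousComponent p]
  rw [map_sum, AddSubmonoidClass.coe_finsetSum, Polynomial.finsetSum_coeff]
  have : ∀ i, ((F.QT hxD (MvPolynomial.homogeneousComponent i p) : F.T) : R[X]).coeff (D * j) =
      if i = j then MvPolynomial.eval x (MvPolynomial.homogeneousComponent j p) else 0 := by
    intro i
    rw [F.QT_hom hxD (MvPolynomial.homogeneousComponent_isHomogeneous i p), Polynomial.coeff_monomial]
    by_cases h : i = j
    · subst h; simp
    · rw [if_neg h, if_neg]
      intro h'; exact h (Nat.eq_of_mul_eq_mul_left hD h')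
  simp only [this]
  rw [Finset.sum_ite_eq']
  split_ifs with h
  · rfl
  · rw [Finset.mem_range, not_lt] at h
    rw [MvPolynomial.homogeneousComponent_eq_zero _ _ (by omega), map_zero]

theorem QT_coeff_nd (p : MvPolynomial ι R) (a : ℕ) (h : ¬ D ∣ a) :
    ((F.QT hxD p : F.T) : R[X]).coeff a = 0 := by
  conv_lhs => rw [← MvPolynomial.sum_homogeneousComponent p]
  rw [map_sum, AddSubmonoidClass.coe_finsetSum, Polynomial.finsetSum_coeff]
  refine Finset.sum_eq_zero fun i _ => ?_
  rw [F.QT_hom hxD (MvPolynomial.homogeneousComponent_isHomogeneous i p), Polynomial.coeff_monomial, if_neg]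
  rintro rfl; exact h ⟨i, rfl⟩

theorem QT_coeff_mem (hD : 0 < D) (p : MvPolynomial ι R) {a j : ℕ} (h : D * j ≤ a) :
    ((F.QT hxD p : F.T) : R[X]).coeff a ∈ sp x ^ j := by
  by_cases hd : D ∣ a
  · obtain ⟨b, rfl⟩ := hd
    rw [QT_coeff _ _ hD]
    have hb : j ≤ b := Nat.le_of_mul_le_mul_left h hD
    exact Ideal.pow_le_pow_right hb (eval_mem_pow x (MvPolynomial.homogeneousComponent_isHomogeneous b p))
  · rw [QT_coeff_nd _ _ _ _ hd]; exact zero_mem _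
end

section
variable {R ι : Type*} [CommRing R] [IsLocalRing R] (F : MF R) {x : ι → R} {D : ℕ} (hxD : ∀ i, x i ∈ F.fil D)
  (hm : maximalIdeal R ≤ F.fil 1)

noncomputable def kap : ResidueField R →+* F.G :=
  Ideal.Quotient.lift (maximalIdeal R) ((Ideal.Quotient.mk F.TP).comp F.CT) (by
    intro a ha
    rw [RingHom.comp_apply, Ideal.Quotient.eq_zero_iff_mem, mem_TP]
    intro n
    change (Polynomial.C a).coeff n ∈ _
    rw [Polynomial.coeff_C]
    split_ifs with h
    · subst h; exact hm ha
    · exact zero_mem _)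

noncomputable def phi : MvPolynomial ι (ResidueField R) →+* F.G :=
  MvPolynomial.eval₂Hom (F.kap hm) (fun i => F.hcl D (x i) (hxD i))

theorem phi_map (p : MvPolynomial ι R) :
    F.phi hxD hm (MvPolynomial.map (residue R) p) = Ideal.Quotient.mk F.TP (F.QT hxD p) := by
  have : (F.phi hxD hm).comp (MvPolynomial.map (residue R)) = (Ideal.Quotient.mk F.TP).comp (F.QT hxD) := by
    apply MvPolynomial.ringHom_ext
    · intro r
      simp only [RingHom.comp_apply, MvPolynomial.map_C, phi, QT, MvPolynomial.eval₂Hom_C]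
      exact Ideal.Quotient.lift_mk _ _ _
    · intro i; simp [phi, QT, hcl]
  exact RingHom.congr_fun this p

theorem phi_hom (p : MvPolynomial ι R) {j : ℕ} (hp : p.IsHomogeneous j) (h : MvPolynomial.eval x p ∈ F.fil (D * j)) :
    F.phi hxD hm (MvPolynomial.map (residue R) p) = F.hcl (D * j) (MvPolynomial.eval x p) h := by
  rw [phi_map]
  unfold hcl
  congr 1
  exact Subtype.ext (F.QT_hom hxD hp)

end
end MF
end NH

end

section
set_option synthInstance.maxHeartbeats 1000000
set_option maxHeartbeats 400000

open IsLocalRing Polynomial Finset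

namespace NH

/-- the filtration FD as an MF -/
def FM {R ι : Type*} [CommRing R] [IsNoetherianRing R] (x : ι → R) (D : ℕ) (hD : 0 < D) : MF R where
  fil := FD x D hD
  zero' := FD_zero
  anti' := fun n => FD_anti (Nat.le_succ n)
  mul' := fun hf hg => FD_mul hf hg

section
variable {R ι : Type*} [CommRing R] [IsLocalRing R] [IsNoetherianRing R] {x : ι → R} {D : ℕ} {hD : 0 < D}

theorem FM_xD (i : ι) : x i ∈ (FM x D hD).fil D := by
  change x i ∈ FD x D hD D
  have : x i ∈ FD x D hD (D * 1) := by
    rw [FD_D]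
    refine pow_le_NF 1 ?_
    rw [pow_one]; exact Ideal.subset_span ⟨i, rfl⟩
  rwa [mul_one] at this

theorem FM_pow (j : ℕ) : sp x ^ j ≤ (FM x D hD).fil (D * j) := by
  change _ ≤ FD x D hD (D * j)
  rw [FD_D]; exact pow_le_NF j

theorem FM_m (hF1 : NF x 1 = maximalIdeal R) : maximalIdeal R ≤ (FM x D hD).fil 1 := by
  intro a ha
  change a ∈ FD x D hD 1
  rw [mem_FD, hF1]
  exact Ideal.pow_mem_of_mem _ ha _ hD

theorem FM_tf [LinearOrder ι] (hx : QR x) {N : ℕ} (hN : maximalIdeal R ^ N ≤ sp x) (hF1 : NF x 1 = maximalIdeal R)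
    (p : MvPolynomial ι (ResidueField R)) (g : (FM x D hD).G) (hp : p ≠ 0)
    (h : (FM x D hD).phi FM_xD (FM_m hF1) p * g = 0) : g = 0 := by
  obtain ⟨p', rfl⟩ := MvPolynomial.map_surjective (residue R) (residue_surjective) p
  obtain ⟨q, rfl⟩ := Ideal.Quotient.mk_surjective g
  rw [Ideal.Quotient.eq_zero_iff_mem]
  by_contra hq
  obtain ⟨n, hn, hn'⟩ := MF.exists_LC _ hq
  rw [MF.phi_map, ← map_mul, Ideal.Quotient.eq_zero_iff_mem] at h
  have hex : ∃ j, MvPolynomial.map (residue R) (MvPolynomial.homogeneousComponent j p') ≠ 0 := by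
    by_contra hcon
    push Not at hcon
    apply hp
    rw [← MvPolynomial.sum_homogeneousComponent p', map_sum]
    exact Finset.sum_eq_zero fun i _ => hcon i
  classical
  set j := Nat.find hex with hj
  have hj1 := Nat.find_spec hex
  have hlc : (FM x D hD).LC ((FM x D hD).QT FM_xD p' : (FM x D hD).T).1 (D * j)
      (MvPolynomial.eval x (MvPolynomial.homogeneousComponent j p')) := by
    refine ⟨?_, fun b hb => ?_⟩
    · rw [MF.QT_coeff _ _ hD, sub_self]; exact zero_mem _
    · by_cases hdb : D ∣ b
      · obtain ⟨i, rfl⟩ := hdb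
        have hi : i < j := Nat.lt_of_mul_lt_mul_left hb
        have := Nat.find_min hex hi
        push Not at this
        rw [MF.QT_coeff _ _ hD]
        have h2 : MvPolynomial.eval x (MvPolynomial.homogeneousComponent i p') ∈ maximalIdeal R * sp x ^ i := by
          refine eval_mem_mul x (MvPolynomial.homogeneousComponent_isHomogeneous i p') _ fun m => ?_
          have := congrArg (MvPolynomial.coeff m) this
          rw [MvPolynomial.coeff_map, MvPolynomial.coeff_zero] at this
          rwa [residue_eq_zero_iff] at this
        refine (Ideal.mul_le.2 fun r hr s hs => ?_ : maximalIdeal R * sp x ^ i ≤ _) h2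
        rw [add_comm]
        exact MF.mul' _ (FM_m hF1 hr) (FM_pow i hs)
      · rw [MF.QT_coeff_nd _ _ _ _ hdb]; exact zero_mem _
  have h3 := MF.LC_TP _ h (MF.LC_mul _ ((FM x D hD).QT FM_xD p').2 q.2 hlc hn)
  apply hn'
  change _ ∈ FD x D hD (n + 1)
  refine FD_cancel hx hN (MvPolynomial.homogeneousComponent_isHomogeneous j p') ((unit_coeff_iff _).2 hj1) ?_
  refine FD_anti ?_ h3
  omega

theorem FM_int (hF1 : NF x 1 = maximalIdeal R) (g : (FM x D hD).G) :
    ((FM x D hD).phi FM_xD (FM_m hF1)).IsIntegralElem g := by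
  refine MF.G_ind _ ?_ ?_ ?_ g
  · exact RingHom.isIntegralElem_zero _
  · intro a b ha hb; exact RingHom.IsIntegralElem.add _ ha hb
  intro n f hf
  suffices hsuf : ((FM x D hD).phi FM_xD (FM_m hF1)).IsIntegralElem ((FM x D hD).hcl n f hf ^ D) by
    algebraize [(FM x D hD).phi FM_xD (FM_m hF1)]
    exact IsIntegral.of_pow hD hsuf
  have h1 : f ^ D ∈ NF x n := hf
  rw [mem_NF] at h1
  obtain ⟨s, hs, a, ha, he⟩ := h1.to_integral
  set y := f ^ D with hy
  have hyF : y ∈ (FM x D hD).fil (n * D) := MF.fil_pow _ hf D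
  have hform : ∀ i, ∃ p : MvPolynomial ι R, p.IsHomogeneous (n * i) ∧ (i ∈ Finset.Icc 1 s → MvPolynomial.eval x p = a i) := by
    intro i
    by_cases hi : i ∈ Finset.Icc 1 s
    · have := ha i hi
      rw [← pow_mul, mem_form] at this
      obtain ⟨p, hp, he⟩ := this
      exact ⟨p, hp, fun _ => he⟩
    · exact ⟨0, MvPolynomial.isHomogeneous_zero _ _ _, fun h => absurd h hi⟩
  choose p hp hpe using hform
  have hyp : ∀ t, y ^ t ∈ (FM x D hD).fil (n * D * t) := fun t => MF.fil_pow _ hyF t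
  refine ⟨Polynomial.X ^ s + ∑ i ∈ Finset.Icc 1 s, Polynomial.C (MvPolynomial.map (residue R) (p i)) * Polynomial.X ^ (s - i), ?_, ?_⟩
  · refine Polynomial.monic_X_pow_add ?_
    refine lt_of_le_of_lt (Polynomial.degree_sum_le _ _) ?_
    rw [Finset.sup_lt_iff (by exact_mod_cast WithBot.bot_lt_coe s)]
    intro i hi
    rw [Finset.mem_Icc] at hi
    refine lt_of_le_of_lt (Polynomial.degree_C_mul_X_pow_le _ _) ?_
    exact_mod_cast (by omega : s - i < s)
  · rw [Polynomial.eval₂_add, Polynomial.eval₂_finsetSum, Polynomial.eval₂_X_pow]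
    simp only [Polynomial.eval₂_mul, Polynomial.eval₂_C, Polynomial.eval₂_X_pow]
    rw [MF.hcl_pow]
    have e1 : ∀ i ∈ Finset.Icc 1 s, (FM x D hD).phi FM_xD (FM_m hF1) (MvPolynomial.map (residue R) (p i)) *
        (FM x D hD).hcl (n * D) (f ^ D) hyF ^ (s - i) =
        Ideal.Quotient.mk _ ((FM x D hD).QT FM_xD (p i) * (FM x D hD).hT (n * D * (s - i)) (y ^ (s - i)) (hyp _)) := by
      intro i hi
      rw [MF.phi_map, MF.hcl_pow, MF.hcl, ← map_mul]
    rw [Finset.sum_congr rfl e1, MF.hcl_pow, MF.hcl, ← map_sum, ← map_add]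
    refine (congrArg (Ideal.Quotient.mk _) ?_).trans (map_zero _)
    apply Subtype.ext
    change Polynomial.monomial (n * D * s) (y ^ s) + _ = (0 : R[X])
    rw [AddSubmonoidClass.coe_finsetSum]
    have e2 : ∀ i ∈ Finset.Icc 1 s, (((FM x D hD).QT FM_xD (p i) * (FM x D hD).hT (n * D * (s - i)) (y ^ (s - i)) (hyp _) : (FM x D hD).T) : R[X]) = Polynomial.monomial (n * D * s) (a i * y ^ (s - i)) := by
      intro i hi
      change ((FM x D hD).QT FM_xD (p i) : R[X]) * Polynomial.monomial (n * D * (s - i)) (y ^ (s - i)) = _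
      rw [MF.QT_hom _ _ (hp i), hpe i hi, Polynomial.monomial_mul_monomial]
      rw [Finset.mem_Icc] at hi
      have e3 : D * (n * i) + n * D * (s - i) = n * D * s := by
        obtain ⟨t, rfl⟩ := Nat.exists_eq_add_of_le hi.2
        rw [Nat.add_sub_cancel_left]; ring
      rw [e3]
    rw [Finset.sum_congr rfl e2, ← map_sum, ← map_add, he, map_zero]
end
end NH

end

section
set_option synthInstance.maxHeartbeats 1000000
set_option maxHeartbeats 400000

open IsLocalRing Polynomial Finset

namespace NH

section
variable {R : Type*} [CommRing R] [IsLocalRing R] [IsNoetherianRing R] {d : ℕ} {x : Fin (d + 1) → R} {D : ℕ} {hD : 0 < D}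

theorem FM_rank (hx : QR x) {e0 : ℕ} (he0 : rl (sp x) ⊤ = e0) (hF1 : NF x 1 = maximalIdeal R)
    {θ : ℕ} (hθ : θ < D) {q : ℕ} (m : Fin q → ℕ) (f : Fin q → R) (hf : ∀ i, f i ∈ (FM x D hD).fil (D * m i + θ))
    (hli : ∀ c : Fin q → MvPolynomial (Fin (d + 1)) (ResidueField R),
      ∑ i, (FM x D hD).phi FM_xD (FM_m hF1) (c i) * (FM x D hD).hcl _ (f i) (hf i) = 0 → ∀ i, c i = 0) : q ≤ e0 := by
  obtain ⟨n0, hn0⟩ : ∃ n0, ∀ i, m i ≤ n0 := ⟨∑ i, m i, fun i => Finset.single_le_sum (f := m) (fun _ _ => Nat.zero_le _) (Finset.mem_univ i)⟩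
  refine lemC2 hx he0 (fun k => FD x D hD (D * k + θ)) (fun k => FD_anti (by rw [Nat.mul_succ]; omega)) (fun k => ?_) n0 fun n => ?_
  · refine (FM_pow (hD := hD) (k + 1)).trans (FD_anti ?_)
    rw [Nat.mul_succ]; omega
  have hx0 : ∀ i, x 0 ^ (n0 - m i) ∈ sp x ^ (n0 - m i) := fun i =>
    Ideal.pow_mem_pow (show x 0 ∈ sp x from Ideal.subset_span ⟨0, rfl⟩) _
  have hmem : ∀ i, ∀ y ∈ sp x ^ n, y * (x 0 ^ (n0 - m i) * f i) ∈ FD x D hD (D * (n0 + n) + θ) := by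
    intro i y hy
    have h1 := FD_mul (hD := hD) (FM_pow (hD := hD) n hy) (FD_mul (hD := hD) (FM_pow (hD := hD) _ (hx0 i)) (hf i))
    refine FD_anti (le_of_eq ?_) h1
    have := hn0 i
    obtain ⟨t, ht⟩ := Nat.exists_eq_add_of_le this
    rw [ht, Nat.add_sub_cancel_left]; ring
  refine lemC1 x (fun i => x 0 ^ (n0 - m i) * f i) n _ _ hmem ?_
  intro p hp hs i b
  have h2 := hli (fun i => MvPolynomial.map (residue R) (p i * MvPolynomial.X 0 ^ (n0 - m i))) ?_ i
  · rw [map_mul, map_pow, MvPolynomial.map_X, mul_eq_zero] at h2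
    rcases h2 with h2 | h2
    · have := congrArg (MvPolynomial.coeff b) h2
      rwa [MvPolynomial.coeff_map, MvPolynomial.coeff_zero, residue_eq_zero_iff] at this
    · exact absurd h2 (pow_ne_zero _ (MvPolynomial.X_ne_zero 0))
  · have hh : ∀ i, (p i * MvPolynomial.X 0 ^ (n0 - m i)).IsHomogeneous (n + (n0 - m i)) := by
      intro i
      refine (hp i).mul ?_
      have := (MvPolynomial.isHomogeneous_X R (0 : Fin (d + 1))).pow (n0 - m i)
      rwa [one_mul] at this
    have e1 : ∀ i, (FM x D hD).phi FM_xD (FM_m hF1) (MvPolynomial.map (residue R) (p i * MvPolynomial.X 0 ^ (n0 - m i))) *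
        (FM x D hD).hcl _ (f i) (hf i) = (FM x D hD).hcl (D * (n0 + n) + θ) (MvPolynomial.eval x (p i) * (x 0 ^ (n0 - m i) * f i))
          (hmem i _ (eval_mem_pow x (hp i))) := by
      intro i
      rw [MF.phi_hom _ _ _ _ (hh i) (FM_pow _ (eval_mem_pow x (hh i))), MF.hcl_mul]
      refine MF.hcl_congr _ _ _ ?_ ?_
      · obtain ⟨t, ht⟩ := Nat.exists_eq_add_of_le (hn0 i)
        rw [ht, Nat.add_sub_cancel_left]; ring
      · rw [map_mul, map_pow, MvPolynomial.eval_X]; ring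
    rw [Finset.sum_congr rfl fun i _ => e1 i, MF.hcl_sum _ _ _ (fun i => hmem i _ (eval_mem_pow x (hp i))), MF.hcl_zero_iff]
    refine FD_anti ?_ hs
    have : D * (n0 + n + 1) = D * (n0 + n) + D := by ring
    omega

theorem FM_finite (hx : QR x) {N : ℕ} (hN : maximalIdeal R ^ N ≤ sp x) (hF1 : NF x 1 = maximalIdeal R)
    (hs : ∀ (f : R) (n j : ℕ), 0 < j → f ^ j ∈ FD x D hD (j * n + 1) → f ∈ FD x D hD (n + 1)) :
    ((FM x D hD).phi FM_xD (FM_m hF1)).Finite := by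
  classical
  obtain ⟨e0, he0⟩ := ENat.ne_top_iff_exists.1 (rl_ne_top_of_pow_le hN ⊤)
  have hred : IsReduced (FM x D hD).G := MF.G_reduced _ hs
  algebraize [(FM x D hD).phi FM_xD (FM_m hF1)]
  have hb : ∀ θ < D, ∃ b : Finset (FM x D hD).G, ∀ m f (hf : f ∈ (FM x D hD).fil (D * m + θ)),
      ∃ u : MvPolynomial (Fin (d + 1)) (ResidueField R), u ≠ 0 ∧
        u • (FM x D hD).hcl _ f hf ∈ Submodule.span (MvPolynomial (Fin (d + 1)) (ResidueField R)) (b : Set (FM x D hD).G) := by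
    intro θ hθ
    let Pq : ℕ → Prop := fun q => ∃ (m : Fin q → ℕ) (f : Fin q → R) (hf : ∀ i, f i ∈ (FM x D hD).fil (D * m i + θ)),
      ∀ c : Fin q → MvPolynomial (Fin (d + 1)) (ResidueField R),
      ∑ i, (FM x D hD).phi FM_xD (FM_m hF1) (c i) * (FM x D hD).hcl _ (f i) (hf i) = 0 → ∀ i, c i = 0
    have h0 : Pq 0 := ⟨Fin.elim0, Fin.elim0, fun i => i.elim0, fun c _ i => i.elim0⟩
    have hbd : ∀ q, Pq q → q ≤ e0 := fun q ⟨m, f, hf, h⟩ => FM_rank hx he0.symm hF1 hθ m f hf h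
    obtain ⟨q, hq, hmax⟩ : ∃ q, Pq q ∧ ¬ Pq (q + 1) := by
      by_contra hcon
      push Not at hcon
      have : ∀ q, Pq q := fun q => by
        induction q with
        | zero => exact h0
        | succ q ih => exact hcon q ih
      have := hbd _ (this (e0 + 1))
      omega
    obtain ⟨m, f, hf, hli⟩ := hq
    refine ⟨Finset.univ.image fun i => (FM x D hD).hcl _ (f i) (hf i), fun m' f' hf' => ?_⟩
    by_contra hcon
    push Not at hcon
    apply hmax
    have hF : ∀ i, (Fin.cons f' f : Fin (q + 1) → R) i ∈ (FM x D hD).fil (D * (Fin.cons m' m : Fin (q + 1) → ℕ) i + θ) := by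
      intro i
      refine Fin.cases ?_ (fun i => ?_) i
      · exact hf'
      · exact hf i
    refine ⟨Fin.cons m' m, Fin.cons f' f, hF, fun c hc => ?_⟩
    rw [Fin.sum_univ_succ] at hc
    have hc0 : c 0 = 0 := by
      by_contra hne
      apply hcon _ hne
      have e : c 0 • (FM x D hD).hcl _ f' hf' = - ∑ i : Fin q, c i.succ • (FM x D hD).hcl _ (f i) (hf i) := eq_neg_of_add_eq_zero_left hc
      rw [e]
      refine neg_mem (Submodule.sum_mem _ fun i _ => Submodule.smul_mem _ _ (Submodule.subset_span ?_))
      simp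
    have hc1 : ∑ i : Fin q, (FM x D hD).phi FM_xD (FM_m hF1) (c i.succ) * (FM x D hD).hcl _ (f i) (hf i) = 0 := by
      rw [hc0, map_zero, zero_mul, zero_add] at hc
      exact hc
    intro i
    refine Fin.cases hc0 (fun i => ?_) i
    exact hli _ hc1 i
  choose! b hb using hb
  let B : Finset (FM x D hD).G := (Finset.range D).biUnion b
  change Module.Finite _ _
  refine fin_of_reduced (fun p g hp h => FM_tf hx hN hF1 p g hp h) (fun g => FM_int hF1 g) B ?_
  refine MF.G_ind _ ⟨1, one_ne_zero, by rw [smul_zero]; exact zero_mem _⟩ ?_ ?_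
  · rintro a a' ⟨u, hu, h⟩ ⟨u', hu', h'⟩
    refine ⟨u * u', mul_ne_zero hu hu', ?_⟩
    rw [smul_add]
    refine add_mem ?_ ?_
    · rw [mul_comm, mul_smul]; exact Submodule.smul_mem _ _ h
    · rw [mul_smul]; exact Submodule.smul_mem _ _ h'
  · intro n f hf
    have hlt := Nat.mod_lt n hD
    have hf' : f ∈ (FM x D hD).fil (D * (n / D) + n % D) := by rwa [Nat.div_add_mod]
    obtain ⟨u, hu, h⟩ := hb (n % D) hlt (n / D) f hf'
    refine ⟨u, hu, ?_⟩
    rw [MF.hcl_congr _ hf hf' (Nat.div_add_mod n D).symm rfl]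
    refine Submodule.span_mono ?_ h
    intro z hz
    exact Finset.mem_coe.2 (Finset.mem_biUnion.2 ⟨_, Finset.mem_range.2 hlt, hz⟩)

theorem FM_gens (hF1 : NF x 1 = maximalIdeal R) (hfin : ((FM x D hD).phi FM_xD (FM_m hF1)).Finite) :
    ∃ c0, ∀ n j, D * j + c0 ≤ n → FD x D hD n ≤ sp x ^ j ⊔ FD x D hD (n + 1) := by
  classical
  algebraize [(FM x D hD).phi FM_xD (FM_m hF1)]
  have hfin' : Module.Finite (MvPolynomial (Fin (d + 1)) (ResidueField R)) (FM x D hD).G := hfin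
  obtain ⟨S, hS⟩ := hfin'.fg_top
  have hlift : ∀ g : (FM x D hD).G, ∃ q : (FM x D hD).T, Ideal.Quotient.mk _ q = g := Ideal.Quotient.mk_surjective
  choose L hL using hlift
  refine ⟨∑ g ∈ S, (L g).1.natDegree, fun n j hn f hf => ?_⟩
  have h1 : (FM x D hD).hcl n f hf ∈ Submodule.span (MvPolynomial (Fin (d + 1)) (ResidueField R)) (S : Set (FM x D hD).G) := by
    rw [hS]; trivial
  rw [Submodule.mem_span_finset] at h1
  obtain ⟨p, -, hp⟩ := h1
  have hpl : ∀ g, ∃ p' : MvPolynomial (Fin (d + 1)) R, MvPolynomial.map (residue R) p' = p g := fun g =>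
    MvPolynomial.map_surjective (residue R) residue_surjective (p g)
  choose p' hp' using hpl
  have h2 : (FM x D hD).hT n f hf - ∑ g ∈ S, (FM x D hD).QT FM_xD (p' g) * L g ∈ (FM x D hD).TP := by
    rw [← Ideal.Quotient.eq_zero_iff_mem, map_sub, sub_eq_zero]
    change (FM x D hD).hcl n f hf = _
    rw [← hp, map_sum]
    refine Finset.sum_congr rfl fun g _ => ?_
    rw [map_mul, hL, ← MF.phi_map _ FM_xD (FM_m hF1), hp']; rfl
  have h3 := h2 n
  change (Polynomial.monomial n f - ((∑ g ∈ S, (FM x D hD).QT FM_xD (p' g) * L g : (FM x D hD).T) : R[X])).coeff n ∈ FD x D hD (n + 1) at h3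
  rw [Polynomial.coeff_sub, Polynomial.coeff_monomial, if_pos rfl, AddSubmonoidClass.coe_finsetSum, Polynomial.finsetSum_coeff] at h3
  have h4 : ∑ g ∈ S, (((FM x D hD).QT FM_xD (p' g) * L g : (FM x D hD).T) : R[X]).coeff n ∈ sp x ^ j := by
    refine Ideal.sum_mem _ fun g hg => ?_
    change (((FM x D hD).QT FM_xD (p' g) : R[X]) * (L g : R[X])).coeff n ∈ _
    rw [Polynomial.coeff_mul]
    refine Ideal.sum_mem _ fun z hz => ?_
    rw [Finset.HasAntidiagonal.mem_antidiagonal] at hz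
    by_cases hz2 : z.2 ≤ (L g).1.natDegree
    · have h5 : (L g).1.natDegree ≤ ∑ g ∈ S, (L g).1.natDegree := Finset.single_le_sum (f := fun g => (L g).1.natDegree) (fun _ _ => Nat.zero_le _) hg
      exact Ideal.mul_mem_right _ _ (MF.QT_coeff_mem _ _ hD _ (by omega))
    · rw [Polynomial.coeff_eq_zero_of_natDegree_lt (not_le.1 hz2), mul_zero]; exact zero_mem _
  have h6 := add_mem (Ideal.mem_sup_left h4 : _ ∈ sp x ^ j ⊔ FD x D hD (n + 1)) (Ideal.mem_sup_right h3)
  rwa [add_sub_cancel] at h6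

end

/-- Rees' theorem up to Chevalley -/
theorem rees_pre {R : Type*} [CommRing R] [IsLocalRing R] [IsNoetherianRing R] {d : ℕ} {x : Fin (d + 1) → R}
    (hx : QR x) {N : ℕ} (hN : maximalIdeal R ^ N ≤ sp x) (hF1 : NF x 1 = maximalIdeal R) :
    ∃ c, ∀ j N', NF x (j + c) ≤ sp x ^ j ⊔ NF x N' := by
  obtain ⟨D, hD, hs⟩ := strict hx hN hF1
  obtain ⟨c0, hc⟩ := FM_gens hF1 (FM_finite hx hN hF1 hs)
  refine ⟨c0, fun j N' => ?_⟩
  have key : ∀ n k, D * j + c0 ≤ n → FD x D hD n ≤ sp x ^ j ⊔ FD x D hD (n + k) := by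
    intro n k hn
    induction k with
    | zero => exact le_sup_right
    | succ k ih =>
      refine ih.trans (sup_le le_sup_left ?_)
      exact hc (n + k) j (by omega)
  rw [← FD_D (x := x) (hD := hD), ← FD_D (x := x) (hD := hD)]
  refine (key _ (D * N') ?_).trans (sup_le_sup_left (FD_anti (by omega)) _)
  rw [mul_add]
  have : 1 * c0 ≤ D * c0 := Nat.mul_le_mul_right _ hD
  omega

end NH

end

section
set_option synthInstance.maxHeartbeats 1000000
set_option maxHeartbeats 400000

open IsLocalRing Polynomial Finset

namespace NH

theorem noeth_compl {R B : Type*} [CommRing R] [IsNoetherianRing R] [CommRing B] (φ : R →+* B) (I : Ideal R)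
    (𝔫 : Ideal B) (h𝔫 : 𝔫 = I.map φ) [IsAdicComplete 𝔫 B] (hs : ∀ b : B, ∃ r : R, b - φ r ∈ 𝔫) : IsNoetherianRing B := by
  classical
  have hφ : ∀ {n : ℕ} {r : R}, r ∈ I ^ n → φ r ∈ 𝔫 ^ n := by
    intro n r hr
    rw [h𝔫, ← Ideal.map_pow]; exact Ideal.mem_map_of_mem _ hr
  have happ : ∀ (n : ℕ) (b : B), b ∈ 𝔫 ^ n → ∃ r ∈ I ^ n, b - φ r ∈ 𝔫 ^ (n + 1) := by
    intro n b hb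
    rw [h𝔫, ← Ideal.map_pow, Ideal.map] at hb
    induction hb using Submodule.span_induction with
    | mem b hb =>
      obtain ⟨r, hr, rfl⟩ := hb
      exact ⟨r, hr, by rw [sub_self]; exact zero_mem _⟩
    | zero => exact ⟨0, zero_mem _, by rw [map_zero, sub_self]; exact zero_mem _⟩
    | add b b' _ _ h h' =>
      obtain ⟨r, hr, h⟩ := h
      obtain ⟨r', hr', h'⟩ := h'
      refine ⟨r + r', add_mem hr hr', ?_⟩
      rw [map_add, add_sub_add_comm]; exact add_mem h h'
    | smul c b _ h =>
      obtain ⟨r, hr, h⟩ := h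
      obtain ⟨s, hs⟩ := hs c
      refine ⟨s * r, Ideal.mul_mem_left _ _ hr, ?_⟩
      rw [map_mul, smul_eq_mul, show c * b - φ s * φ r = c * (b - φ r) + (c - φ s) * φ r by ring]
      refine add_mem (Ideal.mul_mem_left _ _ h) ?_
      rw [pow_succ']; exact Ideal.mul_mem_mul hs (hφ hr)
  refine (isNoetherianRing_iff_ideal_fg B).2 fun 𝔞 => ?_
  let L : Ideal (reesAlgebra I) :=
    { carrier := {p | ∀ n, φ (p.1.coeff n) ∈ 𝔞 ⊔ 𝔫 ^ (n + 1)}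
      add_mem' := by
        intro p q hp hq n
        change φ ((p.1 + q.1).coeff n) ∈ _
        rw [Polynomial.coeff_add, map_add]; exact add_mem (hp n) (hq n)
      zero_mem' := by
        intro n
        change φ ((0 : R[X]).coeff n) ∈ _
        rw [Polynomial.coeff_zero, map_zero]; exact zero_mem _
      smul_mem' := by
        intro p q hq n
        change φ ((p.1 * q.1).coeff n) ∈ _
        rw [Polynomial.coeff_mul, map_sum]
        refine Ideal.sum_mem _ fun z hz => ?_
        rw [Finset.HasAntidiagonal.mem_antidiagonal] at hz
        rw [map_mul]
        obtain ⟨u, hu, v, hv, huv⟩ := Submodule.mem_sup.1 (hq z.2)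
        rw [← huv, mul_add]
        refine Submodule.add_mem_sup (Ideal.mul_mem_left _ _ hu) ?_
        rw [← hz, add_assoc, pow_add]
        exact Ideal.mul_mem_mul (hφ ((mem_reesAlgebra_iff _ _).1 p.2 z.1)) hv }
  have hL : ∀ p, p ∈ L ↔ ∀ n, φ (p.1.coeff n) ∈ 𝔞 ⊔ 𝔫 ^ (n + 1) := fun p => Iff.rfl
  obtain ⟨S, hS⟩ := (isNoetherianRing_iff_ideal_fg (reesAlgebra I)).1 inferInstance L
  have hα : ∀ p : reesAlgebra I, ∀ j : ℕ, ∃ α ∈ 𝔞, p ∈ S → φ (p.1.coeff j) - α ∈ 𝔫 ^ (j + 1) := by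
    intro p j
    by_cases hp : p ∈ S
    · have : p ∈ L := by rw [← hS]; exact Ideal.subset_span hp
      obtain ⟨u, hu, v, hv, huv⟩ := Submodule.mem_sup.1 (this j)
      exact ⟨u, hu, fun _ => by rw [← huv, add_sub_cancel_left]; exact hv⟩
    · exact ⟨0, zero_mem _, fun h => absurd h hp⟩
  choose α hα1 hα2 using hα
  obtain ⟨D0, hD0⟩ : ∃ D0, ∀ p ∈ S, p.1.natDegree < D0 := ⟨∑ p ∈ S, p.1.natDegree + 1, fun p hp =>
    Nat.lt_succ_of_le (Finset.single_le_sum (f := fun p : reesAlgebra I => p.1.natDegree) (fun _ _ => Nat.zero_le _) hp)⟩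
  let T : Finset (reesAlgebra I × ℕ) := S ×ˢ Finset.range D0
  let w : reesAlgebra I × ℕ → B := fun t => α t.1 t.2
  have step : ∀ (n : ℕ) (a : B), a ∈ 𝔞 ∧ a ∈ 𝔫 ^ n → ∃ c : reesAlgebra I × ℕ → B,
      (∀ t, t.2 < D0 → c t ∈ 𝔫 ^ (n - D0)) ∧ (a - ∑ t ∈ T, c t * w t ∈ 𝔞 ∧ a - ∑ t ∈ T, c t * w t ∈ 𝔫 ^ (n + 1)) := by
    rintro n a ⟨ha, han⟩
    obtain ⟨r, hr, har⟩ := happ n a han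
    let p0 : reesAlgebra I := ⟨Polynomial.monomial n r, (mem_reesAlgebra_iff _ _).2 fun i => by
      rw [Polynomial.coeff_monomial]
      split_ifs with h
      · exact h ▸ hr
      · exact zero_mem _⟩
    have hp0 : p0 ∈ L := by
      rw [hL]
      intro i
      change φ ((Polynomial.monomial n r).coeff i) ∈ _
      rw [Polynomial.coeff_monomial]
      split_ifs with h
      · subst h
        rw [show φ r = a + -(a - φ r) by ring]
        exact Submodule.add_mem_sup ha (neg_mem har)
      · rw [map_zero]; exact zero_mem _
    rw [← hS, Ideal.span, Submodule.mem_span_finset] at hp0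
    obtain ⟨q, -, hq⟩ := hp0
    refine ⟨fun t => if t.2 ≤ n then φ ((q t.1).1.coeff (n - t.2)) else 0, fun t ht => ?_, ?_⟩
    · dsimp only
      split_ifs with h
      · refine Ideal.pow_le_pow_right ?_ (hφ ((mem_reesAlgebra_iff _ _).1 (q t.1).2 (n - t.2)))
        omega
      · exact zero_mem _
    constructor
    · exact sub_mem ha (Ideal.sum_mem _ fun t _ => Ideal.mul_mem_left _ _ (hα1 _ _))
    have hr2 : r = ∑ t ∈ T, if t.2 ≤ n then (q t.1).1.coeff (n - t.2) * t.1.1.coeff t.2 else 0 := by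
      have h1 := congrArg (fun p : reesAlgebra I => p.1.coeff n) hq
      change _ = p0.1.coeff n at h1
      rw [show p0.1.coeff n = r from Polynomial.coeff_monomial_same n r] at h1
      rw [← h1, AddSubmonoidClass.coe_finsetSum, Polynomial.finsetSum_coeff, Finset.sum_product]
      refine Finset.sum_congr rfl fun p hp => ?_
      change ((q p).1 * p.1).coeff n = _
      conv_lhs => rw [p.1.as_sum_range_C_mul_X_pow' (hD0 p hp)]
      rw [Finset.mul_sum, Polynomial.finsetSum_coeff]
      refine Finset.sum_congr rfl fun j _ => ?_
      rw [← mul_assoc, Polynomial.coeff_mul_X_pow', Polynomial.coeff_mul_C]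
    have e : a - ∑ t ∈ T, (if t.2 ≤ n then φ ((q t.1).1.coeff (n - t.2)) else 0) * w t =
        (a - φ r) + ∑ t ∈ T, (if t.2 ≤ n then φ ((q t.1).1.coeff (n - t.2)) else 0) * (φ (t.1.1.coeff t.2) - w t) := by
      simp only [mul_sub, Finset.sum_sub_distrib]
      rw [hr2, map_sum]
      simp only [apply_ite φ, map_mul, map_zero, ite_mul, zero_mul]
      ring
    rw [e]
    refine add_mem har (Ideal.sum_mem _ fun t ht => ?_)
    split_ifs with h
    · have h1 := hα2 t.1 t.2 (Finset.mem_product.1 ht).1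
      have h2 := Ideal.mul_mem_mul (hφ ((mem_reesAlgebra_iff _ _).1 (q t.1).2 (n - t.2))) h1
      rw [← pow_add, show n - t.2 + (t.2 + 1) = n + 1 by omega] at h2
      exact h2
    · rw [zero_mul]; exact zero_mem _
  choose! c hc1 hc2 using step
  have hfg : 𝔞 = Ideal.span (T.image w : Set B) := by
    apply le_antisymm
    · intro a ha
      let sq : ℕ → B := fun n => Nat.rec a (fun n b => b - ∑ t ∈ T, c n b t * w t) n
      have hsq : ∀ n, sq n ∈ 𝔞 ∧ sq n ∈ 𝔫 ^ n := by
        intro n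
        induction n with
        | zero => exact ⟨ha, by rw [pow_zero, Ideal.one_eq_top]; trivial⟩
        | succ n ih => exact hc2 n (sq n) ih
      let s : ℕ → reesAlgebra I × ℕ → B := fun N t => ∑ n ∈ Finset.range N, c n (sq n) t
      have hsN : ∀ N, a - ∑ t ∈ T, s N t * w t = sq N := by
        intro N
        induction N with
        | zero => simp [s, sq]
        | succ N ih =>
          have : sq (N + 1) = sq N - ∑ t ∈ T, c N (sq N) t * w t := rfl
          have h2 : ∑ t ∈ T, s (N + 1) t * w t = ∑ t ∈ T, s N t * w t + ∑ t ∈ T, c N (sq N) t * w t := by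
            rw [← Finset.sum_add_distrib]
            refine Finset.sum_congr rfl fun t _ => ?_
            rw [← add_mul]
            congr 1
            exact Finset.sum_range_succ _ _
          rw [this, h2, ← sub_sub, ih]
      have hlim : ∀ t, ∃ l : B, t ∈ T → ∀ n, s (n + D0) t - l ∈ 𝔫 ^ n := by
        intro t
        by_cases ht : t ∈ T
        · have ht2 : t.2 < D0 := Finset.mem_range.1 (Finset.mem_product.1 ht).2
          obtain ⟨l, hl⟩ := IsPrecomplete.prec' (I := 𝔫) (M := B) (fun n => s (n + D0) t) (by
            intro m n hmn
            rw [smul_eq_mul, Ideal.mul_top, SModEq.comm, SModEq.sub_mem]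
            change (∑ i ∈ Finset.range (n + D0), c i (sq i) t) - ∑ i ∈ Finset.range (m + D0), c i (sq i) t ∈ _
            rw [← Finset.sum_Ico_eq_sub _ (by omega)]
            refine Ideal.sum_mem _ fun i hi => ?_
            rw [Finset.mem_Ico] at hi
            exact Ideal.pow_le_pow_right (by omega) (hc1 i (sq i) (hsq i) t ht2))
          refine ⟨l, fun _ n => ?_⟩
          have := hl n
          rwa [smul_eq_mul, Ideal.mul_top, SModEq.sub_mem] at this
        · exact ⟨0, fun h => absurd h ht⟩
      choose l hl using hlim
      have : a - ∑ t ∈ T, l t * w t = 0 := by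
        refine IsHausdorff.haus' (I := 𝔫) _ fun n => ?_
        rw [smul_eq_mul, Ideal.mul_top, SModEq.sub_mem, sub_zero]
        have e : a - ∑ t ∈ T, l t * w t = (a - ∑ t ∈ T, s (n + D0) t * w t) + ∑ t ∈ T, (s (n + D0) t - l t) * w t := by
          simp only [sub_mul, Finset.sum_sub_distrib]; ring
        rw [e, hsN]
        refine add_mem (Ideal.pow_le_pow_right (by omega) (hsq (n + D0)).2) (Ideal.sum_mem _ fun t ht => ?_)
        exact Ideal.mul_mem_right _ _ (hl t ht n)
      rw [sub_eq_zero.1 this]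
      exact Ideal.sum_mem _ fun t ht => Ideal.mul_mem_left _ _ (Ideal.subset_span (Finset.mem_coe.2 (Finset.mem_image_of_mem _ ht)))
    · rw [Ideal.span_le]
      intro z hz
      obtain ⟨t, -, rfl⟩ := Finset.mem_image.1 (Finset.mem_coe.1 hz)
      exact hα1 _ _
  exact ⟨T.image w, hfg.symm⟩
end NH

end

section
set_option synthInstance.maxHeartbeats 1000000
set_option maxHeartbeats 400000

open IsLocalRing Polynomial Finset

namespace NH

variable {R : Type*} [CommRing R] [IsLocalRing R] [IsNoetherianRing R]

theorem stab (F : ℕ → Ideal R) (hF : ∀ {n m}, n ≤ m → F m ≤ F n) (j : ℕ) :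
    ∃ h0, ∀ h ≥ h0, F h0 ≤ F h ⊔ maximalIdeal R ^ j := by
  have h1 : rl (maximalIdeal R ^ j) ⊤ ≠ ⊤ := rl_ne_top_of_pow_le le_rfl _
  rw [rl_top, Module.length_ne_top_iff] at h1
  have h2 : IsArtinian R (R ⧸ (maximalIdeal R ^ j)) :=
    (isFiniteLength_iff_isNoetherian_isArtinian.1 h1).2
  let f : ℕ →o (Submodule R (R ⧸ (maximalIdeal R ^ j)))ᵒᵈ :=
    ⟨fun h => OrderDual.toDual (Submodule.map (Submodule.mkQ (maximalIdeal R ^ j)) (F h)), fun a b hab =>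
      OrderDual.toDual_le_toDual.2 (Submodule.map_mono (hF hab))⟩
  obtain ⟨h0, hh⟩ := IsArtinian.monotone_stabilizes f
  refine ⟨h0, fun h hle => ?_⟩
  have h3 : Submodule.map (Submodule.mkQ (maximalIdeal R ^ j)) (F h0) = Submodule.map (Submodule.mkQ (maximalIdeal R ^ j)) (F h) :=
    hh h hle
  intro a ha
  have h4 : (Submodule.mkQ (maximalIdeal R ^ j)) a ∈ Submodule.map (Submodule.mkQ (maximalIdeal R ^ j)) (F h) := by
    rw [← h3]; exact Submodule.mem_map_of_mem ha
  obtain ⟨b, hb, hab⟩ := h4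
  have h5 : a - b ∈ maximalIdeal R ^ j := by
    rw [← Submodule.Quotient.eq]; exact hab.symm
  rw [show a = b + (a - b) by ring]
  exact Submodule.add_mem_sup hb h5

theorem compl_noeth : IsNoetherianRing (AdicCompletion (maximalIdeal R) R) := by
  refine noeth_compl (algebraMap R (AdicCompletion (maximalIdeal R) R)) (maximalIdeal R)
    (maximalIdeal (AdicCompletion (maximalIdeal R) R)) AdicCompletion.maximalIdeal_eq_map fun b => ?_
  obtain ⟨r, hr⟩ := (AdicCompletion.residueField_map_bijective R).2 (residue _ b)
  obtain ⟨r, rfl⟩ := residue_surjective r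
  refine ⟨r, ?_⟩
  rw [IsLocalRing.ResidueField.map_residue] at hr
  rw [← residue_eq_zero_iff, map_sub, hr, sub_self]

theorem compl_comap (n : ℕ) (a : R)
    (h : algebraMap R (AdicCompletion (maximalIdeal R) R) a ∈ maximalIdeal (AdicCompletion (maximalIdeal R) R) ^ n) :
    a ∈ maximalIdeal R ^ n := by
  rw [AdicCompletion.maximalIdeal_eq_map, ← Ideal.map_pow, ← Submodule.restrictScalars_mem R,
    ← Ideal.smul_top_eq_map, AdicCompletion.pow_smul_top_eq_ker_eval (maximalIdeal R).fg_of_isNoetherianRing] at h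
  have : (algebraMap R (AdicCompletion (maximalIdeal R) R)) a = AdicCompletion.of _ R a := rfl
  simpa only [smul_eq_mul, AdicCompletion.eval, this, LinearMap.mem_ker, LinearMap.coe_mk, AddHom.coe_mk,
      AdicCompletion.of_apply, Submodule.mkQ_apply, Ideal.Quotient.mk_eq_mk, Ideal.Quotient.eq_zero_iff_mem,
      Ideal.mul_top] using h

theorem chev {ι : Type*} (x : ι → R) (hm : sp x ≤ maximalIdeal R)
    [IsReduced (AdicCompletion (maximalIdeal R) R)] (l : ℕ) : ∃ h, NF x h ≤ maximalIdeal R ^ l := by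
  by_contra hcon
  push Not at hcon
  have hnoe : IsNoetherianRing (AdicCompletion (maximalIdeal R) R) := compl_noeth
  choose g hg using stab (NF x) NF_anti
  have step : ∀ j a, a ∈ NF x (g j) ⊔ maximalIdeal R ^ j →
      ∃ a', a' ∈ NF x (g (j+1)) ⊔ maximalIdeal R ^ (j+1) ∧ a' - a ∈ maximalIdeal R ^ j := by
    intro j a ha
    have h1 : NF x (g j) ⊔ maximalIdeal R ^ j ≤ NF x (max (g j) (g (j+1))) ⊔ maximalIdeal R ^ j :=
      sup_le (hg j _ (le_max_left _ _)) le_sup_right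
    obtain ⟨b, hb, c, hc, rfl⟩ := Submodule.mem_sup.1 (h1 ha)
    refine ⟨b, Submodule.mem_sup_left (NF_anti (le_max_right _ _) hb), ?_⟩
    rw [show b - (b + c) = -c by ring]; exact neg_mem hc
  obtain ⟨a0, ha0, ha0'⟩ := Set.not_subset.1 (hcon (g l))
  let St := {p : ℕ × R // p.2 ∈ NF x (g p.1) ⊔ maximalIdeal R ^ p.1}
  let nx : St → St := fun p => ⟨⟨p.1.1 + 1, (step p.1.1 p.1.2 p.2).choose⟩, (step p.1.1 p.1.2 p.2).choose_spec.1⟩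
  let u : ℕ → St := fun k => nx^[k] ⟨⟨l, a0⟩, Submodule.mem_sup_left ha0⟩
  have u1 : ∀ k, u (k+1) = nx (u k) := fun k => Function.iterate_succ_apply' _ _ _
  have u2 : ∀ k, (u k).1.1 = l + k := by
    intro k
    induction k with
    | zero => rfl
    | succ k ih => rw [u1, ← add_assoc, ← ih]
  obtain ⟨s, hs⟩ : ∃ s : ℕ → R, s = fun k => (u k).1.2 := ⟨_, rfl⟩
  have s0 : s 0 = a0 := by rw [hs]; rfl
  have s1 : ∀ k, s k ∈ NF x (g (l+k)) ⊔ maximalIdeal R ^ (l+k) := by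
    intro k
    have := (u k).2
    rw [u2] at this; rw [hs]; exact this
  have s2 : ∀ k, s (k+1) - s k ∈ maximalIdeal R ^ (l+k) := by
    intro k
    have := (step (u k).1.1 (u k).1.2 (u k).2).choose_spec.2
    rw [← u2 k, hs]
    have h3 : (u (k+1)).1.2 = (step (u k).1.1 (u k).1.2 (u k).2).choose := by rw [u1]
    show (u (k+1)).1.2 - (u k).1.2 ∈ _
    rw [h3]; exact this
  have s3 : ∀ k i, s (k+i) - s k ∈ maximalIdeal R ^ (l+k) := by
    intro k i
    induction i with
    | zero => simp
    | succ i ih =>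
      rw [show s (k + (i+1)) - s k = (s (k+i+1) - s (k+i)) + (s (k+i) - s k) by rw [add_assoc]; ring]
      exact add_mem (Ideal.pow_le_pow_right (by omega) (s2 (k+i))) ih
  clear_value u
  let φ := algebraMap R (AdicCompletion (maximalIdeal R) R)
  have hφ : ∀ {n : ℕ} {r : R}, r ∈ maximalIdeal R ^ n → φ r ∈ maximalIdeal (AdicCompletion (maximalIdeal R) R) ^ n := by
    intro n r hr
    rw [AdicCompletion.maximalIdeal_eq_map, ← Ideal.map_pow]; exact Ideal.mem_map_of_mem _ hr
  obtain ⟨a, ha⟩ := IsPrecomplete.prec' (I := maximalIdeal (AdicCompletion (maximalIdeal R) R))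
    (M := AdicCompletion (maximalIdeal R) R) (fun k => φ (s k)) (by
      intro m n hmn
      rw [SModEq.sub_mem, smul_eq_mul, Ideal.mul_top, ← map_sub]
      apply hφ
      obtain ⟨i, rfl⟩ := Nat.exists_eq_add_of_le hmn
      rw [← neg_sub]
      exact neg_mem (Ideal.pow_le_pow_right (by omega) (s3 m i)))
  have ha' : ∀ k, φ (s k) - a ∈ maximalIdeal (AdicCompletion (maximalIdeal R) R) ^ k := by
    intro k
    have := ha k
    rwa [SModEq.sub_mem, smul_eq_mul, Ideal.mul_top] at this
  have hnil : IsNilpotent a := by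
    refine Linf a fun N => ?_
    have hk := s1 (2*N)
    have h1 : NF x (g (l+2*N)) ⊔ maximalIdeal R ^ (l+2*N) ≤ NF x (2*N) ⊔ maximalIdeal R ^ (2*N) :=
      sup_le ((hg _ (max (2*N) (g (l+2*N))) (le_max_right _ _)).trans
        (sup_le_sup (NF_anti (le_max_left _ _)) (Ideal.pow_le_pow_right (by omega))))
        (le_sup_of_le_right (Ideal.pow_le_pow_right (by omega)))
    obtain ⟨b, hb, c, hc, hbc⟩ := Submodule.mem_sup.1 (h1 hk)
    have hb1 : AC (maximalIdeal (AdicCompletion (maximalIdeal R) R) ^ (2*N)) (φ b) := by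
      refine AC.mono ?_ (AC.map φ (mem_NF.1 hb))
      rw [Ideal.map_pow, AdicCompletion.maximalIdeal_eq_map]
      exact Ideal.pow_right_mono (Ideal.map_mono hm) _
    have h2 : a = φ b + (φ c - (φ (s (2*N)) - a)) := by rw [← hbc, map_add]; ring
    have h3 : AC (maximalIdeal (AdicCompletion (maximalIdeal R) R) ^ (2*N)) a := by
      rw [h2]; exact hb1.add (AC.of_mem (sub_mem (hφ hc) (ha' _)))
    obtain ⟨r, hr⟩ := h3
    refine ⟨r + 1 + r, by omega, ?_⟩
    have := hr (r+1)
    rw [← pow_mul] at this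
    exact Ideal.pow_le_pow_right (by nlinarith) this
  have h0 : a = 0 := hnil.eq_zero
  have h1 := ha' l
  rw [h0, sub_zero] at h1
  have h2 := compl_comap _ _ h1
  have h3 := s3 0 l
  rw [zero_add, s0, add_zero] at h3
  apply ha0'
  have := sub_mem h2 h3
  rwa [sub_sub_cancel] at this

theorem rees {d : ℕ} {x : Fin (d+1) → R} (hx : QR x) {N : ℕ} (hN : maximalIdeal R ^ N ≤ sp x)
    (hm : sp x ≤ maximalIdeal R) (hF1 : NF x 1 = maximalIdeal R)
    [IsReduced (AdicCompletion (maximalIdeal R) R)] : ∃ c, ∀ n, NF x (n + c) ≤ sp x ^ n := by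
  obtain ⟨c, hc⟩ := rees_pre hx hN hF1
  refine ⟨c, fun n => ?_⟩
  obtain ⟨h, hh⟩ := chev x hm (N * n)
  refine (hc n h).trans (sup_le le_rfl (hh.trans ?_))
  rw [pow_mul]; exact Ideal.pow_right_mono hN _

end NH

end

section
namespace NH

def UC {R : Type*} [CommRing R] (g : R[X]) : Prop := ∃ i, IsUnit (g.coeff i)

section
variable {R : Type*} [CommRing R] [IsLocalRing R]

theorem UC_iff {g : R[X]} : UC g ↔ g ∉ (maximalIdeal R).map (C : R →+* R[X]) := by
  rw [Ideal.mem_map_C_iff]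
  push Not
  simp only [UC, mem_maximalIdeal, mem_nonunits_iff, not_not]

theorem UC.mul {g h : R[X]} (hg : UC g) (hh : UC h) : UC (g * h) := by
  rw [UC_iff] at *
  have := Ideal.isPrime_map_C_of_isPrime (P := maximalIdeal R)
  intro hc
  exact (this.mem_or_mem hc).elim hg hh

theorem UC.one : UC (1 : R[X]) := ⟨0, by simp⟩

theorem UC.X : UC (Polynomial.X : R[X]) := ⟨1, by simp⟩

structure SL {S : Type*} [CommRing S] (ψ : R[X] →+* S) (y : R[X]) : Prop where
  unit : ∀ g, UC g → IsUnit (ψ g)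
  surj : ∀ s, ∃ α g, UC g ∧ ψ g * s = ψ α
  ker : ∀ α, ψ α = 0 → ∃ g, UC g ∧ g * α ∈ Ideal.span {y}
  hy : ψ y = 0

variable {S : Type*} [CommRing S] {ψ : R[X] →+* S} {y : R[X]}

theorem SL.mem_map (h : SL ψ y) {𝔅 : Ideal R[X]} {s : S} (hs : s ∈ 𝔅.map ψ) :
    ∃ g β, UC g ∧ β ∈ 𝔅 ∧ ψ g * s = ψ β := by
  rw [Ideal.map] at hs
  induction hs using Submodule.span_induction with
  | mem s hs =>
    obtain ⟨β, hβ, rfl⟩ := hs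
    exact ⟨1, β, UC.one, hβ, by rw [map_one, one_mul]⟩
  | zero => exact ⟨1, 0, UC.one, zero_mem _, by simp⟩
  | add s s' _ _ ih ih' =>
    obtain ⟨g, β, hg, hβ, e⟩ := ih
    obtain ⟨g', β', hg', hβ', e'⟩ := ih'
    refine ⟨g * g', g' * β + g * β', hg.mul hg', add_mem (Ideal.mul_mem_left _ _ hβ) (Ideal.mul_mem_left _ _ hβ'), ?_⟩
    simp only [map_mul, map_add]
    rw [← e, ← e']; ring
  | smul c s _ ih =>
    obtain ⟨g, β, hg, hβ, e⟩ := ih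
    obtain ⟨α, g', hg', e'⟩ := h.surj c
    refine ⟨g' * g, α * β, hg'.mul hg, Ideal.mul_mem_left _ _ hβ, ?_⟩
    simp only [map_mul, smul_eq_mul]
    rw [← e, ← e']; ring

theorem SL.mem (h : SL ψ y) {𝔅 : Ideal R[X]} {α : R[X]} :
    ψ α ∈ 𝔅.map ψ ↔ ∃ g, UC g ∧ g * α ∈ 𝔅 ⊔ Ideal.span {y} := by
  constructor
  · intro hs
    obtain ⟨g, β, hg, hβ, e⟩ := h.mem_map hs
    obtain ⟨g', hg', e'⟩ := h.ker (g * α - β) (by rw [map_sub, map_mul, e, sub_self])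
    refine ⟨g' * g, hg'.mul hg, ?_⟩
    rw [show g' * g * α = g' * β + g' * (g * α - β) by ring]
    exact Submodule.add_mem_sup (Ideal.mul_mem_left _ _ hβ) e'
  · rintro ⟨g, hg, hm⟩
    obtain ⟨β, hβ, q, hq, e⟩ := Submodule.mem_sup.1 hm
    obtain ⟨q, rfl⟩ := Ideal.mem_span_singleton'.1 hq
    have h1 : ψ g * ψ α = ψ β := by
      rw [← map_mul, ← e, map_add, map_mul, h.hy, mul_zero, add_zero]
    rw [← Ideal.unit_mul_mem_iff_mem _ (h.unit g hg), h1]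
    exact Ideal.mem_map_of_mem _ hβ

theorem SL.unit_mem (h : SL ψ y) {K : Ideal S} {s : S} {α g : R[X]} (hg : UC g) (e : ψ g * s = ψ α) :
    s ∈ K ↔ ψ α ∈ K := by
  rw [← e, Ideal.unit_mul_mem_iff_mem _ (h.unit g hg)]

theorem map_C_map (ψ : R[X] →+* S) (K : Ideal R) : K.map (ψ.comp C) = (K.map (C : R →+* R[X])).map ψ := by
  rw [Ideal.map_map]

theorem SL.memC (h : SL ψ y) {K : Ideal R} {α : R[X]} :
    ψ α ∈ K.map (ψ.comp C) ↔ ∃ g, UC g ∧ ∃ β : R[X], (∀ i, β.coeff i ∈ K) ∧ ∃ q, g * α = β + q * y := by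
  rw [map_C_map, h.mem]
  constructor
  · rintro ⟨g, hg, hm⟩
    obtain ⟨β, hβ, q, hq, e⟩ := Submodule.mem_sup.1 hm
    obtain ⟨q, rfl⟩ := Ideal.mem_span_singleton'.1 hq
    exact ⟨g, hg, β, Ideal.mem_map_C_iff.1 hβ, q, e.symm⟩
  · rintro ⟨g, hg, β, hβ, q, e⟩
    refine ⟨g, hg, ?_⟩
    rw [e]
    exact Submodule.add_mem_sup (Ideal.mem_map_C_iff.2 hβ) (Ideal.mul_mem_left _ _ (Ideal.mem_span_singleton_self _))

theorem SL.local (h : SL ψ y) (hy : ∀ i, y.coeff i ∈ maximalIdeal R) [IsLocalRing S] :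
    maximalIdeal S = (maximalIdeal R).map (ψ.comp C) := by
  apply le_antisymm
  · intro s hs
    obtain ⟨α, g, hg, e⟩ := h.surj s
    rw [h.unit_mem hg e] at hs ⊢
    by_cases hα : UC α
    · exact absurd (h.unit α hα) hs
    · rw [UC_iff, not_not] at hα
      rw [map_C_map]; exact Ideal.mem_map_of_mem _ hα
  · refine le_maximalIdeal ?_
    rw [Ideal.ne_top_iff_one, ← map_one ψ, h.memC]
    rintro ⟨g, ⟨i, hi⟩, β, hβ, q, e⟩
    rw [mul_one] at e
    have h1 : (q * y).coeff i ∈ maximalIdeal R := by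
      rw [Polynomial.coeff_mul]
      exact Ideal.sum_mem _ fun p _ => Ideal.mul_mem_left _ _ (hy _)
    have h2 : g.coeff i ∈ maximalIdeal R := by
      rw [e, coeff_add]; exact add_mem (hβ i) h1
    exact h2 hi

end

theorem exists_SL {R : Type u} [CommRing R] [IsLocalRing R] [IsNoetherianRing R] (y : R[X])
    (hy : ∀ i, y.coeff i ∈ maximalIdeal R) :
    ∃ (P S : Type u) (_ : CommRing P) (_ : CommRing S) (_ : IsLocalRing P) (_ : IsLocalRing S)
      (_ : IsNoetherianRing P) (_ : IsNoetherianRing S) (ψ₀ : R[X] →+* P) (π : P →+* S),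
      SL ψ₀ 0 ∧ Function.Surjective π ∧ RingHom.ker π = Ideal.span {ψ₀ y} ∧ SL (π.comp ψ₀) y := by
  have hp := Ideal.isPrime_map_C_of_isPrime (P := maximalIdeal R)
  let P := Localization.AtPrime ((maximalIdeal R).map (C : R →+* R[X]))
  let ψ₀ : R[X] →+* P := algebraMap R[X] P
  have hP : SL ψ₀ 0 := by
    constructor
    · intro g hg
      exact IsLocalization.map_units P (⟨g, UC_iff.1 hg⟩ : ((maximalIdeal R).map (C : R →+* R[X])).primeCompl)
    · intro s
      obtain ⟨⟨α, g⟩, e⟩ := IsLocalization.surj ((maximalIdeal R).map (C : R →+* R[X])).primeCompl s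
      exact ⟨α, g, UC_iff.2 g.2, by rw [mul_comm]; exact e⟩
    · intro α hα
      rw [← map_zero ψ₀] at hα
      obtain ⟨g, e⟩ := (IsLocalization.eq_iff_exists ((maximalIdeal R).map (C : R →+* R[X])).primeCompl P).1 hα
      refine ⟨g, UC_iff.2 g.2, ?_⟩
      rw [e, mul_zero]; exact zero_mem _
    · exact map_zero _
  have hnoe : IsNoetherianRing P := IsLocalization.isNoetherianRing ((maximalIdeal R).map (C : R →+* R[X])).primeCompl P inferInstance
  let S := P ⧸ Ideal.span {ψ₀ y}
  have hne : Ideal.span {ψ₀ y} ≠ ⊤ := by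
    intro ht
    have h1 : Ideal.span {ψ₀ y} ≤ maximalIdeal P := by
      rw [Ideal.span_singleton_le_iff_mem, hP.local (by simp), map_C_map]
      exact Ideal.mem_map_of_mem _ (Ideal.mem_map_C_iff.2 hy)
    rw [ht, top_le_iff] at h1
    exact (maximalIdeal.isMaximal P).ne_top h1
  have hnt : Nontrivial S := Ideal.Quotient.nontrivial_iff.2 hne
  have hloc : IsLocalRing S := IsLocalRing.of_surjective' (Ideal.Quotient.mk _) Ideal.Quotient.mk_surjective
  refine ⟨P, S, inferInstance, inferInstance, inferInstance, hloc, hnoe, inferInstance, ψ₀, Ideal.Quotient.mk _, hP,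
    Ideal.Quotient.mk_surjective, Ideal.mk_ker, ?_⟩
  constructor
  · intro g hg; exact (hP.unit g hg).map (Ideal.Quotient.mk (Ideal.span {ψ₀ y}))
  · intro s
    obtain ⟨s, rfl⟩ := Ideal.Quotient.mk_surjective s
    obtain ⟨α, g, hg, e⟩ := hP.surj s
    exact ⟨α, g, hg, by rw [RingHom.comp_apply, RingHom.comp_apply, ← e, map_mul]⟩
  · intro α hα
    rw [RingHom.comp_apply, Ideal.Quotient.eq_zero_iff_mem, ← Set.image_singleton, ← Ideal.map_span, hP.mem] at hα
    simpa using hα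
  · rw [RingHom.comp_apply, Ideal.Quotient.eq_zero_iff_mem]
    exact Ideal.mem_span_singleton_self _

end NH

end

section
namespace NH

theorem rl_one {A : Type*} [CommRing A] [IsLocalRing A] (N : Ideal A) (u : A) (hu : u ∉ N)
    (hm : ∀ a ∈ maximalIdeal A, a * u ∈ N) : rl N (N ⊔ Ideal.span {u}) = 1 := by
  apply le_antisymm
  · rw [rl_sup, ← rl_max_top (R := A)]
    refine rl_le_of_surj (LinearMap.mulRight A u) ?_ ?_ ?_
    · intro a _ ha; exact hm a ha
    · intro a _; exact Ideal.mul_mem_left _ _ (Ideal.mem_span_singleton_self _)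
    · intro a ha
      obtain ⟨b, rfl⟩ := Ideal.mem_span_singleton'.1 ha
      exact ⟨b, trivial, by simp⟩
  · rw [Order.one_le_iff_ne_zero, Ne, rl_eq_zero]
    intro h
    exact hu (h (Submodule.mem_sup_right (Ideal.mem_span_singleton_self _)))

theorem rl_colon {A : Type*} [CommRing A] (K K' : Ideal A) (y : A) (h : ∀ a, y * a ∈ K ↔ a ∈ K') :
    rl K ⊤ = rl K' ⊤ + rl (K ⊔ Ideal.span {y}) ⊤ := by
  rw [rl_add (N := K) (K := K ⊔ Ideal.span {y}) le_sup_left le_top, rl_sup]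
  congr 1
  apply le_antisymm
  · refine rl_le_of_surj (LinearMap.mulLeft A y) ?_ ?_ ?_
    · intro a _ ha; exact (h a).2 ha
    · intro a _; exact Ideal.mul_mem_right _ _ (Ideal.mem_span_singleton_self _)
    · intro a ha
      obtain ⟨b, rfl⟩ := Ideal.mem_span_singleton'.1 ha
      exact ⟨b, trivial, by simp [mul_comm]⟩
  · refine rl_le_of_inj (LinearMap.mulLeft A y) ?_ ?_
    · intro a _; exact Ideal.mul_mem_right _ _ (Ideal.mem_span_singleton_self _)
    · intro a _ ha; exact (h a).1 ha

theorem rl_quot {P S : Type*} [CommRing P] [CommRing S] (π : P →+* S) (hπ : Function.Surjective π)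
    (K : Ideal P) : rl (K.map π) ⊤ = rl (K ⊔ RingHom.ker π) ⊤ := by
  rw [rl_top, rl_top, ← Ideal.comap_map_of_surjective' π hπ]
  algebraize [π]
  let e : (P ⧸ (K.map π).comap π) ≃ₗ[P] (S ⧸ K.map π) := by
    refine LinearEquiv.ofBijective ((Submodule.mapQ ((K.map π).comap π) ((K.map π).restrictScalars P) (Algebra.linearMap P S) ?_)) ?_
    · intro a ha; exact ha
    · constructor
      · rw [injective_iff_map_eq_zero]
        intro a ha
        obtain ⟨a, rfl⟩ := Submodule.Quotient.mk_surjective _ a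
        have ha' : (Submodule.Quotient.mk (π a) : S ⧸ K.map π) = 0 := ha
        rw [Submodule.Quotient.mk_eq_zero] at ha'
        exact (Submodule.Quotient.mk_eq_zero _).2 ha'
      · intro s
        obtain ⟨s, rfl⟩ := Submodule.Quotient.mk_surjective _ s
        obtain ⟨a, rfl⟩ := hπ s
        exact ⟨Submodule.Quotient.mk a, rfl⟩
  rw [e.length_eq]
  exact (Module.length_eq_of_surjective (R := S) (S := P) (M := S ⧸ K.map π) hπ).symm

theorem SL.contr0 {R P : Type*} [CommRing R] [IsLocalRing R] [CommRing P] {ψ : R[X] →+* P} (h : SL ψ 0)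
    {K : Ideal R} {u : R} (hu : (ψ.comp C) u ∈ K.map (ψ.comp C)) : u ∈ K := by
  rw [RingHom.comp_apply, h.memC] at hu
  obtain ⟨g, ⟨i, hi⟩, β, hβ, q, e⟩ := hu
  have h1 := hβ i
  rw [mul_zero, add_zero] at e
  rw [← e, coeff_mul_C] at h1
  exact (Ideal.unit_mul_mem_iff_mem _ hi).1 h1

theorem SL.rl0 {R P : Type*} [CommRing R] [IsLocalRing R] [IsNoetherianRing R] [CommRing P] [IsLocalRing P]
    {ψ : R[X] →+* P} (h : SL ψ 0) {N : ℕ} (K : Ideal R) (hK : maximalIdeal R ^ N ≤ K) :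
    rl (K.map (ψ.comp C)) ⊤ = rl K ⊤ := by
  induction K using IsNoetherian.induction with
  | hgt K ih =>
  by_cases ht : K = ⊤
  · rw [ht, Ideal.map_top, rl_eq_zero.2 le_rfl, rl_eq_zero.2 le_rfl]
  have hex : ∃ n, maximalIdeal R ^ n ≤ K := ⟨N, hK⟩
  classical
  have h0 : Nat.find hex ≠ 0 := by
    intro h0
    have := Nat.find_spec hex
    rw [h0, pow_zero, Ideal.one_eq_top, top_le_iff] at this
    exact ht this
  obtain ⟨n, hn⟩ := Nat.exists_eq_succ_of_ne_zero h0
  have h1 := Nat.find_min hex (m := n) (by omega)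
  have h2 := Nat.find_spec hex
  rw [hn] at h2
  obtain ⟨u, hu, huK⟩ := Set.not_subset.1 h1
  have hmu : ∀ a ∈ maximalIdeal R, a * u ∈ K := by
    intro a ha
    apply h2
    rw [pow_succ']; exact Ideal.mul_mem_mul ha hu
  have h3 : maximalIdeal P = (maximalIdeal R).map (ψ.comp C) := h.local (by simp)
  rw [rl_add (N := K) (K := K ⊔ Ideal.span {u}) le_sup_left le_top, rl_one K u huK hmu,
    rl_add (N := Ideal.map (ψ.comp C) K) (K := Ideal.map (ψ.comp C) (K ⊔ Ideal.span {u})) (Ideal.map_mono le_sup_left) le_top,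
    Ideal.map_sup, Ideal.map_span, Set.image_singleton, rl_one, ← Set.image_singleton, ← Ideal.map_span, ← Ideal.map_sup,
    ih (K ⊔ Ideal.span {u})]
  · refine lt_of_le_of_ne le_sup_left fun he => huK ?_
    rw [he]; exact Submodule.mem_sup_right (Ideal.mem_span_singleton_self _)
  · exact hK.trans le_sup_left
  · intro hc; exact huK (h.contr0 hc)
  · intro a ha
    have h4 : maximalIdeal R ≤ (Submodule.colon K {u}) := by
      intro a ha
      rw [Submodule.mem_colon_singleton]
      exact hmu a ha
    rw [h3] at ha
    rw [Ideal.map] at ha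
    induction ha using Submodule.span_induction with
    | mem b hb =>
      obtain ⟨b, hb, rfl⟩ := hb
      rw [← map_mul]; exact Ideal.mem_map_of_mem _ (hmu b hb)
    | zero => rw [zero_mul]; exact zero_mem _
    | add b b' _ _ h h' => rw [add_mul]; exact add_mem h h'
    | smul c b _ h => rw [smul_mul_assoc]; exact Submodule.smul_mem _ _ h

end NH

end

section
namespace NH

/-- the generic linear form `z - T w` -/
noncomputable def yy {R : Type*} [CommRing R] {d : ℕ} (x : Fin (d + 2) → R) : R[X] := C (x 0) - Polynomial.X * C (x 1)

noncomputable def hA {R : Type*} [CommRing R] {d : ℕ} (x : Fin (d + 2) → R) (D : ℕ) (α : R[X]) : MvPolynomial (Fin (d + 2)) R :=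
  ∑ j ∈ Finset.range (D + 1), MvPolynomial.monomial (Finsupp.single 0 j + Finsupp.single 1 (D - j)) (α.coeff j)

section
variable {R : Type*} [CommRing R] {d : ℕ} {x : Fin (d + 2) → R}

theorem hA_hom (D : ℕ) (α : R[X]) : (hA x D α).IsHomogeneous D := by
  refine MvPolynomial.IsHomogeneous.sum _ _ _ fun j hj => MvPolynomial.isHomogeneous_monomial _ ?_
  rw [Finset.mem_range] at hj
  rw [map_add, Finsupp.degree_single, Finsupp.degree_single]; omega

theorem hA_coeff {D : ℕ} {α : R[X]} {i : ℕ} (hi : i ≤ D) :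
    (hA x D α).coeff (Finsupp.single 0 i + Finsupp.single 1 (D - i)) = α.coeff i := by
  rw [hA, MvPolynomial.coeff_sum, Finset.sum_eq_single i]
  · rw [MvPolynomial.coeff_monomial, if_pos rfl]
  · intro j hj hji
    rw [MvPolynomial.coeff_monomial, if_neg]
    intro h
    have := DFunLike.congr_fun h 0
    simp at this
    exact hji this
  · intro h; simp at h; omega

theorem hA_unit {D : ℕ} {g : R[X]} (hg : UC g) (hD : g.natDegree ≤ D) : ∃ m, IsUnit ((hA x D g).coeff m) := by
  obtain ⟨i, hi⟩ := hg
  by_cases hiD : i ≤ D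
  · exact ⟨_, by rw [hA_coeff hiD]; exact hi⟩
  · rw [coeff_eq_zero_of_natDegree_lt (by omega)] at hi
    have h0 := isUnit_zero_iff.1 hi
    have := subsingleton_of_zero_eq_one h0
    exact ⟨0, isUnit_of_subsingleton _⟩

theorem hA_mem {D : ℕ} {β : R[X]} {K : Ideal R} (h : ∀ i, β.coeff i ∈ K) :
    MvPolynomial.eval x (hA x D β) ∈ K * sp x ^ D := by
  refine eval_mem_mul x (hA_hom D β) K fun m => ?_
  rw [hA, MvPolynomial.coeff_sum]
  refine Ideal.sum_mem _ fun j _ => ?_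
  rw [MvPolynomial.coeff_monomial]
  split_ifs
  · exact h j
  · exact zero_mem _

theorem hA_dvd {D : ℕ} {α : R[X]} (hD : α.natDegree ≤ D) :
    yy x ∣ C (x 1) ^ D * α - C (MvPolynomial.eval x (hA x D α)) := by
  have h1 : α = ∑ j ∈ Finset.range (D + 1), C (α.coeff j) * Polynomial.X ^ j :=
    α.as_sum_range_C_mul_X_pow' (by omega)
  have h2 : MvPolynomial.eval x (hA x D α) = ∑ j ∈ Finset.range (D + 1), α.coeff j * (x 0 ^ j * x 1 ^ (D - j)) := by
    rw [hA, map_sum]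
    refine Finset.sum_congr rfl fun j _ => ?_
    rw [MvPolynomial.eval_monomial]
    show _ * xm x _ = _
    rw [xm_add, xm_single, xm_single]
  rw [h2]
  nth_rw 1 [h1]
  rw [Finset.mul_sum, map_sum, ← Finset.sum_sub_distrib]
  refine Finset.dvd_sum fun j hj => ?_
  rw [Finset.mem_range] at hj
  have h3 : C (x 1) ^ D * (C (α.coeff j) * Polynomial.X ^ j) - C (α.coeff j * (x 0 ^ j * x 1 ^ (D - j))) =
      (C (α.coeff j) * C (x 1) ^ (D - j)) * ((Polynomial.X * C (x 1)) ^ j - C (x 0) ^ j) := by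
    obtain ⟨k, rfl⟩ := Nat.exists_eq_add_of_le (show j ≤ D by omega)
    rw [Nat.add_sub_cancel_left, pow_add]
    simp only [map_mul, map_pow]
    ring
  rw [h3]
  refine Dvd.dvd.mul_left ?_ _
  refine dvd_trans ?_ (sub_dvd_pow_sub_pow _ _ j)
  rw [← neg_sub, dvd_neg]; exact dvd_rfl

theorem yy_dvd_C (hw : ∀ a, x 1 * a = 0 → a = 0) {r : R} (h : yy x ∣ C r) : r = 0 := by
  obtain ⟨q, hq⟩ := h
  by_cases hq0 : q = 0
  · rw [hq0, mul_zero] at hq; exact C_eq_zero.1 hq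
  exfalso
  have h1 := congrArg (fun p => coeff p (q.natDegree + 1)) hq
  simp only [yy, sub_mul, coeff_sub, coeff_C_mul, coeff_C_succ, mul_assoc, coeff_X_mul] at h1
  rw [coeff_eq_zero_of_natDegree_lt (Nat.lt_succ_self _), mul_zero, zero_sub, eq_comm, neg_eq_zero] at h1
  exact hq0 (leadingCoeff_eq_zero.1 (hw _ h1))

theorem dehom (hw : ∀ a, x 1 * a = 0 → a = 0) {g α β q : R[X]} (hg : UC g) (e : g * α = β + q * yy x)
    {K : Ideal R} (hβ : ∀ i, β.coeff i ∈ K) {D : ℕ} {a : R} (ha : yy x ∣ C (x 1) ^ D * α - C a) :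
    ∃ (E : ℕ) (G : MvPolynomial (Fin (d + 2)) R), G.IsHomogeneous E ∧ (∃ m, IsUnit (G.coeff m)) ∧
      MvPolynomial.eval x G * a ∈ K * sp x ^ (D + E) := by
  let E := max g.natDegree β.natDegree
  refine ⟨E, hA x E g, hA_hom _ _, hA_unit hg (le_max_left _ _), ?_⟩
  have h1 : yy x ∣ C (x 1) ^ E * g - C (MvPolynomial.eval x (hA x E g)) := hA_dvd (le_max_left _ _)
  have h2 : yy x ∣ C (x 1) ^ (D + E) * β - C (MvPolynomial.eval x (hA x (D + E) β)) :=
    hA_dvd ((le_max_right _ _).trans (Nat.le_add_left _ _))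
  have h3 : yy x ∣ C (MvPolynomial.eval x (hA x E g) * a - MvPolynomial.eval x (hA x (D + E) β)) := by
    have : C (MvPolynomial.eval x (hA x E g) * a - MvPolynomial.eval x (hA x (D + E) β)) =
        (C (x 1) ^ (D + E) * β - C (MvPolynomial.eval x (hA x (D + E) β)))
        - (C (x 1) ^ D * α - C a) * C (MvPolynomial.eval x (hA x E g))
        - (C (x 1) ^ E * g - C (MvPolynomial.eval x (hA x E g))) * (C (x 1) ^ D * α)
        + C (x 1) ^ (D + E) * q * yy x := by
      have : β = g * α - q * yy x := by rw [e]; ring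
      rw [this]
      simp only [map_sub, map_mul, pow_add]
      ring
    rw [this]
    exact dvd_add (dvd_sub (dvd_sub h2 (ha.mul_right _)) (h1.mul_right _)) (dvd_mul_left _ _)
  rw [sub_eq_zero.1 (yy_dvd_C hw h3)]
  exact hA_mem hβ

end

section
variable {R : Type*} [CommRing R] [IsLocalRing R] [IsNoetherianRing R] {d : ℕ} {x : Fin (d + 2) → R}

theorem reg_x (hx : QR x) {N : ℕ} (hN : maximalIdeal R ^ N ≤ sp x) (hm : sp x ≤ maximalIdeal R) (i : Fin (d + 2)) (a : R)
    (h : x i * a = 0) : a = 0 := by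
  have h1 : a ∈ (⨅ n : ℕ, sp x ^ n : Ideal R) := by
    rw [Ideal.mem_iInf]
    intro n
    refine q1 hx hN (G := MvPolynomial.X i) (MvPolynomial.isHomogeneous_X _ i) ⟨Finsupp.single i 1, ?_⟩ ?_
    · simp
    · rw [MvPolynomial.eval_X, h]; exact zero_mem _
  have h2 : sp x ≠ ⊤ := fun ht => (maximalIdeal.isMaximal R).ne_top (top_le_iff.1 (ht ▸ hm))
  rwa [Ideal.iInf_pow_eq_bot_of_isLocalRing _ h2] at h1

variable {S : Type*} [CommRing S] {ψ : R[X] →+* S}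

theorem SL.sp_eq (h : SL ψ (yy x)) : sp (fun i : Fin (d + 1) => (ψ.comp C) (x i.succ)) = (sp x).map (ψ.comp C) := by
  rw [sp, sp, Ideal.map_span, ← Set.range_comp]
  apply le_antisymm
  · rw [Ideal.span_le]
    rintro _ ⟨i, rfl⟩
    exact Ideal.subset_span ⟨i.succ, rfl⟩
  · rw [Ideal.span_le]
    rintro _ ⟨i, rfl⟩
    refine Fin.cases ?_ (fun i => Ideal.subset_span ⟨i, rfl⟩) i
    have h1 := h.hy
    rw [yy, map_sub, map_mul, sub_eq_zero] at h1
    show ψ (C (x 0)) ∈ _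
    rw [h1]
    exact Ideal.mul_mem_left _ _ (Ideal.subset_span ⟨0, rfl⟩)

theorem SL.contr (h : SL ψ (yy x)) (hx : QR x) {N : ℕ} (hN : maximalIdeal R ^ N ≤ sp x) (hm : sp x ≤ maximalIdeal R)
    {n : ℕ} {r : R} (hr : (ψ.comp C) r ∈ (sp x ^ n).map (ψ.comp C)) : r ∈ sp x ^ n := by
  rw [RingHom.comp_apply, h.memC] at hr
  obtain ⟨g, hg, β, hβ, q, e⟩ := hr
  obtain ⟨E, G, hG, hGu, hm'⟩ := dehom (reg_x hx hN hm 1) hg e hβ (D := 0) (a := r) (by simp)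
  rw [zero_add, ← pow_add] at hm'
  exact q1 hx hN hG hGu hm'

theorem SL.val [IsNoetherianRing S] (h : SL ψ (yy x)) (hx : QR x) {N : ℕ} (hN : maximalIdeal R ^ N ≤ sp x) (hm : sp x ≤ maximalIdeal R)
    {n : ℕ} {α : R[X]} (hα : ψ α ∈ NF (fun i : Fin (d + 1) => (ψ.comp C) (x i.succ)) n)
    {D : ℕ} {a : R} (ha : yy x ∣ C (x 1) ^ D * α - C a) : a ∈ NF x (n + D) := by
  rw [mem_NF] at hα ⊢
  obtain ⟨r, hr⟩ := hα
  refine ⟨r, fun M => ?_⟩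
  have h1 := hr M
  rw [h.sp_eq, ← map_pow, ← pow_mul, ← Ideal.map_pow, h.memC] at h1
  obtain ⟨g, hg, β, hβ, q, e⟩ := h1
  obtain ⟨E, G, hG, hGu, hm'⟩ := dehom (reg_x hx hN hm 1) hg e hβ (D := D * (M + r)) (a := a ^ (M + r)) (by
    rw [pow_mul, ← mul_pow, map_pow]
    exact ha.trans (sub_dvd_pow_sub_pow _ _ _))
  rw [← pow_add, ← add_assoc] at hm'
  have := q1 hx hN hG hGu hm'
  rw [← pow_mul]
  exact Ideal.pow_le_pow_right (by nlinarith) this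

end

end NH

end

section
namespace NH

theorem qr_poly {R ι : Type*} [CommRing R] {x : ι → R} (hx : QR x) : QR (fun i => (C (x i) : R[X])) := by
  classical
  have hsp : ∀ n, sp (fun i => (C (x i) : R[X])) ^ n = Ideal.map C (sp x ^ n) := by
    intro n
    rw [Ideal.map_pow, sp, sp, Ideal.map_span, ← Set.range_comp]; rfl
  intro n p hp he m
  rw [hsp, Ideal.mem_map_C_iff] at he
  have h1 := hsp 1
  rw [pow_one, pow_one] at h1
  rw [h1, Ideal.mem_map_C_iff]
  intro k
  let q : MvPolynomial ι R := ∑ m ∈ p.support, MvPolynomial.monomial m ((p.coeff m).coeff k)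
  have hq : q.IsHomogeneous n := by
    refine MvPolynomial.IsHomogeneous.sum _ _ _ fun j hj => MvPolynomial.isHomogeneous_monomial _ ?_
    have := hp (MvPolynomial.mem_support_iff.1 hj)
    rw [Finsupp.degree_eq_weight_one]; exact this
  have hqc : q.coeff m = (p.coeff m).coeff k := by
    simp only [q, MvPolynomial.coeff_sum, MvPolynomial.coeff_monomial]
    rw [Finset.sum_ite_eq' p.support m]
    split_ifs with h
    · rfl
    · rw [MvPolynomial.notMem_support_iff.1 h, coeff_zero]
  rw [← hqc]
  refine hx n q hq ?_ m
  have : MvPolynomial.eval x q = (MvPolynomial.eval (fun i => (C (x i) : R[X])) p).coeff k := by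
    rw [MvPolynomial.eval_eq (fun i => (C (x i) : R[X])), Polynomial.finsetSum_coeff]
    simp only [q, map_sum, MvPolynomial.eval_monomial]
    refine Finset.sum_congr rfl fun m _ => ?_
    rw [Finsupp.prod]
    simp only [← C_pow]
    rw [← map_prod, coeff_mul_C]
  rw [this]; exact he k

section
variable {R : Type*} [CommRing R] [IsLocalRing R]

theorem SL.denom {P : Type*} [CommRing P] {ψ : R[X] →+* P} {y : R[X]} (h : SL ψ y) {ι : Type*} (s : Finset ι) (f : ι → P) :
    ∃ g, UC g ∧ ∀ i ∈ s, ∃ α, ψ g * f i = ψ α := by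
  classical
  induction s using Finset.induction_on with
  | empty => exact ⟨1, UC.one, by simp⟩
  | insert a s _ ih =>
    obtain ⟨g, hg, H⟩ := ih
    obtain ⟨α, g', hg', e⟩ := h.surj (f a)
    refine ⟨g * g', hg.mul hg', fun i hi => ?_⟩
    rcases Finset.mem_insert.1 hi with rfl | hi
    · exact ⟨g * α, by rw [map_mul, map_mul, mul_assoc, e]⟩
    · obtain ⟨β, hβ⟩ := H i hi
      exact ⟨g' * β, by rw [map_mul, map_mul, ← hβ]; ring⟩

theorem SL.qr0 {P : Type*} [CommRing P] {ψ : R[X] →+* P} (h : SL ψ 0) {ι : Type*} {x : ι → R} (hx : QR x) :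
    QR (fun i => (ψ.comp C) (x i)) := by
  classical
  have hsp : ∀ n, sp (fun i => (ψ.comp C) (x i)) ^ n = Ideal.map (ψ.comp C) (sp x ^ n) := by
    intro n
    rw [Ideal.map_pow, sp, sp, Ideal.map_span, ← Set.range_comp]; rfl
  have hsp' : ∀ n, sp (fun i => (C (x i) : R[X])) ^ n = Ideal.map C (sp x ^ n) := by
    intro n
    rw [Ideal.map_pow, sp, sp, Ideal.map_span, ← Set.range_comp]; rfl
  intro n p hp he m
  obtain ⟨g, hg, H⟩ := h.denom p.support p.coeff
  choose! α hα using H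
  let q : MvPolynomial ι R[X] := ∑ m ∈ p.support, MvPolynomial.monomial m (α m)
  have hq : q.IsHomogeneous n := by
    refine MvPolynomial.IsHomogeneous.sum _ _ _ fun j hj => MvPolynomial.isHomogeneous_monomial _ ?_
    have := hp (MvPolynomial.mem_support_iff.1 hj)
    rw [Finsupp.degree_eq_weight_one]; exact this
  have hqe : ψ (MvPolynomial.eval (fun i => (C (x i) : R[X])) q) = ψ g * MvPolynomial.eval (fun i => (ψ.comp C) (x i)) p := by
    rw [MvPolynomial.eval_eq (fun i => (ψ.comp C) (x i)), Finset.mul_sum]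
    simp only [q, map_sum, MvPolynomial.eval_monomial]
    refine Finset.sum_congr rfl fun m hm => ?_
    rw [map_mul, ← hα m hm, Finsupp.prod, map_prod, mul_assoc]
    simp
  rw [hsp] at he
  have he2 : ψ (MvPolynomial.eval (fun i => (C (x i) : R[X])) q) ∈ Ideal.map (ψ.comp C) (sp x ^ (n + 1)) := by
    rw [hqe]; exact Ideal.mul_mem_left _ _ he
  rw [h.memC] at he2
  obtain ⟨g', hg', β, hβ, r, e⟩ := he2
  rw [mul_zero, add_zero] at e
  have h3 := qr_poly hx n (MvPolynomial.C g' * q) (by simpa using (MvPolynomial.isHomogeneous_C _ g').mul hq) (by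
    rw [map_mul, MvPolynomial.eval_C, e, hsp', Ideal.mem_map_C_iff]; exact hβ) m
  rw [MvPolynomial.coeff_C_mul] at h3
  by_cases hm : m ∈ p.support
  · have hqc : q.coeff m = α m := by
      simp only [q, MvPolynomial.coeff_sum, MvPolynomial.coeff_monomial]
      rw [Finset.sum_ite_eq' p.support m, if_pos hm]
    rw [hqc] at h3
    have h1 := hsp' 1
    rw [pow_one, pow_one] at h1
    have h2 := hsp 1
    rw [pow_one, pow_one] at h2
    have h4 := Ideal.mem_map_of_mem ψ h3
    rw [h1, Ideal.map_map, ← h2, map_mul, ← hα m hm, Ideal.unit_mul_mem_iff_mem _ (h.unit g' hg'),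
      Ideal.unit_mul_mem_iff_mem _ (h.unit g hg)] at h4
    exact h4
  · rw [MvPolynomial.notMem_support_iff.1 hm]; exact zero_mem _

end

theorem qr_tail {P S : Type*} [CommRing P] [CommRing S] {k : ℕ} {x : Fin (k + 1) → P} (hx : QR x) (π : P →+* S)
    (hπ : Function.Surjective π) (hk : RingHom.ker π = Ideal.span {x 0}) :
    QR (fun i : Fin k => π (x i.succ)) := by
  classical
  have h0 : π (x 0) = 0 := by
    rw [← RingHom.mem_ker, hk]; exact Ideal.mem_span_singleton_self _
  have hsp : sp (fun i : Fin k => π (x i.succ)) = Ideal.map π (sp x) := by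
    rw [sp, sp, Ideal.map_span, ← Set.range_comp]
    apply le_antisymm
    · rw [Ideal.span_le]
      rintro _ ⟨i, rfl⟩
      exact Ideal.subset_span ⟨i.succ, rfl⟩
    · rw [Ideal.span_le]
      rintro _ ⟨i, rfl⟩
      refine Fin.cases ?_ (fun i => Ideal.subset_span ⟨i, rfl⟩) i
      rw [Function.comp, h0]; exact zero_mem _
  intro n p hp he m
  obtain ⟨p', hp'⟩ := MvPolynomial.map_surjective π hπ p
  let q := MvPolynomial.homogeneousComponent n p'
  have hq : q.IsHomogeneous n := MvPolynomial.homogeneousComponent_isHomogeneous _ _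
  have hqm : MvPolynomial.map π q = p := by
    ext m
    rw [MvPolynomial.coeff_map, MvPolynomial.coeff_homogeneousComponent]
    split_ifs with h
    · rw [← MvPolynomial.coeff_map, hp']
    · rw [map_zero, hp.coeff_eq_zero h]
  let r := MvPolynomial.rename (Fin.succ : Fin k → Fin (k+1)) q
  have hr : r.IsHomogeneous n := hq.rename_isHomogeneous
  have hre : MvPolynomial.eval x r ∈ mi x {β | 1 ≤ β 0} 0 ⊔ sp x ^ (n + 1) := by
    rw [mi_single, pow_one, ← hk, sup_comm, ← Ideal.comap_map_of_surjective' π hπ, Ideal.mem_comap, Ideal.map_pow, ← hsp]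
    convert he
    rw [← hqm, MvPolynomial.eval_rename, MvPolynomial.eval_map, MvPolynomial.eval, MvPolynomial.coe_eval₂Hom, MvPolynomial.eval₂_comp_left]
    rfl
  have h3 := Q5 hx {β | 1 ≤ β 0} (fun β hβ γ => by simp at hβ ⊢; omega) hr hre (Finsupp.mapDomain Fin.succ m) (by
    simp only [Set.mem_ofPred_eq, not_le, Nat.lt_one_iff]
    rw [Finsupp.mapDomain_of_notMem_range]
    simp)
  rw [MvPolynomial.coeff_rename_mapDomain _ (Fin.succ_injective k)] at h3
  rw [hsp, ← hqm, MvPolynomial.coeff_map]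
  exact Ideal.mem_map_of_mem _ h3

theorem qr_S {R : Type*} [CommRing R] [IsLocalRing R] {P S : Type*} [CommRing P] [CommRing S] {d : ℕ} {x : Fin (d + 2) → R} (hx : QR x)
    {ψ : R[X] →+* P} {π : P →+* S} (h : SL ψ 0) (hπ : Function.Surjective π) (hk : RingHom.ker π = Ideal.span {ψ (yy x)}) :
    QR (fun i : Fin (d + 1) => ((π.comp ψ).comp C) (x i.succ)) := by
  have h1 := h.qr0 hx
  have h2 : QR (Fin.cons (ψ (yy x)) (fun i : Fin (d + 1) => (ψ.comp C) (x i.succ)) : Fin (d + 2) → P) := by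
    refine qr_change h1 ?_
    have hyy : ψ (yy x) = ψ (C (x 0)) - ψ Polynomial.X * ψ (C (x 1)) := by rw [yy, map_sub, map_mul]
    apply le_antisymm
    · rw [sp, Ideal.span_le]
      have hs : ∀ i : Fin (d + 1), (ψ.comp C) (x i.succ) ∈ sp (Fin.cons (ψ (yy x)) (fun i : Fin (d + 1) => (ψ.comp C) (x i.succ)) : Fin (d + 2) → P) :=
        fun i => Ideal.subset_span ⟨i.succ, by simp⟩
      rintro _ ⟨i, rfl⟩
      refine Fin.cases ?_ (fun i => hs i) i
      have h0 : ψ (yy x) ∈ sp (Fin.cons (ψ (yy x)) (fun i : Fin (d + 1) => (ψ.comp C) (x i.succ)) : Fin (d + 2) → P) :=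
        Ideal.subset_span ⟨0, by simp⟩
      have : (ψ.comp C) (x 0) = ψ (yy x) + ψ Polynomial.X * ψ (C (x 1)) := by rw [hyy]; simp
      show (ψ.comp C) (x 0) ∈ _
      rw [this]
      exact Ideal.add_mem _ h0 (Ideal.mul_mem_left _ _ (hs 0))
    · rw [sp, Ideal.span_le]
      rintro _ ⟨i, rfl⟩
      have hs : ∀ i, (ψ.comp C) (x i) ∈ sp (fun i => (ψ.comp C) (x i)) := fun i => Ideal.subset_span ⟨i, rfl⟩
      refine Fin.cases ?_ (fun i => ?_) i
      · show ψ (yy x) ∈ _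
        rw [hyy]
        exact Ideal.sub_mem _ (hs 0) (Ideal.mul_mem_left _ _ (hs 1))
      · exact hs i.succ
  exact qr_tail h2 π hπ (by simpa using hk)

end NH

end

section
namespace NH

section
variable {R : Type*} [CommRing R] [IsLocalRing R] [IsNoetherianRing R] {d : ℕ} {x : Fin (d + 2) → R}

theorem yy_coeff_zero (h : R[X]) : (yy x * h).coeff 0 = x 0 * h.coeff 0 := by
  rw [yy, sub_mul, coeff_sub, coeff_C_mul, mul_assoc, coeff_X_mul_zero, sub_zero]

theorem yy_coeff_succ (h : R[X]) (i : ℕ) : (yy x * h).coeff (i + 1) = x 0 * h.coeff (i + 1) - x 1 * h.coeff i := by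
  rw [yy, sub_mul, coeff_sub, coeff_C_mul, mul_assoc, coeff_X_mul, coeff_C_mul]

theorem x_mem_NF (i : Fin (d + 2)) {n : ℕ} {a : R} (ha : a ∈ NF x n) : x i * a ∈ NF x (n + 1) := by
  rw [add_comm n 1]
  exact NF_mul (pow_le_NF 1 (by rw [pow_one]; exact Ideal.subset_span ⟨i, rfl⟩)) ha

theorem x_cancel (hx : QR x) {N : ℕ} (hN : maximalIdeal R ^ N ≤ sp x) (i : Fin (d + 2)) {n : ℕ} {a : R}
    (ha : x i * a ∈ NF x (n + 1)) : a ∈ NF x n :=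
  NF_cancel_x hx hN i 1 (by rw [pow_one]; exact ha)

theorem colon_poly (hx : QR x) {N : ℕ} (hN : maximalIdeal R ^ N ≤ sp x) {n : ℕ} {h : R[X]}
    (hh : ∀ i, (yy x * h).coeff i ∈ NF x (n + 1)) : ∀ i, h.coeff i ∈ NF x n := by
  intro i
  induction i with
  | zero =>
    have := hh 0
    rw [yy_coeff_zero] at this
    exact x_cancel hx hN 0 this
  | succ i ih =>
    have := hh (i + 1)
    rw [yy_coeff_succ] at this
    have h2 := Ideal.add_mem _ this (x_mem_NF 1 ih)
    rw [sub_add_cancel] at h2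
    exact x_cancel hx hN 0 h2

theorem yy_mul_mem {n : ℕ} {h : R[X]} (hh : ∀ i, h.coeff i ∈ NF x n) : ∀ i, (yy x * h).coeff i ∈ NF x (n + 1) := by
  intro i
  cases i with
  | zero => rw [yy_coeff_zero]; exact x_mem_NF 0 (hh 0)
  | succ i => rw [yy_coeff_succ]; exact Ideal.sub_mem _ (x_mem_NF 0 (hh _)) (x_mem_NF 1 (hh _))

theorem pow_le_NF' {N : ℕ} (hN : maximalIdeal R ^ N ≤ sp x) (n : ℕ) : maximalIdeal R ^ (N * n) ≤ NF x n := by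
  rw [pow_mul]
  exact (Ideal.pow_right_mono hN n).trans (pow_le_NF n)

theorem len_S {P S : Type*} [CommRing P] [IsLocalRing P] [CommRing S] (hx : QR x) {N : ℕ} (hN : maximalIdeal R ^ N ≤ sp x)
    {ψ : R[X] →+* P} {π : P →+* S} (h : SL ψ 0) (hπ : Function.Surjective π) (hk : RingHom.ker π = Ideal.span {ψ (yy x)}) (n : ℕ) :
    rl (NF x (n + 1)) ⊤ = rl (NF x n) ⊤ + rl (Ideal.map ((π.comp ψ).comp C) (NF x (n + 1))) ⊤ := by
  rw [← h.rl0 (NF x (n + 1)) (pow_le_NF' hN _), ← h.rl0 (NF x n) (pow_le_NF' hN _),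
    rl_colon (Ideal.map (ψ.comp C) (NF x (n + 1))) (Ideal.map (ψ.comp C) (NF x n)) (ψ (yy x))]
  · congr 1
    rw [RingHom.comp_assoc, ← Ideal.map_map (ψ.comp C) π, rl_quot π hπ, hk]
  · intro a
    obtain ⟨α, g, hg, e⟩ := h.surj a
    rw [h.unit_mem hg e, h.unit_mem hg (s := ψ (yy x) * a) (α := yy x * α) (by rw [map_mul, ← e]; ring), h.memC, h.memC]
    constructor
    · rintro ⟨g', hg', β, hβ, q, e'⟩
      rw [mul_zero, add_zero] at e'
      refine ⟨g', hg', g' * α, colon_poly hx hN ?_, 0, by simp⟩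
      rw [show yy x * (g' * α) = β by rw [← e']; ring]
      exact hβ
    · rintro ⟨g', hg', β, hβ, q, e'⟩
      rw [mul_zero, add_zero] at e'
      refine ⟨g', hg', yy x * β, yy_mul_mem hβ, 0, by rw [← e']; ring⟩

def SUPR {R : Type*} [CommRing R] {d : ℕ} (x : Fin (d + 2) → R) (n0 : ℕ) : Prop :=
  ∀ k ≥ n0, ∀ r ∈ NF x (k + 1), ∀ u ∈ NF x (k + 1), ∀ f ∈ NF x (k + 3), x 0 * r = x 1 * u + f →
    ∃ w ∈ NF x k, ∃ f' ∈ NF x (k + 2), r = x 1 * w + f'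

variable {S : Type*} [CommRing S] {ψ : R[X] →+* S}

theorem SL.sup (h : SL ψ (yy x)) (hx : QR x) {N : ℕ} (hN : maximalIdeal R ^ N ≤ sp x) {n0 : ℕ} (hs : SUPR x n0)
    {k : ℕ} (hk : n0 ≤ k) {a : S} (ha : a ∈ Ideal.map (ψ.comp C) (NF x (k + 1)))
    (hxa : ψ (C (x 1)) * a ∈ Ideal.map (ψ.comp C) (NF x (k + 3))) : a ∈ Ideal.map (ψ.comp C) (NF x (k + 2)) := by
  rw [map_C_map] at ha
  obtain ⟨g, α, hg, hα, e⟩ := h.mem_map ha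
  rw [h.unit_mem hg e]
  rw [h.unit_mem hg (s := ψ (C (x 1)) * a) (α := C (x 1) * α) (by rw [map_mul, ← e]; ring), h.memC] at hxa
  rw [Ideal.mem_map_C_iff] at hα
  obtain ⟨g', hg', β, hβ, q, e'⟩ := hxa
  have hα' : ∀ i, (g' * α).coeff i ∈ NF x (k + 1) :=
    Ideal.mem_map_C_iff.1 (Ideal.mul_mem_left _ _ (Ideal.mem_map_C_iff.2 hα))
  have ee : C (x 1) * (g' * α) = β + yy x * q := by rw [mul_comm (yy x), ← e']; ring
  have hq : ∀ i, q.coeff i ∈ NF x (k + 1) := by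
    refine colon_poly hx hN (n := k + 1) ?_
    have h1 : yy x * q = C (x 1) * (g' * α) - β := by rw [ee]; ring
    rw [h1]
    intro i
    rw [coeff_sub, coeff_C_mul]
    exact Ideal.sub_mem _ (x_mem_NF 1 (hα' i)) (NF_anti (by omega) (hβ i))
  let qq : ℕ → R := fun i => match i with
    | 0 => 0
    | i + 1 => q.coeff i
  have hqq : ∀ i, qq i ∈ NF x (k + 1) := by
    intro i
    cases i with
    | zero => exact zero_mem _
    | succ i => exact hq i
  have hrel : ∀ i, x 0 * q.coeff i = x 1 * ((g' * α).coeff i + qq i) + (- β.coeff i) := by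
    intro i
    have h1 := congrArg (fun p => coeff p i) ee
    simp only [coeff_C_mul, coeff_add] at h1
    cases i with
    | zero => rw [yy_coeff_zero] at h1; simp only [qq]; linear_combination -h1
    | succ i => rw [yy_coeff_succ] at h1; simp only [qq]; linear_combination -h1
  have hw : ∀ i, ∃ w ∈ NF x k, ∃ f' ∈ NF x (k + 2), q.coeff i = x 1 * w + f' ∧ (q.coeff i = 0 → w = 0) := by
    intro i
    by_cases h0 : q.coeff i = 0
    · exact ⟨0, zero_mem _, 0, zero_mem _, by rw [h0]; simp, fun _ => rfl⟩
    · obtain ⟨w, hw, f', hf', e⟩ := hs k hk _ (hq i) _ (Ideal.add_mem _ (hα' i) (hqq i)) _ (Ideal.neg_mem_iff _ |>.2 (hβ i)) (hrel i)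
      exact ⟨w, hw, f', hf', e, fun h => absurd h h0⟩
  choose w hw f' hf' hwe hw0 using hw
  let W : R[X] := ∑ i ∈ Finset.range (q.natDegree + 1), monomial i (w i)
  have hW : ∀ i, W.coeff i = w i := by
    intro i
    simp only [W, Polynomial.finsetSum_coeff, coeff_monomial]
    rw [Finset.sum_ite_eq' (Finset.range (q.natDegree + 1)) i]
    split_ifs with hi
    · rfl
    · rw [hw0 i (coeff_eq_zero_of_natDegree_lt (by simp at hi; omega))]
  rw [h.memC]
  refine ⟨g', hg', g' * α - yy x * W, fun i => ?_, W, by ring⟩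
  have key : x 1 * ((g' * α).coeff i + qq i - x 0 * w i) ∈ NF x (k + 2 + 1) := by
    have : x 1 * ((g' * α).coeff i + qq i - x 0 * w i) = x 0 * f' i + β.coeff i := by
      have h1 := hrel i
      rw [hwe i] at h1
      linear_combination -h1
    rw [this]
    exact Ideal.add_mem _ (x_mem_NF 0 (hf' i)) (hβ i)
  have key := x_cancel hx hN 1 key
  rw [coeff_sub]
  cases i with
  | zero =>
    rw [yy_coeff_zero, hW]
    simpa [qq] using key
  | succ i =>
    rw [yy_coeff_succ, hW, hW]
    have h1 := hwe i
    have : (g' * α).coeff (i + 1) - (x 0 * w (i + 1) - x 1 * w i) = ((g' * α).coeff (i + 1) + qq (i + 1) - x 0 * w (i + 1)) - f' i := by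
      simp only [qq]; rw [h1]; ring
    rw [this]
    exact Ideal.sub_mem _ key (hf' i)

theorem SL.descent1 (h : SL ψ (yy x)) (hx : QR x) {N : ℕ} (hN : maximalIdeal R ^ N ≤ sp x) {n0 : ℕ} (hs : SUPR x n0)
    {k : ℕ} (hk : n0 + 1 ≤ k) {a : S} (ha : a ∈ Ideal.map (ψ.comp C) (NF x k)) (l : ℕ)
    (hxa : ψ (C (x 1)) * a ∈ Ideal.map (ψ.comp C) (NF x (k + l + 1))) : a ∈ Ideal.map (ψ.comp C) (NF x (k + l)) := by
  induction l with
  | zero => exact ha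
  | succ l ih =>
    have h1 := ih (Ideal.map_mono (NF_anti (by omega)) hxa)
    obtain ⟨k', hk'⟩ : ∃ k', k + l = k' + 1 := ⟨k + l - 1, by omega⟩
    have h2 : k + (l + 1) + 1 = k' + 3 := by omega
    have h3 : k + (l + 1) = k' + 2 := by omega
    rw [h2] at hxa
    rw [hk'] at h1
    rw [h3]
    exact h.sup hx hN hs (by omega) h1 hxa

theorem SL.descent (h : SL ψ (yy x)) (hx : QR x) {N : ℕ} (hN : maximalIdeal R ^ N ≤ sp x) {n0 : ℕ} (hs : SUPR x n0)
    {k : ℕ} (hk : n0 + 1 ≤ k) {a : S} (ha : a ∈ Ideal.map (ψ.comp C) (NF x k)) {l : ℕ} (D : ℕ)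
    (hxa : ψ (C (x 1)) ^ D * a ∈ Ideal.map (ψ.comp C) (NF x (k + l + D))) : a ∈ Ideal.map (ψ.comp C) (NF x (k + l)) := by
  induction D with
  | zero => simpa using hxa
  | succ D ih =>
    apply ih
    have := h.descent1 hx hN hs hk (Ideal.mul_mem_left _ (ψ (C (x 1)) ^ D) ha) (l + D) (by
      rw [show k + (l + D) + 1 = k + l + (D + 1) by omega, ← mul_assoc, ← pow_succ']; exact hxa)
    rwa [← add_assoc] at this

end

section
variable {R : Type*} [CommRing R] [IsLocalRing R] [IsNoetherianRing R] {d : ℕ} {x : Fin (d + 2) → R}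
variable {S : Type*} [CommRing S] [IsNoetherianRing S] {ψ : R[X] →+* S}

theorem SL.spn (h : SL ψ (yy x)) (n : ℕ) : sp (fun i : Fin (d + 1) => (ψ.comp C) (x i.succ)) ^ n = Ideal.map (ψ.comp C) (sp x ^ n) := by
  rw [h.sp_eq, Ideal.map_pow]

theorem SL.reesS [IsLocalRing S] (h : SL ψ (yy x)) (hx : QR x) {N : ℕ} (hN : maximalIdeal R ^ N ≤ sp x) (hm : sp x ≤ maximalIdeal R)
    (hx' : QR (fun i : Fin (d + 1) => (ψ.comp C) (x i.succ)))
    (hN' : maximalIdeal S ^ N ≤ sp (fun i : Fin (d + 1) => (ψ.comp C) (x i.succ)))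
    {c : ℕ} (hc : ∀ n, NF x (n + c) ≤ sp x ^ n) (n : ℕ) :
    NF (fun i : Fin (d + 1) => (ψ.comp C) (x i.succ)) (n + c) ≤ sp (fun i : Fin (d + 1) => (ψ.comp C) (x i.succ)) ^ n := by
  intro s hs
  obtain ⟨α, g, hg, e⟩ := h.surj s
  rw [h.unit_mem hg e] at hs ⊢
  have hd := hA_dvd (x := x) (α := α) le_rfl
  have h1 := h.val hx hN hm hs hd
  have h2 := hc (n + α.natDegree) (NF_anti (by omega) h1)
  refine q1 hx' hN' (G := MvPolynomial.monomial (Finsupp.single 0 α.natDegree) 1)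
    (MvPolynomial.isHomogeneous_monomial _ (by rw [Finsupp.degree_single])) ⟨Finsupp.single 0 α.natDegree, by simp⟩ ?_
  rw [MvPolynomial.eval_monomial, one_mul, ← xm, xm_single]
  obtain ⟨q, hq⟩ := hd
  have h3 := congrArg ψ hq
  rw [map_sub, map_mul, map_pow, map_mul, h.hy, zero_mul, sub_eq_zero] at h3
  show ψ (C (x 1)) ^ α.natDegree * ψ α ∈ _
  rw [h3, h.spn]
  exact Ideal.mem_map_of_mem (ψ.comp C) h2

theorem SL.NF_eq (h : SL ψ (yy x)) (hx : QR x) {N : ℕ} (hN : maximalIdeal R ^ N ≤ sp x) (hm : sp x ≤ maximalIdeal R)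
    {c : ℕ} (hc : ∀ n, NF (fun i : Fin (d + 1) => (ψ.comp C) (x i.succ)) (n + c) ≤ sp (fun i : Fin (d + 1) => (ψ.comp C) (x i.succ)) ^ n)
    {n0 : ℕ} (hs : SUPR x n0) {n : ℕ} (hn : n0 + 1 + c ≤ n) :
    NF (fun i : Fin (d + 1) => (ψ.comp C) (x i.succ)) n = Ideal.map (ψ.comp C) (NF x n) := by
  apply le_antisymm
  · intro s hs'
    obtain ⟨α, g, hg, e⟩ := h.surj s
    rw [h.unit_mem hg e] at hs' ⊢
    have hd := hA_dvd (x := x) (α := α) le_rfl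
    have h1 := h.val hx hN hm hs' hd
    obtain ⟨k, rfl⟩ : ∃ k, n = k + c := ⟨n - c, by omega⟩
    have h2 := hc k hs'
    rw [h.spn] at h2
    refine h.descent hx hN hs (k := k) (by omega) (Ideal.map_mono (pow_le_NF k) h2) α.natDegree ?_
    obtain ⟨q, hq⟩ := hd
    have h3 := congrArg ψ hq
    rw [map_sub, map_mul, map_pow, map_mul, h.hy, zero_mul, sub_eq_zero] at h3
    rw [h3]
    exact Ideal.mem_map_of_mem (ψ.comp C) h1
  · rw [Ideal.map_le_iff_le_comap]
    intro a ha
    rw [Ideal.mem_comap, mem_NF, h.spn]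
    exact (mem_NF.1 ha).map _

end
end NH

end

section
namespace NH

theorem hp_num (k n : ℕ) (e : ℕ → ℤ) :
    (∑ i ∈ Finset.range (k + 1 + 1), (-1 : ℤ) ^ i * e i * ((n + 1 + (k + 1) - i).choose (k + 1 - i)))
      - (∑ i ∈ Finset.range (k + 1 + 1), (-1 : ℤ) ^ i * e i * ((n + (k + 1) - i).choose (k + 1 - i)))
    = ∑ i ∈ Finset.range (k + 1), (-1 : ℤ) ^ i * e i * ((n + 1 + k - i).choose (k - i)) := by
  rw [← Finset.sum_sub_distrib, Finset.sum_range_succ]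
  have : (-1 : ℤ) ^ (k + 1) * e (k + 1) * ((n + 1 + (k + 1) - (k + 1)).choose (k + 1 - (k + 1)) : ℕ) -
      (-1 : ℤ) ^ (k + 1) * e (k + 1) * ((n + (k + 1) - (k + 1)).choose (k + 1 - (k + 1)) : ℕ) = 0 := by simp
  rw [this, add_zero]
  refine Finset.sum_congr rfl fun i hi => ?_
  rw [Finset.mem_range] at hi
  have h1 : n + 1 + (k + 1) - i = (n + 1 + k - i) + 1 := by omega
  have h2 : k + 1 - i = (k - i) + 1 := by omega
  have h3 : n + (k + 1) - i = n + 1 + k - i := by omega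
  rw [h1, h2, h3, Nat.choose_succ_succ']
  push_cast; ring

theorem hp_step {R S : Type*} [CommRing R] [CommRing S] {k : ℕ} {x : Fin (k + 1) → R} {x' : Fin k → S} (h : HP x) {M : ℕ}
    (hs : ∀ n ≥ M, rl (NF x (n + 1)) ⊤ = rl (NF x n) ⊤ + rl (NF x' (n + 1)) ⊤) : HP x' := by
  obtain ⟨e, N, he, H⟩ := h
  refine ⟨e, max M N + 1, he, fun n hn => ?_⟩
  obtain ⟨m, rfl⟩ : ∃ m, n = m + 1 := ⟨n - 1, by omega⟩
  have hM : M ≤ m + 1 := by omega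
  have hN : N ≤ m := by omega
  obtain ⟨l1, hl1, e1⟩ := H m hN
  obtain ⟨l2, hl2, e2⟩ := H (m + 1) (by omega)
  have h1 := hs (m + 1) hM
  rw [hl1, hl2] at h1
  have h3 : rl (NF x' (m + 1 + 1)) ⊤ ≠ ⊤ := by
    intro ht
    rw [ht, add_top] at h1
    exact ENat.natCast_ne_top _ h1
  obtain ⟨l, hl⟩ := ENat.ne_top_iff_exists.1 h3
  refine ⟨l, hl.symm, ?_⟩
  rw [← hl] at h1
  have h4 : l2 = l1 + l := by exact_mod_cast h1
  have h5 : (l : ℤ) = l2 - l1 := by rw [h4]; push_cast; ring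
  rw [h5, e1, e2]
  exact hp_num k m e

universe u

def Cl (k : ℕ) : Prop := ∀ (R : Type u) [CommRing R] [IsLocalRing R] [IsNoetherianRing R] [Infinite (ResidueField R)]
  (x : Fin k → R), QR x → ∀ N, maximalIdeal R ^ N ≤ sp x → sp x ≤ maximalIdeal R →
    (∃ c, ∀ n, NF x (n + c) ≤ sp x ^ n) → HP x → ∀ n, NF x (n + 2) ≤ sp x ^ n

theorem cl_three : Cl.{u} 3 := by
  intro R _ _ _ _ x hx N hN hm hc h n
  obtain ⟨c, hc⟩ := hc
  exact claim3 hx hc hm hN h n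

theorem cl_step {d : ℕ} (IH : Cl.{u} (d + 1)) {R : Type u} [CommRing R] [IsLocalRing R] [IsNoetherianRing R] [Infinite (ResidueField R)]
    {x : Fin (d + 2) → R} (hx : QR x) {N : ℕ} (hN : maximalIdeal R ^ N ≤ sp x) (hm : sp x ≤ maximalIdeal R)
    (hc : ∃ c, ∀ n, NF x (n + c) ≤ sp x ^ n) (hh : HP x) {n0 : ℕ} (hs : SUPR x n0) (n : ℕ) : NF x (n + 2) ≤ sp x ^ n := by
  have hxm : ∀ i, x i ∈ maximalIdeal R := fun i => hm (Ideal.subset_span ⟨i, rfl⟩)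
  have hy : ∀ i, (yy x).coeff i ∈ maximalIdeal R := by
    rw [← Ideal.mem_map_C_iff]
    exact Ideal.sub_mem _ (Ideal.mem_map_of_mem _ (hxm 0)) (Ideal.mul_mem_left _ _ (Ideal.mem_map_of_mem _ (hxm 1)))
  obtain ⟨P, S, _, _, _, _, _, _, ψ, π, h0, hπ, hk, h⟩ := exists_SL (yy x) hy
  have hx' := qr_S hx h0 hπ hk
  have hloc := h.local hy
  have hN' : maximalIdeal S ^ N ≤ sp (fun i : Fin (d + 1) => ((π.comp ψ).comp C) (x i.succ)) := by
    rw [hloc, h.sp_eq, ← Ideal.map_pow]; exact Ideal.map_mono hN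
  have hm' : sp (fun i : Fin (d + 1) => ((π.comp ψ).comp C) (x i.succ)) ≤ maximalIdeal S := by
    rw [hloc, h.sp_eq]; exact Ideal.map_mono hm
  obtain ⟨c, hc⟩ := hc
  have hc' := h.reesS hx hN hm hx' hN' hc
  have hHP : HP (fun i : Fin (d + 1) => ((π.comp ψ).comp C) (x i.succ)) := by
    refine hp_step hh (M := n0 + 1 + c) fun n hn => ?_
    rw [h.NF_eq hx hN hm hc' hs (by omega)]
    exact len_S hx hN h0 hπ hk n
  have hloch : IsLocalHom ((π.comp ψ).comp C) := by
    refine ⟨fun a ha => ?_⟩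
    by_contra hna
    have : ((π.comp ψ).comp C) a ∈ maximalIdeal S := by
      rw [hloc]; exact Ideal.mem_map_of_mem _ hna
    exact this ha
  have hinf : Infinite (ResidueField S) :=
    Infinite.of_injective (ResidueField.map ((π.comp ψ).comp C)) (RingHom.injective _)
  have := IH S _ hx' N hN' hm' ⟨c, hc'⟩ hHP n
  intro a ha
  refine h.contr hx hN hm ?_
  rw [← h.spn]
  apply this
  rw [mem_NF, h.spn]
  exact (mem_NF.1 ha).map _

end NH

end

section
namespace NH

theorem ass_kill {A Q : Type*} [CommRing A] [IsNoetherianRing A] [AddCommGroup Q] [Module A Q] [Module.Finite A Q] (B : Ideal A) (ζ : A)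
    (h : ∀ P ∈ associatedPrimes A Q, ζ ∈ P → B ≤ P) : ∃ s : ℕ, ∀ q : Q, ζ • q = 0 → ∀ a ∈ B ^ s, a • q = 0 := by
  let K := LinearMap.ker (LinearMap.lsmul A Q ζ)
  have hζ : ζ ∈ Module.annihilator A K := by
    rw [Module.mem_annihilator]
    rintro ⟨q, hq⟩
    exact Subtype.ext hq
  have h1 : B ≤ (Module.annihilator A K).radical := by
    rw [← Ideal.sInf_minimalPrimes, le_sInf_iff]
    intro P hP
    have h2 := Module.associatedPrimes.minimalPrimes_annihilator_subset_associatedPrimes A K hP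
    refine h P (associatedPrimes.subset_of_injective (f := K.subtype) (Submodule.subtype_injective _) h2) (hP.1.2 hζ)
  obtain ⟨s, hs⟩ := Ideal.exists_pow_le_of_le_radical_of_fg h1 (IsNoetherian.noetherian B)
  refine ⟨s, fun q hq a ha => ?_⟩
  have := Module.mem_annihilator.1 (hs ha) ⟨q, hq⟩
  exact congrArg Subtype.val this

open scoped Pointwise in
theorem avoid {R : Type*} [CommRing R] [IsLocalRing R] [Infinite (ResidueField R)] (J : Ideal R) {ι : Type*} (s : Finset ι) (W : ι → Ideal R)
    (h2 : ∀ i ∈ s, ¬ J ≤ W i) : ∃ z ∈ J, ∀ i ∈ s, z ∉ W i := by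
  by_contra hcon
  push Not at hcon
  let H : ι → AddSubgroup J := fun i => (W i).toAddSubgroup.comap (J.subtype.toAddMonoidHom)
  have hcov : ⋃ i ∈ s, (0 : J) +ᵥ (H i : Set J) = Set.univ := by
    rw [Set.eq_univ_iff_forall]
    rintro ⟨z, hz⟩
    obtain ⟨i, hi, hzi⟩ := hcon z hz
    rw [Set.mem_iUnion₂]
    exact ⟨i, hi, by rw [zero_vadd]; exact hzi⟩
  obtain ⟨k, hk, hfi⟩ := AddSubgroup.exists_finiteIndex_of_leftCoset_cover hcov
  obtain ⟨u, huJ, huW⟩ := Set.not_subset.1 (h2 k hk)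
  let f : ResidueField R → J ⧸ H k := fun c => QuotientAddGroup.mk ⟨(residue_surjective c).choose * u, J.mul_mem_left _ huJ⟩
  have hf : Function.Injective f := by
    intro c c' hcc
    have h3 : ((residue_surjective c).choose * u) - ((residue_surjective c').choose * u) ∈ W k := by
      have := QuotientAddGroup.eq.1 hcc.symm
      have h4 : -((residue_surjective c').choose * u) + (residue_surjective c).choose * u ∈ W k := this
      rwa [neg_add_eq_sub] at h4
    rw [← sub_mul] at h3
    rw [← (residue_surjective c).choose_spec, ← (residue_surjective c').choose_spec, ← sub_eq_zero, ← map_sub, residue_eq_zero_iff]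
    by_contra hnm
    rw [mem_maximalIdeal, mem_nonunits_iff, not_not] at hnm
    rw [Ideal.unit_mul_mem_iff_mem _ hnm] at h3
    exact huW h3
  have : Finite (J ⧸ H k) := AddSubgroup.finite_quotient_of_finiteIndex
  exact not_injective_infinite_finite f hf

end NH

end

section
namespace NH

section
variable {R : Type*} [CommRing R] {J : Ideal R}

noncomputable def GrM (J : Ideal R) (f : ℕ → Ideal R) (hf : ∀ i n, J ^ i * f n ≤ f (i + n)) : Submodule (reesAlgebra J) R[X] where
  carrier := {p | ∀ n, p.coeff n ∈ f n}
  add_mem' := fun ha hb n => by rw [coeff_add]; exact Ideal.add_mem _ (ha n) (hb n)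
  zero_mem' := fun n => by rw [coeff_zero]; exact zero_mem _
  smul_mem' := by
    rintro ⟨a, ha⟩ p hp n
    show (a * p).coeff n ∈ f n
    rw [coeff_mul]
    refine Ideal.sum_mem _ fun ij hij => ?_
    rw [← Finset.HasAntidiagonal.mem_antidiagonal.1 hij]
    exact hf _ _ (Ideal.mul_mem_mul (ha _) (hp _))

theorem mem_GrM {f : ℕ → Ideal R} {hf : ∀ i n, J ^ i * f n ≤ f (i + n)} {p : R[X]} :
    p ∈ GrM J f hf ↔ ∀ n, p.coeff n ∈ f n := Iff.rfl

theorem GrM_noeth [IsNoetherianRing R] {f : ℕ → Ideal R} (hf : ∀ i n, J ^ i * f n ≤ f (i + n)) {c : ℕ} (hc : ∀ n, f (n + c) ≤ J ^ n) :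
    IsNoetherian (reesAlgebra J) (GrM J f hf) := by
  let T : Set R[X] := (fun i : ℕ => (Polynomial.X : R[X]) ^ i) '' (Set.Iic c)
  have hT : T.Finite := (Set.finite_Iic c).image _
  have h1 : IsNoetherian (reesAlgebra J) (Submodule.span (reesAlgebra J) T) := isNoetherian_span_of_finite _ hT
  refine isNoetherian_of_le (t := Submodule.span (reesAlgebra J) T) ?_
  intro p hp
  rw [p.as_sum_range_C_mul_X_pow]
  refine Submodule.sum_mem _ fun n _ => ?_
  rw [C_mul_X_pow_eq_monomial]
  have key : ∀ i j : ℕ, j ≤ c → ∀ b ∈ J ^ i, (monomial (i + j) b : R[X]) ∈ Submodule.span (reesAlgebra J) T := by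
    intro i j hj b hb
    have := Submodule.smul_mem (Submodule.span (reesAlgebra J) T) (⟨monomial i b, reesAlgebra.monomial_mem.2 hb⟩ : reesAlgebra J)
      (Submodule.subset_span (show (Polynomial.X : R[X]) ^ j ∈ T from ⟨j, hj, rfl⟩))
    have e : (monomial (i + j) b : R[X]) = monomial i b * Polynomial.X ^ j := by
      rw [← C_mul_X_pow_eq_monomial, ← C_mul_X_pow_eq_monomial, pow_add, mul_assoc]
    rw [e]; exact this
  by_cases hn : n ≤ c
  · have := key 0 n hn (p.coeff n) (by simp)
    rwa [zero_add] at this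
  · obtain ⟨k, rfl⟩ : ∃ k, n = k + c := ⟨n - c, by omega⟩
    exact key k c le_rfl _ (hc k (hp (k + c)))

noncomputable def Ap (J : Ideal R) : Ideal (reesAlgebra J) := Ideal.span {a | ∃ u ∈ J, (a : R[X]) = monomial 1 u}

theorem mono_mem_Ap (s : ℕ) : ∀ (t : ℕ) (b : R) (hb : b ∈ J ^ (s + t)),
    (⟨monomial (s + t) b, reesAlgebra.monomial_mem.2 hb⟩ : reesAlgebra J) ∈ Ap J ^ s := by
  induction s with
  | zero => intro t b hb; simp
  | succ s ih =>
    intro t b hb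
    suffices H : ∀ b ∈ J * J ^ (s + t), ∃ a ∈ Ap J ^ (s + 1), (a : R[X]) = monomial (s + 1 + t) b by
      obtain ⟨a, ha, e⟩ := H b (by rw [← pow_succ', show s + t + 1 = s + 1 + t by omega]; exact hb)
      convert ha
      exact e.symm
    intro b hb
    refine Submodule.mul_induction_on hb ?_ ?_
    · intro u hu v hv
      refine ⟨⟨monomial 1 u, reesAlgebra.monomial_mem.2 (by rw [pow_one]; exact hu)⟩ * ⟨monomial (s + t) v, reesAlgebra.monomial_mem.2 hv⟩, ?_, ?_⟩
      · rw [pow_succ']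
        exact Ideal.mul_mem_mul (Ideal.subset_span ⟨u, hu, rfl⟩) (ih t v hv)
      · show monomial 1 u * monomial (s + t) v = _
        rw [monomial_mul_monomial, show 1 + (s + t) = s + 1 + t by omega]
    · rintro v w ⟨a, ha, e⟩ ⟨a', ha', e'⟩
      exact ⟨a + a', Ideal.add_mem _ ha ha', by
        rw [map_add, ← e, ← e']; rfl⟩

noncomputable def JP (P : Ideal (reesAlgebra J)) : Ideal R where
  carrier := {u | ∃ a ∈ P, (a : R[X]) = monomial 1 u}
  zero_mem' := ⟨0, zero_mem _, by rw [map_zero]; rfl⟩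
  add_mem' := by
    rintro u v ⟨a, ha, e⟩ ⟨b, hb, e'⟩
    exact ⟨a + b, Ideal.add_mem _ ha hb, by rw [map_add, ← e, ← e']; rfl⟩
  smul_mem' := by
    rintro r u ⟨a, ha, e⟩
    refine ⟨algebraMap R (reesAlgebra J) r * a, Ideal.mul_mem_left _ _ ha, ?_⟩
    show C r * (a : R[X]) = _
    rw [e, C_mul_monomial, smul_eq_mul]

theorem Ap_le {P : Ideal (reesAlgebra J)} (h : J ≤ JP P) : Ap J ≤ P := by
  rw [Ap, Ideal.span_le]
  rintro a ⟨u, hu, e⟩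
  obtain ⟨a', ha', e'⟩ := h hu
  have : a = a' := Subtype.ext (e.trans e'.symm)
  rw [this]; exact ha'

theorem fin_kill {A P : Type*} [CommRing A] [IsNoetherianRing A] [AddCommGroup P] [Module A P] (F G : Submodule A P) [IsNoetherian A F]
    (Ap : Ideal A) : ∃ T : Finset (Ideal A), (∀ p ∈ T, ¬ Ap ≤ p) ∧ ∀ ζ : A, (∀ p ∈ T, ζ ∉ p) →
      ∃ s, ∀ t ∈ F, ζ • t ∈ G → ∀ a ∈ Ap ^ s, a • t ∈ G := by
  classical
  let Q := F ⧸ Submodule.comap F.subtype G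
  have hfin : (associatedPrimes A Q).Finite := associatedPrimes.finite _ _
  refine ⟨hfin.toFinset.filter fun p => ¬ Ap ≤ p, fun p hp => (Finset.mem_filter.1 hp).2, fun ζ hζ => ?_⟩
  obtain ⟨s, hs⟩ := ass_kill (Q := Q) Ap ζ (by
    intro p hp hζp
    by_contra hA
    exact hζ p (Finset.mem_filter.2 ⟨hfin.mem_toFinset.2 hp, hA⟩) hζp)
  refine ⟨s, fun t ht htG a ha => ?_⟩
  have h2 := hs (Submodule.Quotient.mk ⟨t, ht⟩) (by
    rw [← Submodule.Quotient.mk_smul, Submodule.Quotient.mk_eq_zero]; exact htG) a ha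
  rw [← Submodule.Quotient.mk_smul, Submodule.Quotient.mk_eq_zero] at h2
  exact h2

theorem filt_reg [IsLocalRing R] [IsNoetherianRing R] [Infinite (ResidueField R)] {f g : ℕ → Ideal R} (hf : ∀ i n, J ^ i * f n ≤ f (i + n))
    (hg : ∀ i n, J ^ i * g n ≤ g (i + n)) {c : ℕ} (hc : ∀ n, f (n + c) ≤ J ^ n) (W : Ideal R) (hW : ¬ J ≤ W) :
    ∃ z ∈ J, z ∉ W ∧ ∃ n0, ∀ n ≥ n0, ∀ r ∈ f n, z * r ∈ g (n + 1) → r ∈ g n := by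
  classical
  have hn := GrM_noeth hf hc
  haveI hnr : IsNoetherianRing (reesAlgebra J) := inferInstance
  obtain ⟨T, hT, hT'⟩ := @fin_kill (reesAlgebra J) R[X] _ hnr _ _ (GrM J f hf) (GrM J g hg) hn (Ap J)
  let WW : Option (Ideal (reesAlgebra J)) → Ideal R := fun o => o.elim W JP
  obtain ⟨z, hz, hzW⟩ := avoid J (insert none (T.image some)) WW (by
    intro o ho
    rcases Finset.mem_insert.1 ho with rfl | ho
    · exact hW
    · obtain ⟨P, hP, rfl⟩ := Finset.mem_image.1 ho
      exact fun h => hT P hP (Ap_le h))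
  refine ⟨z, hz, hzW none (Finset.mem_insert_self _ _), ?_⟩
  let ζ : reesAlgebra J := ⟨monomial 1 z, reesAlgebra.monomial_mem.2 (by rw [pow_one]; exact hz)⟩
  obtain ⟨s, hs⟩ := hT' ζ (fun P hP hζ => hzW (some P)
    (Finset.mem_insert_of_mem (Finset.mem_image_of_mem _ hP)) ⟨ζ, hζ, rfl⟩)
  let K : Submodule (reesAlgebra J) (GrM J f hf) := Submodule.comap (LinearMap.lsmul (reesAlgebra J) (GrM J f hf) ζ) (Submodule.comap (GrM J f hf).subtype (GrM J g hg))
  obtain ⟨G, hG⟩ := IsNoetherian.noetherian K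
  let D := G.sup fun t => (t : R[X]).natDegree
  refine ⟨D + s, fun n hn r hr hzr => ?_⟩
  have hp : (monomial n r : R[X]) ∈ GrM J f hf := by
    intro k
    rw [coeff_monomial]
    split_ifs with h
    · rw [← h]; exact hr
    · exact zero_mem _
  have hpK : (⟨monomial n r, hp⟩ : GrM J f hf) ∈ Submodule.span (reesAlgebra J) (G : Set (GrM J f hf)) := by
    rw [hG]
    show (monomial 1 z * monomial n r : R[X]) ∈ GrM J g hg
    rw [monomial_mul_monomial]
    intro k
    rw [coeff_monomial]
    split_ifs with h
    · rw [← h, add_comm]; exact hzr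
    · exact zero_mem _
  obtain ⟨a, -, ha⟩ := Submodule.mem_span_finset.1 hpK
  have h1 := congrArg (fun p : GrM J f hf => (p : R[X]).coeff n) ha
  simp only [coeff_monomial, if_true] at h1
  rw [← h1, AddSubmonoidClass.coe_finsetSum, Polynomial.finsetSum_coeff]
  refine Ideal.sum_mem _ fun t ht => ?_
  show ((a t : R[X]) * (t : R[X])).coeff n ∈ g n
  rw [coeff_mul]
  refine Ideal.sum_mem _ ?_
  rintro ⟨i, j⟩ hij
  have hij := Finset.HasAntidiagonal.mem_antidiagonal.1 hij
  simp only at hij ⊢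
  have htD : (t : R[X]).natDegree ≤ D := Finset.le_sup (f := fun t : GrM J f hf => (t : R[X]).natDegree) ht
  by_cases hj : (t : R[X]).natDegree < j
  · rw [coeff_eq_zero_of_natDegree_lt hj, mul_zero]; exact zero_mem _
  obtain ⟨i', rfl⟩ : ∃ i', i = s + i' := ⟨i - s, by omega⟩
  have htK : t ∈ K := hG ▸ Submodule.subset_span ht
  have h2 := hs t t.2 htK _ (mono_mem_Ap s i' ((a t : R[X]).coeff (s + i')) ((a t).2 _))
  have h3 : (monomial (s + i') ((a t : R[X]).coeff (s + i')) * (t : R[X])).coeff n ∈ g n := h2 n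
  rwa [← hij, ← C_mul_X_pow_eq_monomial, mul_assoc, coeff_C_mul, add_comm (s + i') j, coeff_X_pow_mul, add_comm j, hij] at h3

end
end NH

end

section
namespace NH

universe u

theorem x0_notMem {R : Type*} [CommRing R] [IsLocalRing R] {d : ℕ} {x : Fin (d + 2) → R} (hx : QR x) (hm : sp x ≤ maximalIdeal R) :
    x 0 ∉ sp (Fin.tail x) := by
  intro h
  rw [sp, Ideal.mem_span_range_iff_exists_fun] at h
  obtain ⟨c, hc⟩ := h
  have h1 := hx 1 (MvPolynomial.X 0 - ∑ i : Fin (d + 1), MvPolynomial.C (c i) * MvPolynomial.X i.succ)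
    (by
      refine MvPolynomial.IsHomogeneous.sub (MvPolynomial.isHomogeneous_X _ _) (MvPolynomial.IsHomogeneous.sum _ _ _ fun i _ => ?_)
      simpa using (MvPolynomial.isHomogeneous_C (Fin (d + 2)) (c i)).mul (MvPolynomial.isHomogeneous_X R i.succ))
    (by
      simp only [map_sub, map_sum, map_mul, MvPolynomial.eval_X, MvPolynomial.eval_C]
      rw [← hc]
      simp [Fin.tail])
    (Finsupp.single 0 1)
  rw [MvPolynomial.coeff_sub, MvPolynomial.coeff_sum, Finset.sum_eq_zero, sub_zero] at h1
  · simp only [MvPolynomial.coeff_X] at h1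
    exact (Ideal.ne_top_iff_one _).1 (maximalIdeal.isMaximal R).ne_top (hm h1)
  · intro i _
    rw [MvPolynomial.coeff_C_mul, MvPolynomial.coeff_X', if_neg, mul_zero]
    intro h
    have := DFunLike.congr_fun h 0
    simp [Finsupp.single_apply] at this

def gg {R : Type*} [CommRing R] {d : ℕ} (x : Fin (d + 2) → R) : ℕ → Ideal R
  | 0 => NF x 1
  | n + 1 => Ideal.span {x 1} * NF x n ⊔ NF x (n + 2)

theorem gg_mul {R : Type*} [CommRing R] [IsNoetherianRing R] {d : ℕ} (x : Fin (d + 2) → R) (i n : ℕ) :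
    sp x ^ i * gg x n ≤ gg x (i + n) := by
  rcases n with _ | n
  · rcases i with _ | i
    · simp
    · exact (pow_mul_NF_le (i + 1) 1).trans (le_sup_of_le_right (le_of_eq rfl))
  · show sp x ^ i * (Ideal.span {x 1} * NF x n ⊔ NF x (n + 2)) ≤ Ideal.span {x 1} * NF x (i + n) ⊔ NF x (i + n + 2)
    rw [Ideal.mul_sup]
    refine sup_le_sup ?_ (pow_mul_NF_le i (n + 2))
    rw [mul_left_comm]
    exact Ideal.mul_mono_right (pow_mul_NF_le i n)

theorem exists_gen {R : Type*} [CommRing R] [IsLocalRing R] [IsNoetherianRing R] [Infinite (ResidueField R)] {d : ℕ}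
    {x : Fin (d + 2) → R} (hx : QR x) (hm : sp x ≤ maximalIdeal R) {c : ℕ} (hc : ∀ n, NF x (n + c) ≤ sp x ^ n) :
    ∃ x' : Fin (d + 2) → R, sp x = sp x' ∧ ∃ n0, SUPR x' n0 := by
  have hspx : sp x = Ideal.span {x 0} ⊔ sp (Fin.tail x) := by
    rw [← sp_cons, Fin.cons_self_tail]
  obtain ⟨z, hz, hzW, n0, h⟩ := filt_reg (J := sp x) (f := NF x) (g := gg x) (fun i n => pow_mul_NF_le i n)
    (gg_mul x) hc (maximalIdeal R * Ideal.span {x 0} ⊔ sp (Fin.tail x)) (by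
      intro h
      have h0 : x 0 ∈ sp x := Ideal.subset_span ⟨0, rfl⟩
      obtain ⟨p, hp, b, hb, e⟩ := Submodule.mem_sup.1 (h h0)
      obtain ⟨a, ha, rfl⟩ := Ideal.mem_mul_span_singleton.1 hp
      have hu : IsUnit (1 - a) := by
        by_contra hu
        have := Ideal.add_mem _ ((mem_maximalIdeal _).2 hu) ha
        rw [sub_add_cancel] at this
        exact (Ideal.ne_top_iff_one _).1 (maximalIdeal.isMaximal R).ne_top this
      refine x0_notMem hx hm ((Ideal.unit_mul_mem_iff_mem _ hu).1 ?_)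
      have : (1 - a) * x 0 = b := by linear_combination -e
      rw [this]; exact hb)
  obtain ⟨p, hp, b, hb, e⟩ := Submodule.mem_sup.1 (hspx ▸ hz)
  obtain ⟨a, rfl⟩ := Ideal.mem_span_singleton'.1 hp
  have hu : IsUnit a := by
    by_contra hu
    exact hzW (e ▸ Submodule.add_mem_sup (Ideal.mem_mul_span_singleton.2 ⟨a, hu, rfl⟩) hb)
  have hsp : sp x = sp (Fin.cons z (Fin.tail x) : Fin (d + 2) → R) := by
    rw [sp_cons]
    refine le_antisymm ?_ (sup_le ((Ideal.span_singleton_le_iff_mem _).2 hz) (hspx ▸ le_sup_right))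
    rw [hspx]
    refine sup_le ((Ideal.span_singleton_le_iff_mem _).2 ((Ideal.unit_mul_mem_iff_mem _ hu).1 ?_)) le_sup_right
    have : a * x 0 = z - b := by rw [← e]; ring
    rw [this]
    exact Ideal.sub_mem _ (Ideal.mem_sup_left (Ideal.mem_span_singleton_self z)) (Ideal.mem_sup_right hb)
  refine ⟨Fin.cons z (Fin.tail x), hsp, n0, ?_⟩
  have hNF : NF (Fin.cons z (Fin.tail x) : Fin (d + 2) → R) = NF x := by
    funext n; rw [NF, NF, hsp]
  intro k hk r hr u hu f hf e
  rw [hNF] at *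
  have e0 : (Fin.cons z (Fin.tail x) : Fin (d + 2) → R) 0 = z := rfl
  have e1 : (Fin.cons z (Fin.tail x) : Fin (d + 2) → R) 1 = x 1 := rfl
  rw [e0, e1] at e
  rw [e1]
  have h1 : r ∈ gg x (k + 1) := h (k + 1) (by omega) r hr (by
    rw [e]
    exact Submodule.add_mem_sup (Ideal.mul_mem_mul (Ideal.mem_span_singleton_self _) hu) hf)
  obtain ⟨p, hp, f', hf', e'⟩ := Submodule.mem_sup.1 h1
  obtain ⟨w, hw, rfl⟩ := Ideal.mem_span_singleton_mul.1 hp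
  exact ⟨w, hw, f', hf', e'.symm⟩

theorem cl_all (k : ℕ) : Cl.{u} (k + 3) := by
  induction k with
  | zero => exact cl_three
  | succ k ih =>
    intro R _ _ _ _ x hx N hN hm hc hh n
    obtain ⟨c, hc⟩ := hc
    obtain ⟨x', hs, n0, h⟩ := exists_gen (d := k + 2) hx hm hc
    have hNF : NF x = NF x' := by
      funext n; rw [NF, NF, hs]
    have hx' := qr_change hx hs
    rw [hs] at hN hm
    rw [hNF, hs]
    refine cl_step (d := k + 2) ih hx' hN hm ⟨c, fun n => ?_⟩ ?_ h n
    · rw [← hNF, ← hs]; exact hc n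
    · unfold HP; rw [← hNF]; exact hh

end NH

end

theorem e1_bounds_via_type
    (R : Type*) [CommRing R] [IsLocalRing R] [IsNoetherianRing R]
    (d : ℕ) (hd : 3 ≤ d) (hdim : ringKrullDim R = d)
    (hCM : IsCMLocal R) (hAU : AnalyticallyUnramified R)
    (hres : Infinite (ResidueField R))
    (t : ℕ) (ht : CMTypeData R d t)
    (I J : Ideal R) (hIm : intCl I = maximalIdeal R)
    (hJ : IsMinimalReduction d J I)
    (L : ℕ → ℕ) (e : ℕ → ℤ) (hHilb : NormalHilbertData d I L e)
    (he3 : e 3 = 0)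
    -- `ℓ = λ(Ī²/JĪ)`
    (ℓ : ℕ)
    (hℓ : mlen R (idealQuot (intCl (I ^ 2)) (J * intCl I)) = (ℓ : WithBot ℕ∞)) :
    e 0 - 1 + ℓ ≤ e 1 ∧ e 1 ≤ e 0 - 1 + t := by
  obtain ⟨k, rfl⟩ : ∃ k, d = k + 3 := ⟨d - 3, by omega⟩
  refine NH.assemble R (k + 3) hd hdim hCM t ht I J hIm hJ L e hHilb ℓ hℓ ?_
  rintro s hQ ⟨N, hN⟩ hm hF1 hL
  have hred : IsReduced (AdicCompletion (maximalIdeal R) R) := hAU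
  refine NH.cl_all k R s hQ N hN hm (NH.rees (d := k + 2) hQ hN hm hF1) ?_
  obtain ⟨-, N', hN'⟩ := hHilb
  exact ⟨e, N', he3, fun n hn => ⟨L n, hL n, hN' n hn⟩⟩
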